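/- Let n, n' ≥ 1, and let f, g : Matrix (Fin n) (Fin n) ℂ → Matrix (Fin n') (Fin n') ℂ be holomorphic polynomial maps that map Ω^III_n into Ω^III_{n'}, whose restrictions Ω^III_n → Ω^III_{n'} are proper, and which satisfy f(0) = g(0) = 0. Then there exist automorphisms τ of Ω^III_n and σ of Ω^III_{n'} with f = σ ∘ g ∘ τ on Ω^III_n if and only if there exist such automorphisms additionally satisfying τ(0) = 0 and σ(0) = 0. -/

import Mathlib

open Matrix
open scoped ComplexOrder

noncomputable section

attribute [local instance] Matrix.normedAddCommGroup Matrix.normedSpace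

/-- The type III classical bounded symmetric domain `Ω^II_n` of symmetric matrices. -/
def OmegaIII (n : ℕ) : Set (Matrix (Fin n) (Fin n) ℂ) :=
  {Z | Zᵀ = Z ∧ (1 - Z * Zᴴ).PosDef}

/-- `f` is a holomorphic polynomial map between complex matrix spaces. -/
def IsPolyMapIII {n n' : ℕ}
    (f : Matrix (Fin n) (Fin n) ℂ → Matrix (Fin n') (Fin n') ℂ) : Prop :=
  ∀ i j, ∃ p : MvPolynomial (Fin n × Fin n) ℂ,
    ∀ Z, f Z i j = MvPolynomial.eval (fun q => Z q.1 q.2) p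

/-- Properness of the restriction `Ω₁ → Ω₂`. -/
def IsProperOn {E F : Type*} [TopologicalSpace E] [TopologicalSpace F]
    (f : E → F) (Ω₁ : Set E) (Ω₂ : Set F) : Prop :=
  ∀ K : Set F, K ⊆ Ω₂ → IsCompact K → IsCompact (Ω₁ ∩ f ⁻¹' K)

/-- `τ` is an automorphism of the domain `Ω`: a holomorphic bijection of `Ω` onto itself
with holomorphic inverse. -/
def IsAutomorphismOf {E : Type*} [NormedAddCommGroup E] [NormedSpace ℂ E]
    (Ω : Set E) (τ : E → E) : Prop :=
  Set.MapsTo τ Ω Ω ∧ DifferentiableOn ℂ τ Ω ∧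
    ∃ τinv : E → E, Set.MapsTo τinv Ω Ω ∧ DifferentiableOn ℂ τinv Ω ∧
      (∀ z ∈ Ω, τinv (τ z) = z) ∧ (∀ z ∈ Ω, τ (τinv z) = z)

/-- Square complex matrices of size `n`. -/
abbrev CMat (n : ℕ) := Matrix (Fin n) (Fin n) ℂ

/-- The Euclidean norm of a complex vector. -/
def l2norm {ι : Type*} [Fintype ι] (x : ι → ℂ) : ℝ := ‖(WithLp.toLp 2 x : EuclideanSpace ℂ ι)‖

/-- The spectral norm of a square complex matrix. -/
def spNorm {ι : Type*} [Fintype ι] [DecidableEq ι] (A : Matrix ι ι ℂ) : ℝ :=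
  ‖Matrix.toEuclideanCLM (n := ι) (𝕜 := ℂ) A‖

section Norms

variable {ι : Type*} [Fintype ι]

lemma l2norm_nonneg (x : ι → ℂ) : 0 ≤ l2norm x := norm_nonneg _

lemma l2norm_sq (x : ι → ℂ) : l2norm x ^ 2 = ∑ i, ‖x i‖ ^ 2 := by
  simp [l2norm, EuclideanSpace.norm_sq_eq]

lemma l2norm_zero : l2norm (0 : ι → ℂ) = 0 := by simp [l2norm]

lemma l2norm_eq_zero {x : ι → ℂ} : l2norm x = 0 ↔ x = 0 := by
  simp [l2norm]

lemma l2norm_pos {x : ι → ℂ} (hx : x ≠ 0) : 0 < l2norm x :=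
  lt_of_le_of_ne (l2norm_nonneg x) (fun h => hx (l2norm_eq_zero.1 h.symm))

lemma l2norm_add_le (x y : ι → ℂ) : l2norm (x + y) ≤ l2norm x + l2norm y := by
  simpa [l2norm] using norm_add_le (WithLp.toLp 2 x : EuclideanSpace ℂ ι) (WithLp.toLp 2 y)

lemma l2norm_smul (c : ℂ) (x : ι → ℂ) : l2norm (c • x) = ‖c‖ * l2norm x := by
  simp [l2norm, norm_smul]

lemma star_dotProduct_self (x : ι → ℂ) : star x ⬝ᵥ x = ((l2norm x ^ 2 : ℝ) : ℂ) := by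
  rw [l2norm_sq, dotProduct]
  push_cast
  refine Finset.sum_congr rfl fun i _ => ?_
  simp only [Pi.star_apply, RCLike.star_def]
  exact Complex.conj_mul' (x i)

lemma norm_star_dotProduct_le (x y : ι → ℂ) : ‖star x ⬝ᵥ y‖ ≤ l2norm x * l2norm y := by
  have := norm_inner_le_norm (𝕜 := ℂ) (WithLp.toLp 2 x : EuclideanSpace ℂ ι) (WithLp.toLp 2 y)
  simpa [l2norm, EuclideanSpace.inner_eq_star_dotProduct, dotProduct_comm] using this

lemma norm_apply_le_l2norm (x : ι → ℂ) (i : ι) : ‖x i‖ ≤ l2norm x := by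
  simpa [l2norm] using PiLp.norm_apply_le (WithLp.toLp 2 x : EuclideanSpace ℂ ι) i

lemma star_mulVec_star (A : Matrix ι ι ℂ) (x : ι → ℂ) :
    star (A *ᵥ star x) = Aᴴᵀ *ᵥ x := by
  ext i
  simp [mulVec, dotProduct, conjTranspose_apply]

variable [DecidableEq ι]

lemma l2norm_single (i : ι) (c : ℂ) : l2norm (Pi.single i c) = ‖c‖ := by
  rw [← sq_eq_sq₀ (l2norm_nonneg _) (norm_nonneg _), l2norm_sq]
  rw [Finset.sum_eq_single i] <;> simp +contextual

lemma spNorm_nonneg (A : Matrix ι ι ℂ) : 0 ≤ spNorm A := norm_nonneg _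

lemma l2norm_mulVec_le (A : Matrix ι ι ℂ) (x : ι → ℂ) :
    l2norm (A *ᵥ x) ≤ spNorm A * l2norm x := by
  have := (Matrix.toEuclideanCLM (n := ι) (𝕜 := ℂ) A).le_opNorm (WithLp.toLp 2 x)
  simpa [l2norm, spNorm, Matrix.toEuclideanCLM_toLp] using this

lemma spNorm_le_of {A : Matrix ι ι ℂ} {c : ℝ} (hc : 0 ≤ c)
    (h : ∀ x, l2norm (A *ᵥ x) ≤ c * l2norm x) : spNorm A ≤ c := by
  refine ContinuousLinearMap.opNorm_le_bound _ hc fun x => ?_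
  have := h (WithLp.ofLp x)
  simpa [l2norm, ← Matrix.toEuclideanCLM_toLp] using this

lemma spNorm_le_one_of {A : Matrix ι ι ℂ} (h : ∀ x, l2norm (A *ᵥ x) ≤ l2norm x) :
    spNorm A ≤ 1 :=
  spNorm_le_of zero_le_one (by simpa using h)

lemma l2norm_mulVec_le_of_le_one {A : Matrix ι ι ℂ} (h : spNorm A ≤ 1) (x : ι → ℂ) :
    l2norm (A *ᵥ x) ≤ l2norm x :=
  (l2norm_mulVec_le A x).trans (by nlinarith [l2norm_nonneg x])

lemma spNorm_zero : spNorm (0 : Matrix ι ι ℂ) = 0 := by simp [spNorm]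

lemma spNorm_eq_zero {A : Matrix ι ι ℂ} : spNorm A = 0 ↔ A = 0 := by
  simp [spNorm]

lemma spNorm_one_le : spNorm (1 : Matrix ι ι ℂ) ≤ 1 :=
  spNorm_le_one_of fun x => by simp

lemma spNorm_smul (c : ℂ) (A : Matrix ι ι ℂ) : spNorm (c • A) = ‖c‖ * spNorm A := by
  simp [spNorm, norm_smul]

lemma spNorm_mul_le (A B : Matrix ι ι ℂ) : spNorm (A * B) ≤ spNorm A * spNorm B := by
  simpa [spNorm] using norm_mul_le (Matrix.toEuclideanCLM (n := ι) (𝕜 := ℂ) A)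
    (Matrix.toEuclideanCLM (n := ι) (𝕜 := ℂ) B)

lemma spNorm_mul_le_one {A B : Matrix ι ι ℂ} (hA : spNorm A ≤ 1) (hB : spNorm B ≤ 1) :
    spNorm (A * B) ≤ 1 :=
  (spNorm_mul_le A B).trans (mul_le_one₀ hA (spNorm_nonneg B) hB)

lemma spNorm_conjTranspose (A : Matrix ι ι ℂ) : spNorm Aᴴ = spNorm A := by
  rw [spNorm, ← star_eq_conjTranspose, map_star]
  exact norm_star (E := EuclideanSpace ℂ ι →L[ℂ] EuclideanSpace ℂ ι) _

lemma spNorm_conjTranspose_mul_self (A : Matrix ι ι ℂ) :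
    spNorm (Aᴴ * A) = spNorm A * spNorm A := by
  simp only [spNorm, ← star_eq_conjTranspose, map_mul, map_star]
  exact CStarRing.norm_star_mul_self (E := EuclideanSpace ℂ ι →L[ℂ] EuclideanSpace ℂ ι)

lemma norm_entry_le_spNorm (A : Matrix ι ι ℂ) (i j : ι) : ‖A i j‖ ≤ spNorm A := by
  have h := (norm_apply_le_l2norm (A *ᵥ Pi.single j 1) i).trans (l2norm_mulVec_le A _)
  simpa [l2norm_single] using h

lemma spNorm_diagonal_le {d : ι → ℂ} {c : ℝ} (hc : 0 ≤ c) (h : ∀ i, ‖d i‖ ≤ c) :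
    spNorm (diagonal d) ≤ c := by
  refine spNorm_le_of hc fun x => ?_
  rw [← sq_le_sq₀ (l2norm_nonneg _) (mul_nonneg hc (l2norm_nonneg _)), mul_pow, l2norm_sq,
    l2norm_sq, Finset.mul_sum]
  refine Finset.sum_le_sum fun i _ => ?_
  rw [mulVec_diagonal, norm_mul, mul_pow]
  gcongr
  exact h i

lemma spNorm_diagonal_lt_one {d : ι → ℂ} (h : ∀ i, ‖d i‖ < 1) : spNorm (diagonal d) < 1 := by
  cases isEmpty_or_nonempty ι
  · have : (diagonal d : Matrix ι ι ℂ) = 0 := Subsingleton.elim _ _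
    rw [this, spNorm_zero]
    exact zero_lt_one
  · obtain ⟨i, -, hi⟩ := Finset.exists_max_image Finset.univ (fun i => ‖d i‖)
      Finset.univ_nonempty
    exact (spNorm_diagonal_le (norm_nonneg (d i)) fun j => hi j (Finset.mem_univ j)).trans_lt (h i)

lemma spNorm_le_one_of_conjTranspose_mul_self {U : Matrix ι ι ℂ} (h : Uᴴ * U = 1) :
    spNorm U ≤ 1 := by
  have h1 := spNorm_conjTranspose_mul_self U
  rw [h] at h1
  nlinarith [spNorm_one_le (ι := ι), spNorm_nonneg U]

lemma spNorm_eq_of_unitary {U A W : Matrix ι ι ℂ} (hU : Uᴴ * U = 1) (hW : Wᴴ * W = 1) :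
    spNorm (U * A * W) = spNorm A := by
  have hU' : spNorm U ≤ 1 := spNorm_le_one_of_conjTranspose_mul_self hU
  have hW' : spNorm W ≤ 1 := spNorm_le_one_of_conjTranspose_mul_self hW
  have bound : ∀ X B Y : Matrix ι ι ℂ, spNorm X ≤ 1 → spNorm Y ≤ 1 →
      spNorm (X * B * Y) ≤ spNorm B := fun X B Y hX hY =>
    calc spNorm (X * B * Y) ≤ spNorm (X * B) * spNorm Y := spNorm_mul_le _ _
      _ ≤ spNorm (X * B) * 1 := by gcongr; exact spNorm_nonneg _
      _ ≤ spNorm X * spNorm B := by rw [mul_one]; exact spNorm_mul_le _ _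
      _ ≤ 1 * spNorm B := by gcongr; exact spNorm_nonneg _
      _ = spNorm B := one_mul _
  refine le_antisymm (bound _ _ _ hU' hW') ?_
  have h := bound Uᴴ (U * A * W) Wᴴ (by rwa [spNorm_conjTranspose]) (by rwa [spNorm_conjTranspose])
  have hW2 : W * Wᴴ = 1 := mul_eq_one_comm.1 hW
  rwa [show Uᴴ * (U * A * W) * Wᴴ = (Uᴴ * U) * A * (W * Wᴴ) by simp only [Matrix.mul_assoc],
    hU, hW2, Matrix.one_mul, Matrix.mul_one] at h

lemma continuous_spNorm : Continuous (spNorm : Matrix ι ι ℂ → ℝ) := by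
  have h : Continuous (Matrix.toEuclideanCLM (n := ι) (𝕜 := ℂ)) :=
    LinearMap.continuous_of_finiteDimensional
      ((Matrix.toEuclideanCLM (n := ι) (𝕜 := ℂ)).toAlgEquiv.toLinearMap)
  exact h.norm

lemma l2norm_mulVec_lt {A : Matrix ι ι ℂ} (h : spNorm A < 1) {x : ι → ℂ} (hx : x ≠ 0) :
    l2norm (A *ᵥ x) < l2norm x :=
  (l2norm_mulVec_le A x).trans_lt (by nlinarith [l2norm_pos hx])

lemma star_dotProduct_one_sub (A : Matrix ι ι ℂ) (x : ι → ℂ) :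
    star x ⬝ᵥ ((1 - Aᴴ * A) *ᵥ x) = ((l2norm x ^ 2 - l2norm (A *ᵥ x) ^ 2 : ℝ) : ℂ) := by
  rw [sub_mulVec, one_mulVec, dotProduct_sub, ← mulVec_mulVec, dotProduct_mulVec (star x),
    ← star_mulVec, star_dotProduct_self, star_dotProduct_self]
  push_cast
  rfl

lemma isHermitian_one_sub (A : Matrix ι ι ℂ) : (1 - Aᴴ * A).IsHermitian := by
  simp [IsHermitian, conjTranspose_sub, conjTranspose_mul]

lemma posDef_one_sub_iff (A : Matrix ι ι ℂ) : (1 - Aᴴ * A).PosDef ↔ spNorm A < 1 := by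
  constructor
  · intro h
    have h1 : ∀ x : ι → ℂ, x ≠ 0 → l2norm (A *ᵥ x) < l2norm x := by
      intro x hx
      have := h.dotProduct_mulVec_pos hx
      rw [star_dotProduct_one_sub, Complex.zero_lt_real] at this
      nlinarith [l2norm_nonneg x, l2norm_nonneg (A *ᵥ x)]
    cases isEmpty_or_nonempty ι
    · rw [show A = 0 from Subsingleton.elim _ _, spNorm_zero]
      exact zero_lt_one
    · let T := Matrix.toEuclideanCLM (n := ι) (𝕜 := ℂ) A
      obtain ⟨x, hx, hmax⟩ := (isCompact_sphere (0 : EuclideanSpace ℂ ι) 1).exists_isMaxOn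
        (NormedSpace.sphere_nonempty.2 zero_le_one) (T.continuous.norm.continuousOn)
      have hx1 : ‖x‖ = 1 := by simpa using hx
      have hlt : ‖T x‖ < 1 := by
        have := h1 (WithLp.ofLp x) (by
          intro h0
          have : x = 0 := by simpa using h0
          simp [this] at hx1)
        simpa [l2norm, ← Matrix.toEuclideanCLM_toLp, hx1] using this
      refine lt_of_le_of_lt (ContinuousLinearMap.opNorm_le_bound _ (norm_nonneg (T x)) ?_) hlt
      intro y
      by_cases hy : y = 0
      · simp [hy]
      · have hy' : ‖y‖ ≠ 0 := norm_ne_zero_iff.2 hy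
        have hm := hmax (a := ((‖y‖⁻¹ : ℝ) : ℂ) • y) (by
          simp [norm_smul, hy'])
        simp only [map_smul, norm_smul, Set.mem_ofPred_eq] at hm
        have h3 : ‖((‖y‖⁻¹ : ℝ) : ℂ)‖ = ‖y‖⁻¹ := by simp
        rw [h3, inv_mul_le_iff₀ (norm_pos_iff.2 hy)] at hm
        rw [mul_comm]
        exact hm
  · intro h
    refine PosDef.of_dotProduct_mulVec_pos (isHermitian_one_sub A) fun x hx => ?_
    rw [star_dotProduct_one_sub, Complex.zero_lt_real]
    have := l2norm_mulVec_lt h hx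
    nlinarith [l2norm_nonneg x, l2norm_nonneg (A *ᵥ x)]

lemma isUnit_det_one_sub_of_spNorm_lt_one {A : Matrix ι ι ℂ} (h : spNorm A < 1) :
    IsUnit (1 - A).det := by
  rw [isUnit_iff_ne_zero]
  intro h0
  obtain ⟨x, hx, hx0⟩ := exists_mulVec_eq_zero_iff.2 h0
  rw [sub_mulVec, one_mulVec, sub_eq_zero] at hx0
  have := l2norm_mulVec_lt h hx
  rw [← hx0] at this
  exact lt_irrefl _ this

end Norms

lemma mem_OmegaIII_iff {n : ℕ} {Z : CMat n} : Z ∈ OmegaIII n ↔ Zᵀ = Z ∧ spNorm Z < 1 := by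
  have : Z * Zᴴ = (Zᴴ)ᴴ * Zᴴ := by rw [conjTranspose_conjTranspose]
  rw [OmegaIII, Set.mem_ofPred_eq, this, posDef_one_sub_iff, spNorm_conjTranspose]

section MatrixCalculus

variable {E : Type*} [NormedAddCommGroup E] [NormedSpace ℂ E]
variable {l m n : Type*} [Fintype n]

lemma differentiableWithinAt_matrix_iff {F : E → Matrix m n ℂ} {s : Set E} {x : E} :
    DifferentiableWithinAt ℂ F s x ↔
      ∀ i j, DifferentiableWithinAt ℂ (fun x => F x i j) s x := by
  refine Iff.trans (differentiableWithinAt_pi (F' := fun _ : m => n → ℂ)) ?_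
  refine forall_congr' fun i => ?_
  exact differentiableWithinAt_pi

lemma differentiableAt_matrix_iff {F : E → Matrix m n ℂ} {x : E} :
    DifferentiableAt ℂ F x ↔ ∀ i j, DifferentiableAt ℂ (fun x => F x i j) x := by
  simp only [← differentiableWithinAt_univ, differentiableWithinAt_matrix_iff]

lemma differentiable_matrix_iff {F : E → Matrix m n ℂ} :
    Differentiable ℂ F ↔ ∀ i j, Differentiable ℂ (fun x => F x i j) := by
  simp only [Differentiable, differentiableAt_matrix_iff]
  exact ⟨fun h i j x => h x i j, fun h x i j => h i j x⟩

lemma Differentiable.matrix_mulVec {F : E → Matrix m n ℂ} (hF : Differentiable ℂ F) (v : n → ℂ) :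
    Differentiable ℂ (fun x => F x *ᵥ v) := by
  rw [differentiable_pi]
  intro i
  simp only [mulVec, dotProduct]
  exact Differentiable.fun_sum fun k _ => ((differentiable_matrix_iff.1 hF) i k).mul_const _

lemma Differentiable.entry {F : E → Matrix m n ℂ} (hF : Differentiable ℂ F) (i : m) (j : n) :
    Differentiable ℂ (fun x => F x i j) := differentiable_matrix_iff.1 hF i j

variable [Fintype m]

lemma DifferentiableWithinAt.matrix_mul {F : E → Matrix l m ℂ} {G : E → Matrix m n ℂ}
    {s : Set E} {x : E} (hF : DifferentiableWithinAt ℂ F s x)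
    (hG : DifferentiableWithinAt ℂ G s x) :
    DifferentiableWithinAt ℂ (fun x => F x * G x) s x := by
  rw [differentiableWithinAt_matrix_iff] at *
  intro i j
  simp only [Matrix.mul_apply]
  exact DifferentiableWithinAt.fun_sum fun k _ => (hF i k).mul (hG k j)

lemma DifferentiableAt.matrix_mul {F : E → Matrix l m ℂ} {G : E → Matrix m n ℂ}
    {x : E} (hF : DifferentiableAt ℂ F x) (hG : DifferentiableAt ℂ G x) :
    DifferentiableAt ℂ (fun x => F x * G x) x := by
  rw [← differentiableWithinAt_univ] at *
  exact hF.matrix_mul hG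

lemma Differentiable.matrix_mul {F : E → Matrix l m ℂ} {G : E → Matrix m n ℂ}
    (hF : Differentiable ℂ F) (hG : Differentiable ℂ G) :
    Differentiable ℂ (fun x => F x * G x) := fun x => (hF x).matrix_mul (hG x)

lemma DifferentiableWithinAt.matrix_det [DecidableEq n] {F : E → Matrix n n ℂ}
    {s : Set E} {x : E} (hF : DifferentiableWithinAt ℂ F s x) :
    DifferentiableWithinAt ℂ (fun x => (F x).det) s x := by
  rw [differentiableWithinAt_matrix_iff] at hF
  simp only [Matrix.det_apply]
  refine DifferentiableWithinAt.fun_sum fun σ _ => DifferentiableWithinAt.fun_const_smul ?_ _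
  exact (HasFDerivWithinAt.finsetProd fun i _ => (hF _ _).hasFDerivWithinAt).differentiableWithinAt

lemma DifferentiableWithinAt.matrix_inv [DecidableEq n] {F : E → Matrix n n ℂ}
    {s : Set E} {x : E} (hF : DifferentiableWithinAt ℂ F s x) (hx : (F x).det ≠ 0) :
    DifferentiableWithinAt ℂ (fun x => (F x)⁻¹) s x := by
  have h1 : DifferentiableWithinAt ℂ (fun x => (F x).adjugate) s x := by
    rw [differentiableWithinAt_matrix_iff]
    intro i j
    simp only [adjugate_apply]
    refine DifferentiableWithinAt.matrix_det ?_
    rw [differentiableWithinAt_matrix_iff] at *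
    intro k l
    by_cases hk : k = j
    · subst hk
      simp only [updateRow_self]
      exact differentiableWithinAt_const _
    · simpa [updateRow_ne hk] using hF k l
  simp only [Matrix.inv_def, Ring.inverse_eq_inv']
  exact (hF.matrix_det.fun_inv hx).smul h1

lemma DifferentiableAt.matrix_inv [DecidableEq n] {F : E → Matrix n n ℂ} {x : E}
    (hF : DifferentiableAt ℂ F x) (hx : (F x).det ≠ 0) :
    DifferentiableAt ℂ (fun x => (F x)⁻¹) x := by
  rw [← differentiableWithinAt_univ] at *
  exact hF.matrix_inv hx

lemma differentiable_line (A B : Matrix m n ℂ) : Differentiable ℂ (fun ζ : ℂ => A + ζ • B) :=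
  (differentiable_const A).add (differentiable_id.smul_const B)

end MatrixCalculus

section Identity

variable {E : Type*} [NormedAddCommGroup E] [NormedSpace ℂ E] [CompleteSpace E]

lemma Differentiable.eq_of_frequently {φ ψ : ℂ → E} (hφ : Differentiable ℂ φ)
    (hψ : Differentiable ℂ ψ) {z₀ : ℂ} (h : ∃ᶠ z in nhdsWithin z₀ {z₀}ᶜ, φ z = ψ z) : φ = ψ :=
  AnalyticOnNhd.eq_of_frequently_eq (fun z _ => hφ.analyticAt z) (fun z _ => hψ.analyticAt z) h

lemma Differentiable.eq_of_eventually {φ ψ : ℂ → E} (hφ : Differentiable ℂ φ)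
    (hψ : Differentiable ℂ ψ) {z₀ : ℂ} (h : ∀ᶠ z in nhds z₀, φ z = ψ z) : φ = ψ :=
  hφ.eq_of_frequently hψ (h.filter_mono nhdsWithin_le_nhds).frequently

lemma Differentiable.eq_of_ne_zero {φ ψ : ℂ → E} (hφ : Differentiable ℂ φ)
    (hψ : Differentiable ℂ ψ) {q : ℂ → ℂ} (hq : Continuous q) {z₀ : ℂ} (h0 : q z₀ ≠ 0)
    (h : ∀ z, q z ≠ 0 → φ z = ψ z) : φ = ψ :=
  hφ.eq_of_eventually hψ ((hq.continuousAt.eventually_ne h0).mono h)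

lemma Differentiable.eq_of_circle {φ ψ : ℂ → E} (hφ : Differentiable ℂ φ)
    (hψ : Differentiable ℂ ψ) (h : ∀ z : ℂ, ‖z‖ = 1 → φ z = ψ z) : φ = ψ := by
  refine hφ.eq_of_frequently hψ (z₀ := 1) ?_
  have hc : Continuous fun t : ℝ => Complex.exp (t * Complex.I) := by fun_prop
  have ht : Filter.Tendsto (fun t : ℝ => Complex.exp (t * Complex.I)) (nhdsWithin 0 (Set.Ioi 0))
      (nhdsWithin 1 {1}ᶜ) := by
    refine tendsto_nhdsWithin_iff.2 ⟨?_, ?_⟩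
    · have := hc.tendsto 0
      simp only [Complex.ofReal_zero, zero_mul, Complex.exp_zero] at this
      exact this.mono_left nhdsWithin_le_nhds
    · filter_upwards [Ioo_mem_nhdsGT (show (0 : ℝ) < 1 by norm_num)] with t ht h1
      rw [Set.mem_singleton_iff, Complex.exp_eq_one_iff] at h1
      obtain ⟨k, hk⟩ := h1
      have h2 : (t : ℂ) = ((k * (2 * Real.pi) : ℝ) : ℂ) := by
        have := mul_right_cancel₀ Complex.I_ne_zero
          (hk.trans (by ring : _ = (k * (2 * Real.pi) : ℂ) * Complex.I))
        rw [this]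
        push_cast
        rfl
      have h3 : t = k * (2 * Real.pi) := by exact_mod_cast h2
      have hk0 : 0 < k := by
        by_contra hk
        have : (k : ℝ) ≤ 0 := by exact_mod_cast not_lt.1 hk
        nlinarith [Real.pi_pos, ht.1]
      have : (1 : ℝ) ≤ k := by exact_mod_cast hk0
      nlinarith [Real.pi_gt_three, ht.2]
  exact ht.frequently (Filter.Eventually.frequently (Filter.Eventually.of_forall fun t =>
    h _ (Complex.norm_exp_ofReal_mul_I t)))

end Identity

section PolyMaps

variable {n m k : ℕ}

lemma IsPolyMapIII.differentiable_comp {E : Type*} [NormedAddCommGroup E] [NormedSpace ℂ E]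
    {f : CMat n → CMat m} (hf : IsPolyMapIII f) {γ : E → CMat n} (hγ : Differentiable ℂ γ) :
    Differentiable ℂ (fun x => f (γ x)) := by
  refine differentiable_matrix_iff.2 fun i j => ?_
  obtain ⟨p, hp⟩ := hf i j
  simp only [hp]
  clear hp
  induction p using MvPolynomial.induction_on with
  | C a => simp
  | add p q hp hq =>
    simp only [map_add]
    exact hp.add hq
  | mul_X p q hp =>
    simp only [map_mul, MvPolynomial.eval_X]
    exact hp.mul (hγ.entry q.1 q.2)

lemma IsPolyMapIII.continuous {f : CMat n → CMat m} (hf : IsPolyMapIII f) : Continuous f := by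
  refine continuous_matrix fun i j => ?_
  obtain ⟨p, hp⟩ := hf i j
  simp only [hp]
  exact (MvPolynomial.continuous_eval p).comp
    (continuous_pi fun q => continuous_id.matrix_elem q.1 q.2)

lemma IsPolyMapIII.comp {f : CMat m → CMat k} {g : CMat n → CMat m} (hf : IsPolyMapIII f)
    (hg : IsPolyMapIII g) : IsPolyMapIII (fun Z => f (g Z)) := by
  intro i j
  obtain ⟨p, hp⟩ := hf i j
  choose q hq using hg
  refine ⟨MvPolynomial.bind₁ (fun r : Fin m × Fin m => q r.1 r.2) p, fun Z => ?_⟩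
  refine (hp (g Z)).trans ?_
  simp only [hq]
  exact (MvPolynomial.eval₂Hom_bind₁ _ _ _ _).symm

lemma isPolyMapIII_const (C : CMat m) : IsPolyMapIII (fun _ : CMat n => C) :=
  fun i j => ⟨MvPolynomial.C (C i j), fun Z => by simp⟩

lemma isPolyMapIII_id : IsPolyMapIII (fun Z : CMat n => Z) :=
  fun i j => ⟨MvPolynomial.X (i, j), fun Z => by simp⟩

lemma IsPolyMapIII.add {f g : CMat n → CMat m} (hf : IsPolyMapIII f) (hg : IsPolyMapIII g) :
    IsPolyMapIII (fun Z => f Z + g Z) := fun i j => by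
  obtain ⟨p, hp⟩ := hf i j
  obtain ⟨q, hq⟩ := hg i j
  exact ⟨p + q, fun Z => by simp [hp, hq]⟩

lemma IsPolyMapIII.mul {f g : CMat n → CMat m} (hf : IsPolyMapIII f) (hg : IsPolyMapIII g) :
    IsPolyMapIII (fun Z => f Z * g Z) := fun i j => by
  choose p hp using hf
  choose q hq using hg
  exact ⟨∑ k, p i k * q k j, fun Z => by simp [hp, hq, mul_apply]⟩

lemma isPolyMapIII_linear (L : CMat n →ₗ[ℂ] CMat m) : IsPolyMapIII (fun Z => L Z) := fun i j => by
  refine ⟨∑ r : Fin n × Fin n, MvPolynomial.C (L (single r.1 r.2 1) i j) * MvPolynomial.X r,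
    fun Z => ?_⟩
  conv_lhs => rw [matrix_eq_sum_single Z]
  simp only [map_sum, Matrix.sum_apply, MvPolynomial.eval_mul, MvPolynomial.eval_C,
    MvPolynomial.eval_X, Fintype.sum_prod_type]
  refine Finset.sum_congr rfl fun a _ => Finset.sum_congr rfl fun b _ => ?_
  rw [show single a b (Z a b) = Z a b • single a b (1 : ℂ) by simp, map_smul]
  simp [mul_comm]

end PolyMaps

section PolyOmega

variable {n m : ℕ}

lemma smul_mem_OmegaIII {Z : CMat n} (hZ : Zᵀ = Z) {c : ℂ} (h : ‖c‖ * spNorm Z < 1) :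
    c • Z ∈ OmegaIII n :=
  mem_OmegaIII_iff.2 ⟨by rw [transpose_smul, hZ], by rwa [spNorm_smul]⟩

lemma zero_mem_OmegaIII : (0 : CMat n) ∈ OmegaIII n :=
  mem_OmegaIII_iff.2 ⟨transpose_zero, by rw [spNorm_zero]; exact zero_lt_one⟩

lemma eventually_smul_mem_OmegaIII {Z : CMat n} (hZ : Zᵀ = Z) :
    ∀ᶠ c : ℂ in nhds 0, c • Z ∈ OmegaIII n := by
  have : Continuous fun c : ℂ => ‖c‖ * spNorm Z := by fun_prop
  have h := this.continuousAt (x := 0)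
  filter_upwards [h.eventually_lt_const (by simp : ‖(0 : ℂ)‖ * spNorm Z < 1)] with c hc
  exact smul_mem_OmegaIII hZ hc

/-- A polynomial map sending `OmegaIII n` into the symmetric matrices preserves symmetry. -/
lemma transpose_apply_of_mapsTo {f : CMat n → CMat m} (hf : IsPolyMapIII f)
    (hmaps : Set.MapsTo f (OmegaIII n) (OmegaIII m)) {Z : CMat n} (hZ : Zᵀ = Z) :
    (f Z)ᵀ = f Z := by
  have hd : Differentiable ℂ fun c : ℂ => f (c • Z) :=
    hf.differentiable_comp (differentiable_id.smul_const Z)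
  have hdT : Differentiable ℂ fun c : ℂ => (f (c • Z))ᵀ :=
    differentiable_matrix_iff.2 fun i j => hd.entry j i
  have := hdT.eq_of_eventually hd (z₀ := 0) ((eventually_smul_mem_OmegaIII hZ).mono fun c hc =>
    (mem_OmegaIII_iff.1 (hmaps hc)).1)
  simpa using congrFun this 1

lemma spNorm_apply_le_one_of_mapsTo {f : CMat n → CMat m} (hf : Continuous f)
    (hmaps : Set.MapsTo f (OmegaIII n) (OmegaIII m)) {Z : CMat n} (hZ : Zᵀ = Z)
    (h1 : spNorm Z ≤ 1) : spNorm (f Z) ≤ 1 := by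
  have hc : Continuous fun r : ℝ => spNorm (f ((r : ℂ) • Z)) :=
    continuous_spNorm.comp (hf.comp (by fun_prop))
  have ht : Filter.Tendsto (fun r : ℝ => spNorm (f ((r : ℂ) • Z))) (nhdsWithin 1 (Set.Iio 1))
      (nhds (spNorm (f Z))) := by
    have := hc.tendsto 1
    simp only [Complex.ofReal_one, one_smul] at this
    exact this.mono_left nhdsWithin_le_nhds
  refine le_of_tendsto ht ?_
  filter_upwards [Ioo_mem_nhdsLT (show (0 : ℝ) < 1 by norm_num)] with r hr
  have : ‖(r : ℂ)‖ = r := by simp [abs_of_pos hr.1]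
  refine (mem_OmegaIII_iff.1 (hmaps (smul_mem_OmegaIII hZ ?_))).2.le
  rw [this]
  nlinarith [hr.1, hr.2, spNorm_nonneg Z]

end PolyOmega

section Takagi

variable {n : ℕ}

/-- If `a` is symmetric, the antilinear map `x ↦ a x̄` has an eigenvector with nonnegative
eigenvalue orthogonal to a given orthonormal family of such eigenvectors. -/
lemma exists_coneigenvector {a : CMat n} (ha : aᵀ = a) {k : ℕ} (hk : k < n)
    (v : Fin k → Fin n → ℂ) (s : Fin k → ℝ) (hv : ∀ i, a *ᵥ star (v i) = (s i : ℂ) • v i) :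
    ∃ (x : Fin n → ℂ) (t : ℝ), 0 ≤ t ∧ l2norm x = 1 ∧ a *ᵥ star x = (t : ℂ) • x ∧
      ∀ i, star (v i) ⬝ᵥ x = 0 := by
  set φ : (Fin n → ℂ) →ₗ[ℂ] (Fin k → ℂ) := mulVecLin (of fun i j => star (v i j)) with hφ
  have hφ_apply : ∀ x i, φ x i = star (v i) ⬝ᵥ x := fun x i => rfl
  have hT : ∀ x, x ∈ LinearMap.ker φ → a *ᵥ star x ∈ LinearMap.ker φ := by
    intro x hx
    rw [LinearMap.mem_ker] at hx ⊢
    ext i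
    have h0 : star (v i) ⬝ᵥ x = 0 := by rw [← hφ_apply, hx]; rfl
    rw [hφ_apply, dotProduct_mulVec, ← mulVec_transpose, ha, hv, smul_dotProduct]
    have : v i ⬝ᵥ star x = star (star (v i) ⬝ᵥ x) := by
      rw [star_dotProduct, star_star, dotProduct_comm]
    rw [this, h0]
    simp
  have hTT : ∀ x, a *ᵥ star (a *ᵥ star x) = (a * aᴴ) *ᵥ x := by
    intro x
    rw [star_mulVec_star, ← mulVec_mulVec]
    congr 2
    exact congrArg conjTranspose ha
  have hmaps : ∀ x ∈ LinearMap.ker φ, mulVecLin (a * aᴴ) x ∈ LinearMap.ker φ := by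
    intro x hx
    rw [mulVecLin_apply, ← hTT]
    exact hT _ (hT _ hx)
  have hne : LinearMap.ker φ ≠ ⊥ := LinearMap.ker_ne_bot_of_finrank_lt (by simpa using hk)
  have : Nontrivial (LinearMap.ker φ) := Submodule.nontrivial_iff_ne_bot.2 hne
  obtain ⟨μ, hμ⟩ := Module.End.exists_eigenvalue ((mulVecLin (a * aᴴ)).restrict hmaps)
  obtain ⟨⟨y, hyW⟩, hy⟩ := hμ.exists_hasEigenvector
  have hy0 : y ≠ 0 := fun h => hy.2 (Subtype.ext h)
  have hyμ : (a * aᴴ) *ᵥ y = μ • y := congrArg Subtype.val hy.apply_eq_smul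
  set t : ℝ := l2norm (aᴴ *ᵥ y) / l2norm y with ht
  have hypos := l2norm_pos hy0
  have ht0 : 0 ≤ t := div_nonneg (l2norm_nonneg _) (l2norm_nonneg _)
  have hμt : μ = (t : ℂ) ^ 2 := by
    have h1 : star y ⬝ᵥ ((a * aᴴ) *ᵥ y) = ((l2norm (aᴴ *ᵥ y) ^ 2 : ℝ) : ℂ) := by
      rw [← star_dotProduct_self, star_mulVec, ← mulVec_mulVec, dotProduct_mulVec,
        conjTranspose_conjTranspose]
    rw [hyμ, dotProduct_smul, star_dotProduct_self, smul_eq_mul] at h1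
    have h2 : ((l2norm y ^ 2 : ℝ) : ℂ) ≠ 0 := by
      exact_mod_cast (pow_pos hypos 2).ne'
    rw [eq_div_of_mul_eq h2 h1, ht]
    push_cast
    rw [div_pow]
  suffices h : ∃ x, x ≠ 0 ∧ a *ᵥ star x = (t : ℂ) • x ∧ x ∈ LinearMap.ker φ by
    obtain ⟨x, hx0, hx, hxW⟩ := h
    have hxpos := l2norm_pos hx0
    refine ⟨((l2norm x)⁻¹ : ℂ) • x, t, ht0, ?_, ?_, fun i => ?_⟩
    · rw [l2norm_smul, norm_inv, Complex.norm_real, Real.norm_of_nonneg hxpos.le,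
        inv_mul_cancel₀ hxpos.ne']
    · rw [star_smul, mulVec_smul, hx, smul_comm]
      simp
    · rw [dotProduct_smul, ← hφ_apply, LinearMap.mem_ker.1 hxW]
      simp
  by_cases h : a *ᵥ star y + (t : ℂ) • y = 0
  · refine ⟨Complex.I • y, smul_ne_zero Complex.I_ne_zero hy0, ?_, Submodule.smul_mem _ _ hyW⟩
    rw [star_smul, mulVec_smul, eq_neg_of_add_eq_zero_left h, smul_neg, ← neg_smul, smul_comm]
    simp
  · refine ⟨_, h, ?_, Submodule.add_mem _ (hT _ hyW) (Submodule.smul_mem _ _ hyW)⟩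
    rw [star_add, mulVec_add, hTT, hyμ, star_smul, mulVec_smul, hμt, smul_add, smul_smul, pow_two,
      add_comm]
    simp

lemma exists_orthonormal_coneigenvectors {a : CMat n} (ha : aᵀ = a) :
    ∀ k ≤ n, ∃ (v : Fin k → Fin n → ℂ) (s : Fin k → ℝ), (∀ i, 0 ≤ s i) ∧
      (∀ i, a *ᵥ star (v i) = (s i : ℂ) • v i) ∧
      ∀ i j, star (v i) ⬝ᵥ v j = if i = j then 1 else 0 := by
  intro k
  induction k with
  | zero => exact fun _ => ⟨Fin.elim0, Fin.elim0, fun i => i.elim0, fun i => i.elim0,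
      fun i => i.elim0⟩
  | succ k ih =>
    intro hk
    obtain ⟨v, s, hs, hv, ho⟩ := ih (Nat.le_of_succ_le hk)
    obtain ⟨x, t, ht, hx1, hx, hxo⟩ := exists_coneigenvector ha hk v s hv
    refine ⟨Fin.snoc v x, Fin.snoc s t, fun i => ?_, fun i => ?_, fun i j => ?_⟩
    · refine Fin.lastCases ?_ (fun i => ?_) i <;> simp [ht, hs]
    · refine Fin.lastCases ?_ (fun i => ?_) i
      · simpa using hx
      · simpa using hv i
    · have hxo' : ∀ i, star x ⬝ᵥ v i = 0 := fun i => by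
        rw [star_dotProduct, hxo, star_zero]
      refine Fin.lastCases ?_ (fun i => ?_) i <;> refine Fin.lastCases ?_ (fun j => ?_) j
      · simp [star_dotProduct_self, hx1]
      · simp [hxo', (Fin.castSucc_lt_last j).ne']
      · simp [hxo, (Fin.castSucc_lt_last i).ne]
      · simp [ho]

/-- Autonne–Takagi factorization of a complex symmetric matrix. -/
theorem exists_takagi {a : CMat n} (ha : aᵀ = a) :
    ∃ (U : CMat n) (d : Fin n → ℝ), Uᴴ * U = 1 ∧ (∀ i, 0 ≤ d i) ∧
      a = U * diagonal (fun i => (d i : ℂ)) * Uᵀ := by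
  obtain ⟨v, s, hs, hv, ho⟩ := exists_orthonormal_coneigenvectors ha n le_rfl
  have hU : (of v)ᵀᴴ * (of v)ᵀ = 1 := by
    ext i j
    rw [Matrix.one_apply, ← ho]
    rfl
  refine ⟨(of v)ᵀ, s, hU, hs, ?_⟩
  have h1 : a * ((of v)ᵀᴴ)ᵀ = (of v)ᵀ * diagonal (fun i => (s i : ℂ)) := by
    ext i j
    rw [mul_diagonal]
    have := congrFun (hv j) i
    simp only [Pi.smul_apply, smul_eq_mul] at this
    rw [transpose_apply, of_apply, mul_comm, ← this]
    rfl
  have h2 : ((of v)ᵀᴴ)ᵀ * ((of v)ᵀ)ᵀ = 1 := by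
    rw [← transpose_mul, mul_eq_one_comm.1 hU, transpose_one]
  rw [← h1, Matrix.mul_assoc, h2, Matrix.mul_one]

end Takagi

section Holomorphic

/-- Holomorphy of a self-map of a normed space on a set. -/
def HolomorphicOn {E : Type*} [NormedAddCommGroup E] [NormedSpace ℂ E] (F : E → E)
    (s : Set E) : Prop := DifferentiableOn ℂ F s

variable {n : ℕ} {F : CMat n → CMat n} {Ω : Set (CMat n)}

lemma HolomorphicOn.comp_curve (hF : HolomorphicOn F Ω) {γ : ℂ → CMat n} {s : Set ℂ}
    (hγ : DifferentiableOn ℂ γ s) (hm : Set.MapsTo γ s Ω) :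
    DifferentiableOn ℂ (fun t => F (γ t)) s :=
  DifferentiableOn.comp hF hγ hm

lemma HolomorphicOn.exists_derivative (hF : HolomorphicOn F Ω) {z₀ : CMat n} (hz₀ : z₀ ∈ Ω) :
    ∃ L : CMat n →ₗ[ℂ] CMat n, ∀ (γ : ℂ → CMat n) (v : CMat n), γ 0 = z₀ → HasDerivAt γ v 0 →
      (∀ᶠ t in nhds 0, γ t ∈ Ω) → HasDerivAt (fun t => F (γ t)) (L v) 0 := by
  obtain ⟨L, hL⟩ := hF z₀ hz₀
  refine ⟨(L : CMat n →ₗ[ℂ] CMat n), fun γ v h0 hγ hm => ?_⟩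
  subst h0
  have h1 : HasDerivWithinAt (fun t => F (γ t)) (L v) (γ ⁻¹' Ω) 0 :=
    HasFDerivWithinAt.comp_hasDerivWithinAt 0 hL hγ.hasDerivWithinAt (Set.mapsTo_preimage γ Ω)
  exact h1.hasDerivAt hm

lemma IsAutomorphismOf.comp {τ σ : CMat n → CMat n} (hτ : IsAutomorphismOf Ω τ)
    (hσ : IsAutomorphismOf Ω σ) : IsAutomorphismOf Ω (fun z => τ (σ z)) := by
  obtain ⟨h1, h2, τ', h3, h4, h5, h6⟩ := hτ
  obtain ⟨k1, k2, σ', k3, k4, k5, k6⟩ := hσ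
  refine ⟨h1.comp k1, h2.comp k2 k1, fun z => σ' (τ' z), k3.comp h3, k4.comp h4 h3,
    fun z hz => ?_, fun z hz => ?_⟩
  · change σ' (τ' (τ (σ z))) = z
    rw [h5 _ (k1 hz), k5 _ hz]
  · change τ (σ (σ' (τ' z))) = z
    rw [k6 _ (h3 hz), h6 _ hz]

lemma holomorphicOn_linear (L : CMat n →ₗ[ℂ] CMat n) : HolomorphicOn (fun z => L z) Ω :=
  (LinearMap.toContinuousLinearMap L).differentiable.differentiableOn

lemma isAutomorphismOf_linear (L M : CMat n →ₗ[ℂ] CMat n) (hL : Set.MapsTo L Ω Ω)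
    (hM : Set.MapsTo M Ω Ω) (hML : ∀ z ∈ Ω, M (L z) = z) (hLM : ∀ z ∈ Ω, L (M z) = z) :
    IsAutomorphismOf Ω (fun z => L z) :=
  ⟨hL, holomorphicOn_linear L, fun z => M z, hM, holomorphicOn_linear M, hML, hLM⟩

end Holomorphic

section Cartan

variable {n : ℕ}

lemma deriv_transpose_eq {F : ℂ → CMat n} {L : CMat n} (hF : HasDerivAt F L 0)
    (hsym : ∀ᶠ t in nhds 0, (F t)ᵀ = F t) : Lᵀ = L := by
  have h1 : ∀ i j, HasDerivAt (fun t => F t i j) (L i j) 0 := fun i j =>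
    hasDerivAt_pi.1 (hasDerivAt_pi.1 hF i) j
  ext i j
  refine HasDerivAt.unique ((h1 j i).congr_of_eventuallyEq ?_) (h1 i j)
  filter_upwards [hsym] with t ht
  exact congrFun (congrFun ht.symm i) j

lemma HasDerivAt.toLp_mulVec {F : ℂ → CMat n} {L : CMat n} {t : ℂ} (hF : HasDerivAt F L t)
    (x : Fin n → ℂ) : HasDerivAt (fun t => (WithLp.toLp 2 (F t *ᵥ x) : EuclideanSpace ℂ (Fin n)))
      (WithLp.toLp 2 (L *ᵥ x)) t := by
  have h1 : ∀ i j, HasDerivAt (fun t => F t i j) (L i j) t := fun i j =>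
    hasDerivAt_pi.1 (hasDerivAt_pi.1 hF i) j
  have h2 : HasDerivAt (fun t => F t *ᵥ x) (L *ᵥ x) t := by
    rw [hasDerivAt_pi]
    intro i
    simp only [mulVec, dotProduct]
    exact HasDerivAt.fun_sum fun k _ => (h1 i k).mul_const _
  exact ((PiLp.continuousLinearEquiv 2 ℂ (fun _ : Fin n => ℂ)).symm
    : (Fin n → ℂ) →L[ℂ] EuclideanSpace ℂ (Fin n)).hasFDerivAt.comp_hasDerivAt t h2

lemma DifferentiableOn.toLp_mulVec {F : ℂ → CMat n} {s : Set ℂ} (hF : DifferentiableOn ℂ F s)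
    (x : Fin n → ℂ) :
    DifferentiableOn ℂ (fun t => (WithLp.toLp 2 (F t *ᵥ x) : EuclideanSpace ℂ (Fin n))) s := by
  have h2 : DifferentiableOn ℂ (fun t => F t *ᵥ x) s := by
    intro t ht
    rw [differentiableWithinAt_pi]
    intro i
    simp only [mulVec, dotProduct]
    exact DifferentiableWithinAt.fun_sum fun k _ =>
      ((differentiableWithinAt_matrix_iff.1 (hF t ht)) i k).mul_const _
  exact ((PiLp.continuousLinearEquiv 2 ℂ (fun _ : Fin n => ℂ)).symm
    : (Fin n → ℂ) →L[ℂ] EuclideanSpace ℂ (Fin n)).differentiable.comp_differentiableOn h2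

lemma mapsTo_smul_ball {z : CMat n} (hz : zᵀ = z) (h1 : spNorm z ≤ 1) :
    Set.MapsTo (fun t : ℂ => t • z) (Metric.ball 0 1) (OmegaIII n) := by
  intro t ht
  refine smul_mem_OmegaIII hz ?_
  have : ‖t‖ < 1 := by simpa using ht
  nlinarith [norm_nonneg t, spNorm_nonneg z]

lemma hasDerivAt_smul_const (z : CMat n) (t : ℂ) : HasDerivAt (fun t : ℂ => t • z) z t := by
  have h := (hasDerivAt_id t).smul_const z
  rw [one_smul] at h
  exact h

lemma differentiable_smul_const (z : CMat n) : Differentiable ℂ (fun t : ℂ => t • z) :=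
  fun t => (hasDerivAt_smul_const z t).differentiableAt

/-- Schwarz lemma for the spectral norm. -/
lemma spNorm_derivative_le_one {F : CMat n → CMat n} (hF : HolomorphicOn F (OmegaIII n))
    (hm : Set.MapsTo F (OmegaIII n) (OmegaIII n)) (h0 : F 0 = 0) {z L : CMat n} (hz : zᵀ = z)
    (h1 : spNorm z ≤ 1) (hL : HasDerivAt (fun t : ℂ => F (t • z)) L 0) : spNorm L ≤ 1 := by
  refine spNorm_le_one_of fun x => ?_
  have hd : DifferentiableOn ℂ (fun t : ℂ => F (t • z)) (Metric.ball 0 1) :=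
    hF.comp_curve (differentiable_smul_const z).differentiableOn (mapsTo_smul_ball hz h1)
  have := Complex.norm_deriv_le_div_of_mapsTo_ball (R₁ := 1) (R₂ := l2norm x) (hd.toLp_mulVec x)
    (fun t ht => by
      rw [zero_smul, h0, zero_mulVec, WithLp.toLp_zero, mem_closedBall_zero_iff]
      exact l2norm_mulVec_le_of_le_one (mem_OmegaIII_iff.1 (hm (mapsTo_smul_ball hz h1 ht))).2.le x)
    one_pos
  rw [(hL.toLp_mulVec x).deriv, div_one] at this
  exact this

lemma eq_smul_of_unitary {H : CMat n → CMat n} (hH : HolomorphicOn H (OmegaIII n))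
    (hm : Set.MapsTo H (OmegaIII n) (OmegaIII n)) (h0 : H 0 = 0) {W : CMat n} (hW : Wᵀ = W)
    (hWU : Wᴴ * W = 1) (hder : HasDerivAt (fun t : ℂ => H (t • W)) W 0) {t : ℂ} (ht : ‖t‖ < 1) :
    H (t • W) = t • W := by
  have h1 : spNorm W ≤ 1 := spNorm_le_one_of_conjTranspose_mul_self hWU
  have hd : DifferentiableOn ℂ (fun t : ℂ => H (t • W)) (Metric.ball 0 1) :=
    hH.comp_curve (differentiable_smul_const W).differentiableOn (mapsTo_smul_ball hW h1)
  refine Matrix.ext_of_mulVec_single fun j => ?_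
  set x : Fin n → ℂ := Pi.single j 1
  have hx : l2norm (W *ᵥ x) = l2norm x := by
    rw [← sq_eq_sq₀ (l2norm_nonneg _) (l2norm_nonneg _)]
    have := star_dotProduct_one_sub W x
    rw [hWU, sub_self, zero_mulVec, dotProduct_zero] at this
    have h2 : l2norm x ^ 2 - l2norm (W *ᵥ x) ^ 2 = 0 := by exact_mod_cast this.symm
    linarith
  have key := Complex.affine_of_mapsTo_ball_of_norm_dslope_eq_div (R₁ := 1) (R₂ := l2norm x)
    (z₀ := 0) (hd.toLp_mulVec x) (fun t ht => by
      rw [zero_smul, h0, zero_mulVec, WithLp.toLp_zero, mem_closedBall_zero_iff]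
      exact l2norm_mulVec_le_of_le_one (mem_OmegaIII_iff.1 (hm (mapsTo_smul_ball hW h1 ht))).2.le x)
    (by simp) (by
      rw [dslope_same, (hder.toLp_mulVec x).deriv, div_one]
      exact hx)
  have h3 := key (show t ∈ Metric.ball 0 1 by simpa using ht)
  simp only [dslope_same, (hder.toLp_mulVec x).deriv, zero_smul, h0, zero_mulVec,
    WithLp.toLp_zero, zero_add, sub_zero] at h3
  rw [smul_mulVec]
  exact (WithLp.toLp_injective 2) h3

/-- Cartan's uniqueness theorem for `OmegaIII n`. -/
lemma eq_self_of_derivative_eq_id {H : CMat n → CMat n} (hH : HolomorphicOn H (OmegaIII n))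
    (hm : Set.MapsTo H (OmegaIII n) (OmegaIII n)) (h0 : H 0 = 0)
    (hder : ∀ W : CMat n, Wᵀ = W → HasDerivAt (fun t : ℂ => H (t • W)) W 0)
    {z : CMat n} (hz : z ∈ OmegaIII n) : H z = z := by
  obtain ⟨hzT, hz1⟩ := mem_OmegaIII_iff.1 hz
  obtain ⟨U, d, hU, hd0, rfl⟩ := exists_takagi hzT
  have hUb : (Uᵀ)ᴴ * Uᵀ = 1 := by
    rw [show (Uᵀ)ᴴ = (Uᴴ)ᵀ from rfl, ← transpose_mul, mul_eq_one_comm.1 hU, transpose_one]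
  have hd1 : ∀ i, d i < 1 := fun i => by
    rw [spNorm_eq_of_unitary hU hUb] at hz1
    have := (norm_entry_le_spNorm _ i i).trans_lt hz1
    rwa [diagonal_apply_eq, Complex.norm_real, Real.norm_of_nonneg (hd0 i)] at this
  obtain ⟨ρ, hρ0, hρ1, hdρ⟩ : ∃ ρ : ℝ, 0 < ρ ∧ ρ < 1 ∧ ∀ i, d i ≤ ρ := by
    have hev : ∀ᶠ ρ in nhdsWithin (1 : ℝ) (Set.Iio 1), 0 < ρ ∧ ρ < 1 ∧ ∀ i, d i ≤ ρ := by
      filter_upwards [Ioo_mem_nhdsLT (show (0 : ℝ) < 1 by norm_num),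
        Filter.eventually_all.2 fun i => Ioo_mem_nhdsLT (hd1 i)] with ρ h1 h2
      exact ⟨h1.1, h1.2, fun i => (h2 i).1.le⟩
    exact hev.exists
  have hsymm : ∀ c : Fin n → ℂ, (U * diagonal c * Uᵀ)ᵀ = U * diagonal c * Uᵀ := fun c => by
    simp [transpose_mul, Matrix.mul_assoc]
  have hmem : ∀ c : Fin n → ℂ, (∀ i, ‖c i‖ ≤ ρ) → U * diagonal c * Uᵀ ∈ OmegaIII n := fun c hc =>
    mem_OmegaIII_iff.2 ⟨hsymm c, by
      rw [spNorm_eq_of_unitary hU hUb]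
      exact (spNorm_diagonal_le hρ0.le hc).trans_lt hρ1⟩
  suffices h : ∀ S : Finset (Fin n), ∀ c : Fin n → ℂ, (∀ i ∈ S, ‖c i‖ ≤ ρ) →
      (∀ i ∉ S, ‖c i‖ = ρ) → H (U * diagonal c * Uᵀ) = U * diagonal c * Uᵀ from
    h Finset.univ _ (fun i _ => by
      rw [Complex.norm_real, Real.norm_of_nonneg (hd0 i)]
      exact hdρ i) (fun i hi => absurd (Finset.mem_univ i) hi)
  intro S
  induction S using Finset.induction_on with
  | empty =>
    intro c _ hc
    have hρ : (ρ : ℂ) ≠ 0 := by exact_mod_cast hρ0.ne'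
    have e : U * diagonal c * Uᵀ = (ρ : ℂ) • (U * diagonal (fun i => (ρ : ℂ)⁻¹ * c i) * Uᵀ) := by
      rw [← smul_mul_assoc, ← mul_smul_comm, ← diagonal_smul]
      congr 3
      ext i
      simp [hρ]
    have hun : (diagonal (fun i => (ρ : ℂ)⁻¹ * c i))ᴴ * diagonal (fun i => (ρ : ℂ)⁻¹ * c i)
        = (1 : CMat n) := by
      rw [diagonal_conjTranspose, diagonal_mul_diagonal, ← diagonal_one]
      congr 1
      ext i
      rw [Pi.star_apply, RCLike.star_def, Complex.conj_mul', norm_mul, hc i (Finset.notMem_empty i),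
        norm_inv, Complex.norm_real, Real.norm_of_nonneg hρ0.le, inv_mul_cancel₀ hρ0.ne']
      simp
    rw [e]
    refine eq_smul_of_unitary hH hm h0 (hsymm _) ?_ (hder _ (hsymm _)) ?_
    · rw [conjTranspose_mul, conjTranspose_mul]
      calc _ = Uᵀᴴ * ((diagonal (fun i => (ρ : ℂ)⁻¹ * c i))ᴴ * (Uᴴ * U) *
            diagonal (fun i => (ρ : ℂ)⁻¹ * c i)) * Uᵀ := by simp only [Matrix.mul_assoc]
        _ = 1 := by rw [hU, Matrix.mul_one, hun, Matrix.mul_one, hUb]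
    · rwa [Complex.norm_real, Real.norm_of_nonneg hρ0.le]
  | insert j S hj ih =>
    intro c hc1 hc2
    let γ : ℂ → CMat n := fun t => U * diagonal (Function.update c j t) * Uᵀ
    have hγ : Differentiable ℂ γ := by
      refine ((differentiable_const U).matrix_mul ?_).matrix_mul (differentiable_const _)
      refine differentiable_matrix_iff.2 fun a b => ?_
      by_cases hab : a = b
      · subst hab
        simp only [diagonal_apply_eq]
        by_cases haj : a = j
        · subst haj
          simp
        · simp [Function.update_of_ne haj]
      · simp [diagonal_apply_ne _ hab]
    have hcle : ∀ i, ‖c i‖ ≤ ρ := fun i => by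
      by_cases hi : i ∈ insert j S
      · exact hc1 i hi
      · exact (hc2 i hi).le
    have hγm : Set.MapsTo γ (Metric.closedBall 0 ρ) (OmegaIII n) := fun t ht =>
      hmem _ fun i => by
        by_cases hi : i = j
        · subst hi
          simpa using ht
        · rw [Function.update_of_ne hi]
          exact hcle i
    have hcl : closure (Metric.ball (0 : ℂ) ρ) = Metric.closedBall 0 ρ :=
      closure_ball _ hρ0.ne'
    have hd : DiffContOnCl ℂ (fun t => H (γ t)) (Metric.ball 0 ρ) :=
      DifferentiableOn.diffContOnCl (by
        rw [hcl]
        exact hH.comp_curve hγ.differentiableOn hγm)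
    have hEq := Complex.eqOn_closure_of_eqOn_frontier Metric.isBounded_ball hd
      (hγ.diffContOnCl) (fun t ht => by
        rw [frontier_ball _ hρ0.ne', mem_sphere_zero_iff_norm] at ht
        refine ih _ (fun i hi => ?_) (fun i hi => ?_)
        · rw [Function.update_of_ne (ne_of_mem_of_not_mem hi hj)]
          exact hcle i
        · by_cases hij : i = j
          · subst hij
            simpa using ht
          · rw [Function.update_of_ne hij]
            exact hc2 i (by simp [hij, hi]))
    have := hEq (x := c j) (by
      rw [hcl]
      simpa using hcle j)
    simpa [γ] using this

/-- An automorphism of `OmegaIII n` fixing the origin is linear, and so is its inverse. -/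
theorem IsAutomorphismOf.exists_linear {F : CMat n → CMat n}
    (hF : IsAutomorphismOf (OmegaIII n) F) (h0 : F 0 = 0) :
    ∃ L M : CMat n →ₗ[ℂ] CMat n, Set.MapsTo L (OmegaIII n) (OmegaIII n) ∧
      Set.MapsTo M (OmegaIII n) (OmegaIII n) ∧ (∀ z ∈ OmegaIII n, F z = L z) ∧
      (∀ z ∈ OmegaIII n, M (L z) = z) ∧ ∀ z ∈ OmegaIII n, L (M z) = z := by
  obtain ⟨hFm, hFd, G, hGm, hGd, hGF, hFG⟩ := hF
  have hG0 : G 0 = 0 := by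
    conv_lhs => rw [← h0]
    exact hGF 0 zero_mem_OmegaIII
  have key : ∀ F G : CMat n → CMat n, HolomorphicOn F (OmegaIII n) → HolomorphicOn G (OmegaIII n) →
      Set.MapsTo F (OmegaIII n) (OmegaIII n) → Set.MapsTo G (OmegaIII n) (OmegaIII n) →
      F 0 = 0 → G 0 = 0 → (∀ z ∈ OmegaIII n, G (F z) = z) →
      ∃ M : CMat n →ₗ[ℂ] CMat n, ∀ z ∈ OmegaIII n, M (F z) = z := by
    intro F G hFd hGd hFm hGm h0 hG0 hGF
    obtain ⟨M, hM⟩ := hGd.exists_derivative zero_mem_OmegaIII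
    obtain ⟨L, hL⟩ := hFd.exists_derivative zero_mem_OmegaIII
    have hLz : ∀ z : CMat n, zᵀ = z → HasDerivAt (fun t : ℂ => F (t • z)) (L z) 0 := fun z hz =>
      hL _ z (zero_smul _ _) (hasDerivAt_smul_const z 0) (eventually_smul_mem_OmegaIII hz)
    have hMz : ∀ z : CMat n, zᵀ = z → HasDerivAt (fun t : ℂ => G (t • z)) (M z) 0 := fun z hz =>
      hM _ z (zero_smul _ _) (hasDerivAt_smul_const z 0) (eventually_smul_mem_OmegaIII hz)
    have hMsym : ∀ z : CMat n, zᵀ = z → (M z)ᵀ = M z := fun z hz =>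
      deriv_transpose_eq (hMz z hz) ((eventually_smul_mem_OmegaIII hz).mono fun t ht =>
        (mem_OmegaIII_iff.1 (hGm ht)).1)
    have hMle : ∀ z : CMat n, zᵀ = z → spNorm (M z) ≤ spNorm z := by
      intro z hz
      by_cases hz0 : z = 0
      · simp [hz0, spNorm_zero]
      · have hpos : 0 < spNorm z :=
          lt_of_le_of_ne (spNorm_nonneg z) fun h => hz0 (spNorm_eq_zero.1 h.symm)
        have hsym' : (((spNorm z)⁻¹ : ℂ) • z)ᵀ = ((spNorm z)⁻¹ : ℂ) • z := by
          rw [transpose_smul, hz]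
        have hn : ‖((spNorm z)⁻¹ : ℂ)‖ = (spNorm z)⁻¹ := by
          rw [norm_inv, Complex.norm_real, Real.norm_of_nonneg hpos.le]
        have := spNorm_derivative_le_one hGd hGm hG0 hsym'
          (by rw [spNorm_smul, hn, inv_mul_cancel₀ hpos.ne']) (hMz _ hsym')
        rwa [map_smul, spNorm_smul, hn, inv_mul_le_iff₀ hpos, mul_one] at this
    have hMm : Set.MapsTo M (OmegaIII n) (OmegaIII n) := fun z hz => by
      rw [mem_OmegaIII_iff] at hz ⊢
      exact ⟨hMsym z hz.1, (hMle z hz.1).trans_lt hz.2⟩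
    have hML : ∀ z : CMat n, zᵀ = z → M (L z) = z := fun z hz => by
      have h1 := hM (fun t : ℂ => F (t • z)) (L z) (by simp [h0]) (hLz z hz)
        ((eventually_smul_mem_OmegaIII hz).mono fun t ht => hFm ht)
      refine h1.unique ((hasDerivAt_smul_const z 0).congr_of_eventuallyEq ?_)
      exact (eventually_smul_mem_OmegaIII hz).mono fun t ht => hGF _ ht
    refine ⟨M, fun z hz => eq_self_of_derivative_eq_id (H := fun z => M (F z)) ?_
      (hMm.comp hFm) (by simp [h0]) (fun W hW => ?_) hz⟩
    · exact DifferentiableOn.comp (holomorphicOn_linear M (Ω := OmegaIII n)) hFd hFm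
    · have := ((LinearMap.toContinuousLinearMap M).hasFDerivAt).comp_hasDerivAt 0 (hLz W hW)
      refine HasDerivAt.congr_deriv this ?_
      exact hML W hW
  obtain ⟨M, hM⟩ := key F G hFd hGd hFm hGm h0 hG0 hGF
  obtain ⟨L, hL⟩ := key G F hGd hFd hGm hFm hG0 h0 hFG
  have hFL : ∀ z ∈ OmegaIII n, F z = L z := fun z hz => by
    rw [← hL _ (hFm hz), hGF z hz]
  have hGM : ∀ z ∈ OmegaIII n, G z = M z := fun z hz => by
    rw [← hM _ (hGm hz), hFG z hz]
  refine ⟨L, M, fun z hz => ?_, fun z hz => ?_, hFL, fun z hz => ?_, fun z hz => ?_⟩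
  · rw [← hFL z hz]
    exact hFm hz
  · rw [← hGM z hz]
    exact hGm hz
  · rw [← hFL z hz, hM z hz]
  · rw [← hGM z hz, hL z hz]

end Cartan

section Mobius

variable {n : ℕ}

/-- The complex diagonal matrix with real entries `α`. -/
def cdiag (α : Fin n → ℝ) : CMat n := diagonal fun i => (α i : ℂ)

/-- The vector with entries `√(1 - α i ^ 2)`. -/
def coSqrt (α : Fin n → ℝ) : Fin n → ℝ := fun i => √(1 - α i ^ 2)

/-- The Möbius transformation of `OmegaIII n` sending `cdiag α` to `0`. -/
def mobius (α : Fin n → ℝ) (Y : CMat n) : CMat n :=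
  -cdiag α + cdiag (coSqrt α) * (Y * (1 - cdiag α * Y)⁻¹) * cdiag (coSqrt α)

lemma cdiag_transpose (α : Fin n → ℝ) : (cdiag α)ᵀ = cdiag α := diagonal_transpose _

lemma cdiag_conjTranspose (α : Fin n → ℝ) : (cdiag α)ᴴ = cdiag α := by
  rw [cdiag, diagonal_conjTranspose]
  congr 1
  ext i
  simp

lemma cdiag_neg (α : Fin n → ℝ) : cdiag (-α) = -cdiag α := by
  rw [cdiag, cdiag, diagonal_neg]
  congr 1
  ext i
  simp

lemma cdiag_mul (α β : Fin n → ℝ) : cdiag α * cdiag β = cdiag (α * β) := by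
  rw [cdiag, cdiag, cdiag, diagonal_mul_diagonal]
  congr 1
  ext i
  simp

lemma cdiag_comm (α β : Fin n → ℝ) : cdiag α * cdiag β = cdiag β * cdiag α := by
  rw [cdiag_mul, cdiag_mul, mul_comm]

lemma spNorm_cdiag_lt_one {α : Fin n → ℝ} (hα : ∀ i, |α i| < 1) : spNorm (cdiag α) < 1 :=
  spNorm_diagonal_lt_one fun i => by
    rw [Complex.norm_real]
    exact hα i

lemma coSqrt_neg (α : Fin n → ℝ) : coSqrt (-α) = coSqrt α := by
  ext i
  simp [coSqrt]

lemma coSqrt_pos {α : Fin n → ℝ} (hα : ∀ i, |α i| < 1) (i : Fin n) : 0 < coSqrt α i := by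
  refine Real.sqrt_pos.2 ?_
  have := (sq_lt_one_iff_abs_lt_one (α i)).2 (hα i)
  linarith

lemma coSqrt_sq {α : Fin n → ℝ} (hα : ∀ i, |α i| < 1) (i : Fin n) :
    coSqrt α i ^ 2 = 1 - α i ^ 2 := by
  refine Real.sq_sqrt ?_
  have := (sq_lt_one_iff_abs_lt_one (α i)).2 (hα i)
  linarith

lemma cdiag_coSqrt_mul_self {α : Fin n → ℝ} (hα : ∀ i, |α i| < 1) :
    cdiag (coSqrt α) * cdiag (coSqrt α) = 1 - cdiag α * cdiag α := by
  rw [cdiag_mul, cdiag_mul, cdiag, cdiag, ← diagonal_one, diagonal_sub]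
  congr 1
  ext i
  have := coSqrt_sq hα i
  simp only [Pi.mul_apply]
  rw [← pow_two, this]
  push_cast
  ring

lemma cdiag_mul_inv {s : Fin n → ℝ} (hs : ∀ i, 0 < s i) : cdiag s * cdiag s⁻¹ = 1 := by
  rw [cdiag_mul, cdiag, ← diagonal_one]
  congr 1
  ext i
  simp [(hs i).ne']

lemma cdiag_inv_mul {s : Fin n → ℝ} (hs : ∀ i, 0 < s i) : cdiag s⁻¹ * cdiag s = 1 := by
  rw [cdiag_comm, cdiag_mul_inv hs]

lemma isUnit_det_one_sub_mul {A Y : CMat n} (hA : spNorm A < 1) (hY : spNorm Y < 1) :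
    IsUnit (1 - A * Y).det :=
  isUnit_det_one_sub_of_spNorm_lt_one ((spNorm_mul_le A Y).trans_lt (by
    nlinarith [spNorm_nonneg A, spNorm_nonneg Y]))

/-- The push-through identity. -/
lemma mul_one_sub_inv {A Y : CMat n} (h : IsUnit (1 - A * Y).det) :
    Y * (1 - A * Y)⁻¹ = (1 - Y * A)⁻¹ * Y := by
  have h' : IsUnit (1 - Y * A).det := by
    rwa [det_one_sub_mul_comm]
  have e : (1 - Y * A) * Y = Y * (1 - A * Y) := by noncomm_ring
  calc Y * (1 - A * Y)⁻¹ = (1 - Y * A)⁻¹ * ((1 - Y * A) * Y) * (1 - A * Y)⁻¹ := by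
        rw [← Matrix.mul_assoc, nonsing_inv_mul _ h', Matrix.one_mul]
    _ = (1 - Y * A)⁻¹ * Y := by
        rw [e, Matrix.mul_assoc, Matrix.mul_assoc, mul_nonsing_inv _ h, Matrix.mul_one]

lemma transpose_mul_one_sub_inv {A Y : CMat n} (hA : Aᵀ = A) (hY : Yᵀ = Y)
    (h : IsUnit (1 - A * Y).det) : (Y * (1 - A * Y)⁻¹)ᵀ = Y * (1 - A * Y)⁻¹ := by
  rw [transpose_mul, transpose_nonsing_inv, transpose_sub, transpose_one, transpose_mul, hA, hY,
    ← mul_one_sub_inv h]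

lemma one_sub_conjTranspose_mul_mobius {A S Y R : CMat n} (hA : Aᴴ = A) (hS : Sᴴ = S)
    (hSS : S * S = 1 - A * A) (hAS : A * S = S * A) (hR : (1 - A * Y) * R = 1) :
    1 - (-A + S * (Y * R) * S)ᴴ * (-A + S * (Y * R) * S)
      = (R * S)ᴴ * (1 - Yᴴ * Y) * (R * S) := by
  have hR' : Rᴴ * (1 - Yᴴ * A) = 1 := by
    have := congrArg conjTranspose hR
    rwa [conjTranspose_mul, conjTranspose_sub, conjTranspose_mul, conjTranspose_one, hA] at this
  have h1 : S * S = S * (Rᴴ * (1 - Yᴴ * A)) * ((1 - A * Y) * R) * S := by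
    rw [hR, hR', Matrix.mul_one, Matrix.mul_one]
  have h2 : A * (S * (Y * R) * S) = S * (Rᴴ * (1 - Yᴴ * A)) * (A * Y) * R * S := by
    rw [hR', Matrix.mul_one]
    simp only [← Matrix.mul_assoc, hAS]
  have h3 : S * (Rᴴ * Yᴴ) * S * A = S * Rᴴ * (Yᴴ * A) * ((1 - A * Y) * R) * S := by
    rw [hR, Matrix.mul_one]
    simp only [Matrix.mul_assoc, hAS]
  have h4 : S * (Rᴴ * Yᴴ) * S * (S * (Y * R) * S)
      = S * Rᴴ * (Yᴴ * (1 - A * A) * Y) * R * S := by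
    rw [← hSS]
    simp only [Matrix.mul_assoc]
  have e : (-A + S * (Y * R) * S)ᴴ = -A + S * (Rᴴ * Yᴴ) * S := by
    simp only [conjTranspose_add, conjTranspose_neg, conjTranspose_mul, hA, hS, Matrix.mul_assoc]
  calc 1 - (-A + S * (Y * R) * S)ᴴ * (-A + S * (Y * R) * S)
      = (1 - A * A) + A * (S * (Y * R) * S) + S * (Rᴴ * Yᴴ) * S * A
        - S * (Rᴴ * Yᴴ) * S * (S * (Y * R) * S) := by
        rw [e]
        noncomm_ring
    _ = (R * S)ᴴ * (1 - Yᴴ * Y) * (R * S) := by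
        rw [← hSS, h1, h2, h3, h4, conjTranspose_mul, hS]
        noncomm_ring

lemma mobius_mem {α : Fin n → ℝ} (hα : ∀ i, |α i| < 1) {Y : CMat n} (hY : Y ∈ OmegaIII n) :
    mobius α Y ∈ OmegaIII n := by
  obtain ⟨hYT, hY1⟩ := mem_OmegaIII_iff.1 hY
  have hu := isUnit_det_one_sub_mul (spNorm_cdiag_lt_one hα) hY1
  rw [mem_OmegaIII_iff]
  constructor
  · rw [mobius, transpose_add, transpose_neg, cdiag_transpose, transpose_mul, transpose_mul,
      cdiag_transpose, transpose_mul_one_sub_inv (cdiag_transpose α) hYT hu]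
    simp only [Matrix.mul_assoc]
  · rw [← posDef_one_sub_iff, mobius, one_sub_conjTranspose_mul_mobius (cdiag_conjTranspose α)
      (cdiag_conjTranspose _) (cdiag_coSqrt_mul_self hα) (cdiag_comm _ _) (mul_nonsing_inv _ hu)]
    refine ((posDef_one_sub_iff Y).2 hY1).conjTranspose_mul_mul_same ?_
    refine mulVec_injective_of_isUnit (IsUnit.mul ?_ ?_)
    · exact (isUnit_iff_isUnit_det _).2 (isUnit_nonsing_inv_det _ hu)
    · exact IsUnit.of_mul_eq_one _ (cdiag_mul_inv (coSqrt_pos hα))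

lemma mobius_left_inv_aux {A S T Y R R' : CMat n} (hSS : S * S = 1 - A * A)
    (hAS : A * S = S * A) (hST : S * T = 1) (hTS : T * S = 1) (hR : (1 - A * Y) * R = 1)
    (hR' : (1 + A * (-A + S * (Y * R) * S)) * R' = 1) :
    A + S * ((-A + S * (Y * R) * S) * R') * S = Y := by
  have hRl : R * (1 - A * Y) = 1 := mul_eq_one_comm.1 hR
  have h1 : 1 + A * (-A + S * (Y * R) * S) = S * R * S := by
    calc 1 + A * (-A + S * (Y * R) * S) = (1 - A * A) + A * S * (Y * R) * S := by noncomm_ring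
      _ = S * ((1 - A * Y) * R + A * Y * R) * S := by
        rw [← hSS, hAS, hR]
        noncomm_ring
      _ = S * R * S := by noncomm_ring
  have h2 : R' = T * (1 - A * Y) * T := by
    have h3 : T * (1 - A * Y) * T * (S * R * S) = 1 := by
      calc T * (1 - A * Y) * T * (S * R * S) = T * ((1 - A * Y) * (T * S) * R) * S := by
            noncomm_ring
        _ = 1 := by rw [hTS, Matrix.mul_one, hR, Matrix.mul_one, hTS]
    rw [h1] at hR'
    calc R' = T * (1 - A * Y) * T * (S * R * S) * R' := by rw [h3, Matrix.one_mul]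
      _ = T * (1 - A * Y) * T := by rw [Matrix.mul_assoc, hR', Matrix.mul_one]
  have h5 : S * (-A) * T = -A := by
    rw [Matrix.mul_neg, ← hAS, Matrix.neg_mul, Matrix.mul_assoc, hST, Matrix.mul_one]
  calc A + S * ((-A + S * (Y * R) * S) * R') * S
      = A + (S * (-A) * T + S * S * (Y * R) * (S * T)) * (1 - A * Y) * (T * S) := by
        rw [h2]
        noncomm_ring
    _ = A + (-A) * (1 - A * Y) + S * S * (Y * (R * (1 - A * Y))) := by
        rw [hST, hTS, h5]
        noncomm_ring
    _ = Y := by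
        rw [hRl, hSS]
        noncomm_ring

lemma mobius_neg_mobius {α : Fin n → ℝ} (hα : ∀ i, |α i| < 1) {Y : CMat n}
    (hY : Y ∈ OmegaIII n) : mobius (-α) (mobius α Y) = Y := by
  obtain ⟨hYT, hY1⟩ := mem_OmegaIII_iff.1 hY
  have hu := isUnit_det_one_sub_mul (spNorm_cdiag_lt_one hα) hY1
  have hα' : ∀ i, |(-α) i| < 1 := fun i => by simpa using hα i
  have hu' := isUnit_det_one_sub_mul (spNorm_cdiag_lt_one hα')
    (mem_OmegaIII_iff.1 (mobius_mem hα hY)).2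
  rw [mobius, coSqrt_neg, cdiag_neg, neg_neg]
  rw [cdiag_neg] at hu'
  refine mobius_left_inv_aux (R' := (1 - -cdiag α * mobius α Y)⁻¹) (cdiag_coSqrt_mul_self hα)
    (cdiag_comm _ _) (cdiag_mul_inv (coSqrt_pos hα)) (cdiag_inv_mul (coSqrt_pos hα))
    (mul_nonsing_inv _ hu) ?_
  have := mul_nonsing_inv _ hu'
  rw [Matrix.neg_mul, sub_neg_eq_add] at this ⊢
  exact this

lemma mobius_mobius_neg {α : Fin n → ℝ} (hα : ∀ i, |α i| < 1) {Y : CMat n}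
    (hY : Y ∈ OmegaIII n) : mobius α (mobius (-α) Y) = Y := by
  have := mobius_neg_mobius (α := -α) (fun i => by simpa using hα i) hY
  rwa [neg_neg] at this

lemma holomorphicOn_mobius {α : Fin n → ℝ} (hα : ∀ i, |α i| < 1) :
    HolomorphicOn (mobius α) (OmegaIII n) := by
  intro Y hY
  have hu := isUnit_det_one_sub_mul (spNorm_cdiag_lt_one hα) (mem_OmegaIII_iff.1 hY).2
  have hid : DifferentiableWithinAt ℂ (fun Y : CMat n => Y) (OmegaIII n) Y :=
    differentiableWithinAt_id
  have h1 := hid.matrix_mul (DifferentiableWithinAt.matrix_inv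
    ((differentiableWithinAt_const (1 : CMat n)).sub
      ((differentiableWithinAt_const (cdiag α)).matrix_mul hid)) hu.ne_zero)
  exact (differentiableWithinAt_const _).add
    (((differentiableWithinAt_const _).matrix_mul h1).matrix_mul (differentiableWithinAt_const _))

lemma isAutomorphismOf_mobius {α : Fin n → ℝ} (hα : ∀ i, |α i| < 1) :
    IsAutomorphismOf (OmegaIII n) (mobius α) :=
  have hα' : ∀ i, |(-α) i| < 1 := fun i => by simpa using hα i
  ⟨fun _ hY => mobius_mem hα hY, holomorphicOn_mobius hα, mobius (-α),
    fun _ hY => mobius_mem hα' hY, holomorphicOn_mobius hα',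
    fun _ hY => mobius_neg_mobius hα hY, fun _ hY => mobius_mobius_neg hα hY⟩

lemma mobius_zero (α : Fin n → ℝ) : mobius α 0 = -cdiag α := by
  simp [mobius]

lemma mobius_cdiag {α : Fin n → ℝ} (hα : ∀ i, |α i| < 1) : mobius α (cdiag α) = 0 := by
  have h := mobius_mobius_neg hα (Y := 0) zero_mem_OmegaIII
  rwa [mobius_zero, cdiag_neg, neg_neg] at h

/-- The congruence `Z ↦ U Z Uᵀ`. -/
def congrLin (U : CMat n) : CMat n →ₗ[ℂ] CMat n where
  toFun Z := U * Z * Uᵀ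
  map_add' X Y := by rw [Matrix.mul_add, Matrix.add_mul]
  map_smul' c X := by simp

lemma congrLin_apply (U Z : CMat n) : congrLin U Z = U * Z * Uᵀ := rfl

lemma conjTranspose_mul_transpose {U : CMat n} (hU : Uᴴ * U = 1) : (Uᵀ)ᴴ * Uᵀ = 1 := by
  rw [show (Uᵀ)ᴴ = (Uᴴ)ᵀ from rfl, ← transpose_mul, mul_eq_one_comm.1 hU, transpose_one]

lemma congrLin_mem {U Z : CMat n} (hU : Uᴴ * U = 1) (hZ : Z ∈ OmegaIII n) :
    congrLin U Z ∈ OmegaIII n := by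
  rw [mem_OmegaIII_iff] at hZ ⊢
  rw [congrLin_apply, spNorm_eq_of_unitary hU (conjTranspose_mul_transpose hU)]
  refine ⟨?_, hZ.2⟩
  rw [transpose_mul, transpose_mul, transpose_transpose, hZ.1, Matrix.mul_assoc]

lemma congrLin_congrLin {U W : CMat n} (h : U * W = 1) (Z : CMat n) :
    congrLin U (congrLin W Z) = Z := by
  calc U * (W * Z * Wᵀ) * Uᵀ = (U * W) * Z * (U * W)ᵀ := by
        rw [transpose_mul]
        noncomm_ring
    _ = Z := by rw [h, transpose_one, Matrix.mul_one, Matrix.one_mul]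

lemma isAutomorphismOf_congrLin {U : CMat n} (hU : Uᴴ * U = 1) :
    IsAutomorphismOf (OmegaIII n) (fun Z => congrLin U Z) :=
  have hU' : Uᴴᴴ * Uᴴ = 1 := by rw [conjTranspose_conjTranspose, mul_eq_one_comm.1 hU]
  isAutomorphismOf_linear _ (congrLin Uᴴ) (fun _ hZ => congrLin_mem hU hZ)
    (fun _ hZ => congrLin_mem hU' hZ) (fun Z _ => congrLin_congrLin hU Z)
    (fun Z _ => congrLin_congrLin (mul_eq_one_comm.1 hU) Z)

end Mobius

section BlockNorms

variable {ι : Type*} [Fintype ι]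

lemma l2norm_add_sq {x y : ι → ℂ} (h : star x ⬝ᵥ y = 0) :
    l2norm (x + y) ^ 2 = l2norm x ^ 2 + l2norm y ^ 2 := by
  have h' : star y ⬝ᵥ x = 0 := by
    rw [← star_star (star y ⬝ᵥ x), star_dotProduct, star_star, h, star_zero]
  have := star_dotProduct_self (x + y)
  rw [star_add, add_dotProduct, dotProduct_add, dotProduct_add, h, h', star_dotProduct_self,
    star_dotProduct_self] at this
  have h2 : ((l2norm x ^ 2 + l2norm y ^ 2 : ℝ) : ℂ) = ((l2norm (x + y) ^ 2 : ℝ) : ℂ) := by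
    rw [← this]
    push_cast
    ring
  exact_mod_cast h2.symm

lemma star_mulVec_dotProduct_mulVec (A B : Matrix ι ι ℂ) (x y : ι → ℂ) :
    star (A *ᵥ x) ⬝ᵥ (B *ᵥ y) = star x ⬝ᵥ ((Aᴴ * B) *ᵥ y) := by
  rw [star_mulVec, ← mulVec_mulVec, dotProduct_mulVec (star x) Aᴴ]

variable [DecidableEq ι]

lemma l2norm_sq_add_of_proj {Q : Matrix ι ι ℂ} (hQ : Qᴴ = Q) (hQQ : Q * Q = Q) (x : ι → ℂ) :
    l2norm (Q *ᵥ x) ^ 2 + l2norm ((1 - Q) *ᵥ x) ^ 2 = l2norm x ^ 2 := by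
  rw [← l2norm_add_sq, ← add_mulVec, add_sub_cancel, one_mulVec]
  rw [star_mulVec_dotProduct_mulVec, hQ, Matrix.mul_sub, Matrix.mul_one, hQQ, sub_self,
    zero_mulVec, dotProduct_zero]

lemma spNorm_le_of_mem_sq {A : Matrix ι ι ℂ} (h : ∀ x, l2norm (A *ᵥ x) ^ 2 ≤ l2norm x ^ 2) :
    spNorm A ≤ 1 :=
  spNorm_le_one_of fun x => (sq_le_sq₀ (l2norm_nonneg _) (l2norm_nonneg _)).1 (h x)

/-- A block matrix whose blocks satisfy the relevant scalar bounds is a contraction. -/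
lemma spNorm_block_le_one {Q M : Matrix ι ι ℂ} (hQ : Qᴴ = Q) (hQQ : Q * Q = Q) {a b c d : ℝ}
    (h11 : ∀ x, l2norm ((Q * M * Q) *ᵥ x) ≤ a * l2norm (Q *ᵥ x))
    (h12 : ∀ x, l2norm ((Q * M * (1 - Q)) *ᵥ x) ≤ b * l2norm ((1 - Q) *ᵥ x))
    (h21 : ∀ x, l2norm (((1 - Q) * M * Q) *ᵥ x) ≤ c * l2norm (Q *ᵥ x))
    (h22 : ∀ x, l2norm (((1 - Q) * M * (1 - Q)) *ᵥ x) ≤ d * l2norm ((1 - Q) *ᵥ x))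
    (h : ∀ p q : ℝ, 0 ≤ p → 0 ≤ q →
      (a * p + b * q) ^ 2 + (c * p + d * q) ^ 2 ≤ p ^ 2 + q ^ 2) : spNorm M ≤ 1 := by
  refine spNorm_le_of_mem_sq fun x => ?_
  rw [← l2norm_sq_add_of_proj hQ hQQ x, ← l2norm_sq_add_of_proj hQ hQQ (M *ᵥ x)]
  have e1 : Q *ᵥ (M *ᵥ x) = (Q * M * Q) *ᵥ x + (Q * M * (1 - Q)) *ᵥ x := by
    rw [← add_mulVec, ← Matrix.mul_add, add_sub_cancel, Matrix.mul_one, mulVec_mulVec]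
  have e2 : (1 - Q) *ᵥ (M *ᵥ x) = ((1 - Q) * M * Q) *ᵥ x + ((1 - Q) * M * (1 - Q)) *ᵥ x := by
    rw [← add_mulVec, ← Matrix.mul_add, add_sub_cancel, Matrix.mul_one, mulVec_mulVec]
  refine le_trans ?_ (h _ _ (l2norm_nonneg _) (l2norm_nonneg _))
  refine add_le_add (pow_le_pow_left₀ (l2norm_nonneg _) ?_ 2)
    (pow_le_pow_left₀ (l2norm_nonneg _) ?_ 2)
  · rw [e1]
    exact (l2norm_add_le _ _).trans (add_le_add (h11 x) (h12 x))
  · rw [e2]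
    exact (l2norm_add_le _ _).trans (add_le_add (h21 x) (h22 x))

lemma eq_zero_of_star_dotProduct_mulVec {A : Matrix ι ι ℂ}
    (h : ∀ x, star x ⬝ᵥ (A *ᵥ x) = 0) : A = 0 := by
  have h1 : Matrix.toEuclideanLin A = 0 := by
    rw [← inner_map_self_eq_zero]
    intro x
    have := h (WithLp.ofLp x)
    rw [EuclideanSpace.inner_eq_star_dotProduct, dotProduct_star, dotProduct_comm, star_eq_zero]
    exact this
  simpa using h1

end BlockNorms

section UnitBlock

variable {n m : ℕ}

/-- The diagonal matrix unit at position `i`. -/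
def eMat (i : Fin n) : CMat n := single i i 1

/-- The matrix acting as multiplication by `t` on the range of `Q` and as the identity on its
kernel, when `Q` is idempotent. -/
def stretch (Q : CMat n) (t : ℂ) : CMat n := 1 + (t - 1) • Q

lemma eMat_mul_self (i : Fin n) : eMat i * eMat i = eMat i := by simp [eMat]

lemma eMat_transpose (i : Fin n) : (eMat i)ᵀ = eMat i := by simp [eMat]

lemma eMat_conjTranspose (i : Fin n) : (eMat i)ᴴ = eMat i := by simp [eMat]

lemma eMat_mul_mul_eMat (i : Fin n) (w : CMat n) : eMat i * w * eMat i = w i i • eMat i := by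
  simp [eMat, Matrix.smul_single]

lemma mul_eMat_of_symm {i : Fin n} {w : CMat n} (hw : wᵀ = w) (h : eMat i * w = 0) :
    w * eMat i = 0 := by
  have := congrArg transpose h
  rwa [transpose_mul, hw, eMat_transpose, transpose_zero] at this

lemma stretch_zero (Q : CMat n) : stretch Q 0 = 1 - Q := by
  simp [stretch, sub_eq_add_neg]

lemma stretch_one (Q : CMat n) : stretch Q 1 = 1 := by simp [stretch]

lemma stretch_mul {Q : CMat n} (hQ : Q * Q = Q) (s t : ℂ) :
    stretch Q s * stretch Q t = stretch Q (s * t) := by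
  simp only [stretch, Matrix.add_mul, Matrix.mul_add, Matrix.one_mul, Matrix.mul_one,
    Matrix.smul_mul, Matrix.mul_smul, hQ]
  module

lemma stretch_transpose (Q : CMat n) (t : ℂ) : (stretch Q t)ᵀ = stretch Qᵀ t := by
  simp [stretch]

lemma stretch_eq (Q : CMat n) (t : ℂ) : stretch Q t = (1 - Q) + t • Q := by
  rw [stretch]
  module

lemma mul_stretch {Q : CMat n} (hQ : Q * Q = Q) (t : ℂ) : Q * stretch Q t = t • Q := by
  rw [stretch_eq, Matrix.mul_add, Matrix.mul_sub, Matrix.mul_one, hQ, Matrix.mul_smul, hQ]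
  simp

lemma stretch_mul_self {Q : CMat n} (hQ : Q * Q = Q) (t : ℂ) : stretch Q t * Q = t • Q := by
  rw [stretch_eq, Matrix.add_mul, Matrix.sub_mul, Matrix.one_mul, hQ, Matrix.smul_mul, hQ]
  simp

lemma stretch_mul_mul_stretch (Q u : CMat n) (t : ℂ) :
    stretch Q t * u * stretch Q t = (1 - Q) * u * (1 - Q)
      + t • ((1 - Q) * u * Q + Q * u * (1 - Q)) + (t ^ 2) • (Q * u * Q) := by
  simp only [stretch_eq, Matrix.add_mul, Matrix.mul_add, Matrix.smul_mul, Matrix.mul_smul]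
  module

lemma stretch_symm {Q u : CMat n} (hQ : Qᵀ = Q) (hu : uᵀ = u) (t : ℂ) :
    (stretch Q t * u * stretch Q t)ᵀ = stretch Q t * u * stretch Q t := by
  rw [transpose_mul, transpose_mul, stretch_transpose, hQ, hu, Matrix.mul_assoc]

lemma l2norm_smul_eMat_mulVec (i : Fin n) (c : ℂ) (x : Fin n → ℂ) :
    l2norm ((c • eMat i) *ᵥ x) = ‖c‖ * l2norm (eMat i *ᵥ x) := by
  rw [smul_mulVec, l2norm_smul]

/-- Direct sums of a unimodular scalar block and a contraction are contractions. -/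
lemma spNorm_smul_eMat_add_le_one {i : Fin n} {ζ : ℂ} {w : CMat n} (hζ : ‖ζ‖ ≤ 1)
    (hw : wᵀ = w) (hw1 : spNorm w ≤ 1) (h : eMat i * w = 0) :
    spNorm (ζ • eMat i + w) ≤ 1 := by
  have h' := mul_eMat_of_symm hw h
  have hQ := eMat_mul_self i
  refine spNorm_block_le_one (eMat_conjTranspose i) hQ (a := 1) (b := 0) (c := 0) (d := 1)
    (fun x => ?_) (fun x => ?_) (fun x => ?_) (fun x => ?_) (fun p q _ _ => by simp)
  · rw [Matrix.mul_add, h, Matrix.mul_smul, hQ, add_zero, Matrix.smul_mul, hQ,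
      l2norm_smul_eMat_mulVec]
    exact mul_le_mul_of_nonneg_right hζ (l2norm_nonneg _)
  · rw [Matrix.mul_add, h, Matrix.mul_smul, hQ, add_zero, Matrix.smul_mul, Matrix.mul_sub,
      Matrix.mul_one, hQ, sub_self, smul_zero, zero_mulVec, l2norm_zero, zero_mul]
  · rw [Matrix.mul_assoc, Matrix.add_mul, h', Matrix.smul_mul, hQ, add_zero, Matrix.mul_smul,
      Matrix.sub_mul, Matrix.one_mul, hQ, sub_self, smul_zero, zero_mulVec, l2norm_zero, zero_mul]
  · have e : (1 - eMat i) * (ζ • eMat i + w) * (1 - eMat i) = w * (1 - eMat i) := by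
      rw [Matrix.mul_add, Matrix.mul_smul, Matrix.sub_mul, Matrix.sub_mul, hQ, h]
      simp
    rw [e, ← mulVec_mulVec, one_mul]
    exact l2norm_mulVec_le_of_le_one hw1 _

end UnitBlock

section MaximumPrinciple

variable {n m : ℕ}

/-- A polynomial map preserving symmetric contractions. -/
structure IsContractive (F : CMat n → CMat m) : Prop where
  poly : IsPolyMapIII F
  bound : ∀ Z, Zᵀ = Z → spNorm Z ≤ 1 → spNorm (F Z) ≤ 1
  symm : ∀ Z, Zᵀ = Z → (F Z)ᵀ = F Z

lemma isContractive_of_mapsTo {F : CMat n → CMat m} (hF : IsPolyMapIII F)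
    (h : Set.MapsTo F (OmegaIII n) (OmegaIII m)) : IsContractive F :=
  ⟨hF, fun _ hZ h1 => spNorm_apply_le_one_of_mapsTo hF.continuous h hZ h1,
    fun _ hZ => transpose_apply_of_mapsTo hF h hZ⟩

/-- `F` sends the variable `Z i i` to the partial isometry `V`, on matrices whose `i`-th row and
column vanish off the diagonal. -/
def FixesBlock (F : CMat n → CMat m) (i : Fin n) (V : CMat m) : Prop :=
  ∀ (ζ : ℂ) (w : CMat n), wᵀ = w → eMat i * w = 0 →
    F (ζ • eMat i + w) * Vᴴ = ζ • (V * Vᴴ)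

/-- The compression of `F` by the partial isometry `V` has no first order term in the
off-diagonal entries of the `i`-th row and column. -/
def FlatBlock (F : CMat n → CMat m) (i : Fin n) (V : CMat m) : Prop :=
  ∀ (κ : ℂ) (u : CMat n), uᵀ = u → ∀ j k, HasDerivAt (fun τ : ℂ =>
    (Vᴴ * F (κ • eMat i + stretch (eMat i) τ * u * stretch (eMat i) τ) * Vᴴ) j k) 0 0

lemma l2norm_mulVec_of_partialIsometry {V : CMat m} (hV : V * Vᴴ * V = V) (x : Fin m → ℂ) :
    l2norm (V *ᵥ (Vᴴ *ᵥ x)) = l2norm (Vᴴ *ᵥ x) := by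
  rw [← sq_eq_sq₀ (l2norm_nonneg _) (l2norm_nonneg _)]
  have h1 := star_dotProduct_self (V *ᵥ (Vᴴ *ᵥ x))
  have h2 := star_dotProduct_self (Vᴴ *ᵥ x)
  have hV' : Vᴴ * (V * Vᴴ) = Vᴴ := by
    have := congrArg conjTranspose hV
    rw [conjTranspose_mul, conjTranspose_mul, conjTranspose_conjTranspose] at this
    exact this
  rw [star_mulVec_dotProduct_mulVec, mulVec_mulVec, Matrix.mul_assoc, hV', h2] at h1
  exact_mod_cast h1.symm

lemma Differentiable.toLp_mulVec {F : ℂ → CMat m} (hF : Differentiable ℂ F) (x : Fin m → ℂ) :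
    Differentiable ℂ fun z => (WithLp.toLp 2 (F z *ᵥ x) : EuclideanSpace ℂ (Fin m)) :=
  (PiLp.continuousLinearEquiv 2 ℂ fun _ : Fin m => ℂ).symm.differentiable.comp
    (hF.matrix_mulVec x)

lemma IsPolyMapIII.differentiable_curve_mul {F : CMat n → CMat m} (hF : IsPolyMapIII F)
    (A B : CMat n) (C : CMat m) : Differentiable ℂ fun ζ : ℂ => F (A + ζ • B) * C :=
  (hF.differentiable_comp (differentiable_line A B)).matrix_mul (differentiable_const C)

lemma continuous_line (A B : CMat n) : Continuous fun ζ : ℂ => A + ζ • B := by fun_prop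

lemma fixesBlock_of_base {F : CMat n → CMat m} (hF : IsContractive F) {i : Fin n} {V : CMat m}
    (hV : V * Vᴴ * V = V) {z₀ : CMat n} (hz : z₀ᵀ = z₀) (h0 : eMat i * z₀ = 0)
    (h1 : spNorm z₀ < 1) (h : ∀ ζ : ℂ, ‖ζ‖ = 1 → F (ζ • eMat i + z₀) * Vᴴ = ζ • (V * Vᴴ)) :
    FixesBlock F i V := by
  have key : ∀ w : CMat n, wᵀ = w → eMat i * w = 0 → ∀ ζ : ℂ, ‖ζ‖ = 1 →
      F (ζ • eMat i + w) * Vᴴ = ζ • (V * Vᴴ) := by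
    intro w hw hew ζ hζ
    have hd := hF.poly.differentiable_curve_mul (ζ • eMat i + z₀) (w - z₀) Vᴴ
    suffices H : ∀ x, (F (ζ • eMat i + w) * Vᴴ) *ᵥ x = (ζ • (V * Vᴴ)) *ᵥ x from
      Matrix.ext_of_mulVec_single fun j => H _
    intro x
    set φ : ℂ → EuclideanSpace ℂ (Fin m) := fun l =>
      WithLp.toLp 2 ((F (ζ • eMat i + z₀ + l • (w - z₀)) * Vᴴ) *ᵥ x) with hφ
    have hφd : Differentiable ℂ φ := hd.toLp_mulVec x
    have hφ0 : φ 0 = WithLp.toLp 2 ((ζ • (V * Vᴴ)) *ᵥ x) := by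
      simp only [hφ, zero_smul, add_zero, h ζ hζ]
    have hn0 : ‖φ 0‖ = l2norm (Vᴴ *ᵥ x) := by
      rw [hφ0]
      change l2norm _ = _
      rw [smul_mulVec, l2norm_smul, hζ, one_mul, ← mulVec_mulVec,
        l2norm_mulVec_of_partialIsometry hV]
    have hc : ∀ᶠ l : ℂ in nhds 0, spNorm (z₀ + l • (w - z₀)) < 1 :=
      (continuous_spNorm.comp (continuous_line z₀ (w - z₀))).continuousAt.eventually_lt_const
        (by simpa using h1)
    have hmax : IsLocalMax (norm ∘ φ) 0 := by
      filter_upwards [hc] with l hl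
      simp only [Function.comp_apply, hn0]
      change l2norm _ ≤ _
      rw [← mulVec_mulVec, add_assoc]
      refine l2norm_mulVec_le_of_le_one (hF.bound _ ?_ ?_) _
      · simp [hw, hz, eMat_transpose]
      · refine spNorm_smul_eMat_add_le_one hζ.le ?_ hl.le ?_
        · simp [hw, hz]
        · simp [Matrix.mul_add, Matrix.mul_sub, h0, hew]
    have hev := Complex.eventually_eq_of_isLocalMax_norm
      (Filter.Eventually.of_forall fun z => hφd z) hmax
    have := congrFun (hφd.eq_of_eventually (differentiable_const (φ 0)) hev) 1
    rw [hφ0] at this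
    simp only [hφ, one_smul] at this
    rw [show ζ • eMat i + z₀ + (w - z₀) = ζ • eMat i + w by abel] at this
    exact WithLp.toLp_injective 2 this
  intro ζ w hw hew
  have hd := hF.poly.differentiable_curve_mul w (eMat i) Vᴴ
  have := Differentiable.eq_of_circle hd (ψ := fun ζ : ℂ => ζ • (V * Vᴴ))
    (differentiable_id.smul_const _) fun z hz => by
      change F (w + z • eMat i) * Vᴴ = _
      rw [add_comm]
      exact key w hw hew z hz
  rw [add_comm]
  exact congrFun this ζ

end MaximumPrinciple

section FlatBlock

variable {n m : ℕ}

lemma IsPolyMapIII.contDiff_comp {E : Type*} [NormedAddCommGroup E] [NormedSpace ℂ E]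
    {f : CMat n → CMat m} (hf : IsPolyMapIII f) {γ : E → CMat n}
    (hγ : ∀ i j, ContDiff ℂ 2 fun x => γ x i j) (i j : Fin m) :
    ContDiff ℂ 2 fun x => f (γ x) i j := by
  obtain ⟨p, hp⟩ := hf i j
  simp only [hp]
  clear hp
  induction p using MvPolynomial.induction_on with
  | C a => simpa using contDiff_const
  | add p q hp hq => simpa using hp.add hq
  | mul_X p q hp => simpa using hp.mul (hγ q.1 q.2)

lemma partialIsometry_conjTranspose {V : CMat m} (hV : V * Vᴴ * V = V) : Vᴴ * V * Vᴴ = Vᴴ := by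
  have := congrArg conjTranspose hV
  rwa [conjTranspose_mul, conjTranspose_mul, conjTranspose_conjTranspose,
    ← Matrix.mul_assoc] at this

lemma spNorm_smul_eMat_add_add_le_one {i : Fin n} {κ : ℂ} {w y : CMat n} {r : ℝ} (hκ : ‖κ‖ = 1)
    (hw : wᵀ = w) (hw1 : spNorm w ≤ 1 / 2) (h : eMat i * w = 0)
    (hy1 : eMat i * y * eMat i = 0) (hy2 : (1 - eMat i) * y * (1 - eMat i) = 0) (hr0 : 0 ≤ r)
    (hr : spNorm y ≤ r) (hr1 : r ≤ 1 / 4) :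
    spNorm ((κ * ((1 - 4 * r ^ 2 : ℝ) : ℂ)) • eMat i + w + y) ≤ 1 := by
  have h' := mul_eMat_of_symm hw h
  have hQ := eMat_mul_self i
  have hQc := eMat_conjTranspose i
  set Q := eMat i
  have hb : ∀ A : CMat n, ∀ t, spNorm A ≤ t → ∀ x, l2norm (A *ᵥ x) ≤ t * l2norm x :=
    fun A t ht x => (l2norm_mulVec_le A x).trans (mul_le_mul_of_nonneg_right ht (l2norm_nonneg x))
  have hproj : ∀ x, l2norm (Q *ᵥ x) ≤ l2norm x := fun x => by
    have := l2norm_sq_add_of_proj hQc hQ x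
    nlinarith [l2norm_nonneg (Q *ᵥ x), l2norm_nonneg x, sq_nonneg (l2norm ((1 - Q) *ᵥ x))]
  have hproj' : ∀ x, l2norm ((1 - Q) *ᵥ x) ≤ l2norm x := fun x => by
    have := l2norm_sq_add_of_proj hQc hQ x
    nlinarith [l2norm_nonneg ((1 - Q) *ᵥ x), l2norm_nonneg x, sq_nonneg (l2norm (Q *ᵥ x))]
  refine spNorm_block_le_one hQc hQ (a := 1 - 4 * r ^ 2) (b := r) (c := r) (d := 1 / 2)
    (fun x => ?_) (fun x => ?_) (fun x => ?_) (fun x => ?_) (fun p q hp hq => ?_)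
  · rw [Matrix.mul_add, Matrix.mul_add, Matrix.add_mul, hy1, h, Matrix.mul_smul, hQ, add_zero,
      add_zero, Matrix.smul_mul, hQ, smul_mulVec, l2norm_smul, norm_mul, hκ, one_mul,
      Complex.norm_real, Real.norm_of_nonneg (by nlinarith)]
  · have e : Q * ((κ * ((1 - 4 * r ^ 2 : ℝ) : ℂ)) • Q + w + y) * (1 - Q)
        = Q * (y * (1 - Q)) := by
      rw [Matrix.mul_add, Matrix.mul_add, h, Matrix.mul_smul, hQ, add_zero, Matrix.add_mul,
        Matrix.smul_mul, Matrix.mul_sub Q, Matrix.mul_one, hQ, sub_self, smul_zero, zero_add,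
        Matrix.mul_assoc]
    rw [e, ← mulVec_mulVec, ← mulVec_mulVec]
    exact (hproj _).trans (hb _ _ hr _)
  · have e : (1 - Q) * ((κ * ((1 - 4 * r ^ 2 : ℝ) : ℂ)) • Q + w + y) * Q
        = (1 - Q) * (y * Q) := by
      rw [Matrix.mul_assoc, Matrix.add_mul, Matrix.add_mul, h', Matrix.smul_mul, hQ, add_zero,
        Matrix.mul_add, Matrix.mul_smul, Matrix.sub_mul, Matrix.one_mul, hQ, sub_self, smul_zero,
        zero_add]
    rw [e, ← mulVec_mulVec, ← mulVec_mulVec]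
    exact (hproj' _).trans (hb _ _ hr _)
  · have e : (1 - Q) * ((κ * ((1 - 4 * r ^ 2 : ℝ) : ℂ)) • Q + w + y) * (1 - Q)
        = w * (1 - Q) := by
      rw [Matrix.mul_add, Matrix.add_mul, hy2, add_zero, Matrix.mul_add, Matrix.mul_smul,
        Matrix.sub_mul, Matrix.sub_mul, hQ, h]
      simp
    rw [e, ← mulVec_mulVec]
    exact hb _ _ hw1 _
  · nlinarith [mul_nonneg hp hq, mul_nonneg (mul_nonneg hr0 hp) hq, sq_nonneg (4 * r * p - 2 * q),
      sq_nonneg (r * p), sq_nonneg (r * q), sq_nonneg (2 * r * p - q),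
      mul_nonneg (sq_nonneg (r * p)) (by nlinarith : (0:ℝ) ≤ 1 / 16 - r ^ 2),
      mul_nonneg (sq_nonneg q) (by nlinarith : (0:ℝ) ≤ 1 / 16 - r ^ 2),
      mul_nonneg (mul_nonneg (mul_nonneg hr0 hp) hq) (sq_nonneg r)]

/-- The first order vanishing behind `FlatBlock`, at unimodular corner entries. -/
lemma fderiv_eq_zero_of_norm_eq_one {F : CMat n → CMat m} (hF : IsContractive F) {i : Fin n}
    {V : CMat m} (hV : V * Vᴴ * V = V) (hb : FixesBlock F i V) {w y : CMat n} (hw : wᵀ = w)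
    (hew : eMat i * w = 0) (hy : yᵀ = y) (hy1 : eMat i * y * eMat i = 0)
    (hy2 : (1 - eMat i) * y * (1 - eMat i) = 0) (x : Fin m → ℂ) {Ψ : ℂ × ℂ × ℂ → ℂ}
    (hΨ : ∀ p, Ψ p = star ((V * Vᴴ) *ᵥ x) ⬝ᵥ
      ((F (p.1 • eMat i + p.2.1 • w + p.2.2 • y) * Vᴴ) *ᵥ x))
    (hd : Differentiable ℂ Ψ) {κ l : ℂ} (hκ : ‖κ‖ = 1) (hl : spNorm (l • w) ≤ 1 / 2) :
    fderiv ℂ Ψ (κ, l, 0) (0, 0, 1) = 0 := by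
  set G := fderiv ℂ Ψ (κ, l, 0) (0, 0, 1) with hG
  set c : ℂ := κ * star G with hc
  set Y : ℝ := spNorm (c • y)
  have hκκ : star κ * κ = 1 := by
    rw [RCLike.star_def, ← Complex.normSq_eq_conj_mul_self, Complex.normSq_eq_norm_sq, hκ]
    simp
  have hcurve : HasDerivAt (fun s : ℂ => ((κ * (1 - 4 * (s * Y) ^ 2), l, c * s) : ℂ × ℂ × ℂ))
      (0, 0, c) 0 := by
    refine HasDerivAt.prodMk ?_ (HasDerivAt.prodMk (hasDerivAt_const _ _) ?_)
    · have := (((((hasDerivAt_id (0 : ℂ)).mul_const (Y : ℂ)).pow 2).const_mul 4).const_sub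
        1).const_mul κ
      simpa using this
    · simpa using (hasDerivAt_id (0 : ℂ)).const_mul c
  have h0 : ((κ * (1 - 4 * ((0 : ℂ) * Y) ^ 2), l, c * 0) : ℂ × ℂ × ℂ) = (κ, l, 0) := by simp
  have hcomp := (hd _).hasFDerivAt.comp_hasDerivAt (0 : ℂ) hcurve
  rw [h0, show ((0, 0, c) : ℂ × ℂ × ℂ) = c • (0, 0, 1) by simp, map_smul, ← hG] at hcomp
  have hre := ((hcomp.const_mul (star κ))).real_of_complex (z := 0)
  have hv : star κ * (c • G) = ((‖G‖ ^ 2 : ℝ) : ℂ) := by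
    rw [smul_eq_mul, hc, show star κ * (κ * star G * G) = (star κ * κ) * (star G * G) by ring,
      hκκ, one_mul, RCLike.star_def, ← Complex.normSq_eq_conj_mul_self, Complex.normSq_eq_norm_sq]
  have hmax : IsLocalMax (fun s : ℝ => (star κ * (Ψ ∘ fun s : ℂ =>
      ((κ * (1 - 4 * (s * Y) ^ 2), l, c * s) : ℂ × ℂ × ℂ)) s).re) 0 := by
    have hsm : ∀ᶠ s : ℝ in nhds 0, |s| * Y < 1 / 4 :=
      (by fun_prop : Continuous fun s : ℝ => |s| * Y).continuousAt.eventually_lt_const (by simp)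
    filter_upwards [hsm] with s hs
    have hval : (star κ * (Ψ ∘ fun s : ℂ =>
        ((κ * (1 - 4 * (s * Y) ^ 2), l, c * s) : ℂ × ℂ × ℂ)) (0 : ℝ)).re
          = l2norm (Vᴴ *ᵥ x) ^ 2 := by
      simp only [Function.comp_apply, Complex.ofReal_zero, h0, hΨ, zero_smul, add_zero]
      rw [hb κ (l • w) (by rw [transpose_smul, hw]) (by rw [Matrix.mul_smul, hew, smul_zero]),
        smul_mulVec, dotProduct_smul, star_dotProduct_self, smul_eq_mul, ← mul_assoc, hκκ, one_mul,
        Complex.ofReal_re, ← mulVec_mulVec, l2norm_mulVec_of_partialIsometry hV]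
    rw [hval]
    refine (Complex.re_le_norm _).trans ?_
    rw [norm_mul, norm_star, hκ, one_mul, Function.comp_apply, hΨ]
    refine (norm_star_dotProduct_le _ _).trans ?_
    rw [sq (l2norm (Vᴴ *ᵥ x)), ← mulVec_mulVec, ← mulVec_mulVec, l2norm_mulVec_of_partialIsometry hV]
    refine mul_le_mul_of_nonneg_left (l2norm_mulVec_le_of_le_one (hF.bound _ ?_ ?_) _)
      (l2norm_nonneg (Vᴴ *ᵥ x))
    · simp [hw, hy, eMat_transpose]
    · have := spNorm_smul_eMat_add_add_le_one (i := i) (w := l • w) (y := (c * s) • y)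
        (r := |s| * Y) hκ (by rw [transpose_smul, hw]) hl (by rw [Matrix.mul_smul, hew, smul_zero])
        (by rw [Matrix.mul_smul, Matrix.smul_mul, hy1, smul_zero])
        (by rw [Matrix.mul_smul, Matrix.smul_mul, hy2, smul_zero])
        (mul_nonneg (abs_nonneg s) (spNorm_nonneg _))
        (by rw [mul_comm c, ← smul_smul, spNorm_smul, Complex.norm_real, Real.norm_eq_abs]) hs.le
      rw [mul_pow, sq_abs, ← mul_pow] at this
      push_cast at this ⊢
      exact this
  have hz := hmax.hasDerivAt_eq_zero hre
  rw [hv, Complex.ofReal_re] at hz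
  simpa using hz

lemma flatBlock_of_fixesBlock {F : CMat n → CMat m} (hF : IsContractive F) {i : Fin n}
    {V : CMat m} (hV : V * Vᴴ * V = V) (hb : FixesBlock F i V) : FlatBlock F i V := by
  intro κ u hu
  have hQ := eMat_mul_self i
  have hQT := eMat_transpose i
  set w : CMat n := (1 - eMat i) * u * (1 - eMat i) with hw
  set y : CMat n := (1 - eMat i) * u * eMat i + eMat i * u * (1 - eMat i) with hy
  have hQ' : eMat i * (1 - eMat i) = 0 := by rw [Matrix.mul_sub, Matrix.mul_one, hQ, sub_self]
  have hQ'' : (1 - eMat i) * eMat i = 0 := by rw [Matrix.sub_mul, Matrix.one_mul, hQ, sub_self]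
  have hwT : wᵀ = w := by
    simp only [hw, transpose_mul, transpose_sub, transpose_one, hQT, hu, Matrix.mul_assoc]
  have hew : eMat i * w = 0 := by
    rw [hw, ← Matrix.mul_assoc, ← Matrix.mul_assoc, hQ', Matrix.zero_mul, Matrix.zero_mul]
  have hyT : yᵀ = y := by
    simp only [hy, transpose_add, transpose_mul, transpose_sub, transpose_one, hQT, hu,
      Matrix.mul_assoc]
    abel
  have hy1 : eMat i * y * eMat i = 0 := by
    rw [hy, Matrix.mul_add, Matrix.add_mul, ← Matrix.mul_assoc, ← Matrix.mul_assoc, hQ',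
      Matrix.zero_mul, Matrix.zero_mul, Matrix.zero_mul, zero_add, Matrix.mul_assoc,
      Matrix.mul_assoc _ _ (eMat i), hQ'', Matrix.mul_zero, Matrix.mul_zero]
  have hy2 : (1 - eMat i) * y * (1 - eMat i) = 0 := by
    rw [hy, Matrix.mul_add, Matrix.add_mul, ← Matrix.mul_assoc _ (eMat i * u),
      ← Matrix.mul_assoc _ (eMat i), hQ'', Matrix.zero_mul, Matrix.zero_mul, Matrix.zero_mul,
      add_zero, Matrix.mul_assoc, Matrix.mul_assoc _ (eMat i), hQ', Matrix.mul_zero,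
      Matrix.mul_zero]
  have hsplit : ∀ τ : ℂ, κ • eMat i + stretch (eMat i) τ * u * stretch (eMat i) τ
      = (κ + τ ^ 2 * u i i) • eMat i + (1 : ℂ) • w + τ • y := fun τ => by
    rw [stretch_mul_mul_stretch, eMat_mul_mul_eMat, ← hw, ← hy]
    module
  set N : ℂ → CMat m := fun τ =>
    (V * Vᴴ) * (F (κ • eMat i + stretch (eMat i) τ * u * stretch (eMat i) τ) * Vᴴ) with hN
  have hNd : Differentiable ℂ N := by
    refine (differentiable_const (V * Vᴴ)).matrix_mul
      ((hF.poly.differentiable_comp ?_).matrix_mul (differentiable_const Vᴴ))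
    simp only [hsplit]
    refine differentiable_matrix_iff.2 fun j k => ?_
    simp only [Matrix.add_apply, Matrix.smul_apply, smul_eq_mul]
    fun_prop
  have hquad : ∀ x : Fin m → ℂ, HasDerivAt (fun τ => star x ⬝ᵥ (N τ *ᵥ x)) 0 0 := by
    intro x
    set Ψ : ℂ × ℂ × ℂ → ℂ := fun p => star ((V * Vᴴ) *ᵥ x) ⬝ᵥ
      ((F (p.1 • eMat i + p.2.1 • w + p.2.2 • y) * Vᴴ) *ᵥ x) with hΨ
    have hcd : ContDiff ℂ 2 Ψ := by
      simp only [hΨ, dotProduct, mulVec, Matrix.mul_apply]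
      refine ContDiff.sum fun j _ => contDiff_const.mul (ContDiff.sum fun k _ =>
        ContDiff.mul (ContDiff.sum fun r _ => ContDiff.mul (hF.poly.contDiff_comp ?_ _ _)
          contDiff_const) contDiff_const)
      intro a b
      simp only [Matrix.add_apply, Matrix.smul_apply, smul_eq_mul]
      fun_prop
    have hd : Differentiable ℂ Ψ := hcd.differentiable (by norm_num)
    have hfd : Differentiable ℂ fun p => fderiv ℂ Ψ p (0, 0, 1) :=
      ((hcd.fderiv_right (m := 1) (by norm_num)).differentiable (by norm_num)).clm_apply
        (differentiable_const _)
    have h1 : ∀ k : ℂ, ‖k‖ = 1 → ∀ l : ℂ, fderiv ℂ Ψ (k, l, 0) (0, 0, 1) = 0 := by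
      intro k hk
      have hl : ∀ᶠ l : ℂ in nhds 0, spNorm (l • w) < 1 / 2 :=
        (continuous_spNorm.comp (by fun_prop : Continuous fun l : ℂ =>
          l • w)).continuousAt.eventually_lt_const (by simp [spNorm_zero])
      refine congrFun (Differentiable.eq_of_eventually (z₀ := 0)
        (hfd.comp (by fun_prop : Differentiable ℂ fun l : ℂ => ((k, l, 0) : ℂ × ℂ × ℂ)))
        (differentiable_const (0 : ℂ)) ?_)
      filter_upwards [hl] with l hl
      exact fderiv_eq_zero_of_norm_eq_one hF hV hb hwT hew hyT hy1 hy2 x (fun _ => rfl) hd hk hl.le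
    have h2 : fderiv ℂ Ψ (κ, 1, 0) (0, 0, 1) = 0 :=
      congrFun (Differentiable.eq_of_circle
        (hfd.comp (by fun_prop : Differentiable ℂ fun k : ℂ => ((k, 1, 0) : ℂ × ℂ × ℂ)))
        (differentiable_const (0 : ℂ)) fun k hk => h1 k hk 1) κ
    have hcurve : HasDerivAt (fun τ : ℂ => ((κ + τ ^ 2 * u i i, 1, τ) : ℂ × ℂ × ℂ))
        (0, 0, 1) 0 := by
      refine HasDerivAt.prodMk ?_ (HasDerivAt.prodMk (hasDerivAt_const _ _) (hasDerivAt_id _))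
      simpa using (((hasDerivAt_id (0 : ℂ)).pow 2).mul_const (u i i)).const_add κ
    have hcomp := (hd _).hasFDerivAt.comp_hasDerivAt (0 : ℂ) hcurve
    rw [show ((κ + (0 : ℂ) ^ 2 * u i i, 1, 0) : ℂ × ℂ × ℂ) = (κ, 1, 0) by simp, h2] at hcomp
    refine hcomp.congr_of_eventuallyEq (Filter.Eventually.of_forall fun τ => ?_)
    simp only [hN, hΨ, Function.comp_apply, ← hsplit]
    rw [star_mulVec_dotProduct_mulVec, conjTranspose_mul, conjTranspose_conjTranspose]
  have hNe : ∀ j k, HasDerivAt (fun τ => N τ j k) (deriv (fun τ => N τ j k) 0) 0 :=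
    fun j k => (hNd.entry j k 0).hasDerivAt
  set D : CMat m := of fun j k => deriv (fun τ => N τ j k) 0 with hD
  have hD0 : D = 0 := eq_zero_of_star_dotProduct_mulVec fun x => by
    refine HasDerivAt.unique ?_ (hquad x)
    simp only [dotProduct, mulVec]
    exact HasDerivAt.fun_sum fun j _ => (HasDerivAt.fun_sum fun k _ =>
      (hNe j k).mul_const _).const_mul _
  intro j k
  have hN0 : ∀ j k, HasDerivAt (fun τ => N τ j k) 0 0 := fun j k => by
    have := hNe j k
    rwa [show deriv (fun τ => N τ j k) 0 = D j k from rfl, hD0] at this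
  have h3 : ∀ τ, Vᴴ * F (κ • eMat i + stretch (eMat i) τ * u * stretch (eMat i) τ) * Vᴴ
      = Vᴴ * N τ := fun τ => by
    simp only [hN]
    rw [← Matrix.mul_assoc Vᴴ, ← Matrix.mul_assoc Vᴴ, partialIsometry_conjTranspose hV,
      Matrix.mul_assoc]
  rw [funext fun τ => congrFun (congrFun (h3 τ) j) k]
  simp only [Matrix.mul_apply]
  have := HasDerivAt.fun_sum (u := Finset.univ) fun r _ => (hN0 r k).const_mul (Vᴴ j r)
  simpa only [mul_zero, Finset.sum_const_zero] using this

end FlatBlock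

section PolynomialTools

open Polynomial

/-- A complex function of one variable given by a polynomial. -/
def IsPolyFun (φ : ℂ → ℂ) : Prop := ∃ p : ℂ[X], ∀ z, φ z = p.eval z

lemma isPolyFun_const (c : ℂ) : IsPolyFun fun _ => c := ⟨C c, fun z => by simp⟩

lemma isPolyFun_id : IsPolyFun fun z => z := ⟨X, fun z => by simp⟩

lemma IsPolyFun.add {φ ψ : ℂ → ℂ} (hφ : IsPolyFun φ) (hψ : IsPolyFun ψ) :
    IsPolyFun fun z => φ z + ψ z := by
  obtain ⟨p, hp⟩ := hφ
  obtain ⟨q, hq⟩ := hψ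
  exact ⟨p + q, fun z => by simp [hp, hq]⟩

lemma IsPolyFun.mul {φ ψ : ℂ → ℂ} (hφ : IsPolyFun φ) (hψ : IsPolyFun ψ) :
    IsPolyFun fun z => φ z * ψ z := by
  obtain ⟨p, hp⟩ := hφ
  obtain ⟨q, hq⟩ := hψ
  exact ⟨p * q, fun z => by simp [hp, hq]⟩

lemma IsPolyFun.sub {φ ψ : ℂ → ℂ} (hφ : IsPolyFun φ) (hψ : IsPolyFun ψ) :
    IsPolyFun fun z => φ z - ψ z := by
  obtain ⟨p, hp⟩ := hφ
  obtain ⟨q, hq⟩ := hψ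
  exact ⟨p - q, fun z => by simp [hp, hq]⟩

lemma isPolyFun_sum {ι : Type*} {s : Finset ι} {φ : ι → ℂ → ℂ} (h : ∀ i, IsPolyFun (φ i)) :
    IsPolyFun fun z => ∑ i ∈ s, φ i z := by
  choose p hp using h
  exact ⟨∑ i ∈ s, p i, fun z => by simp [hp, eval_finsetSum]⟩

lemma IsPolyMapIII.isPolyFun_comp {n m : ℕ} {f : CMat n → CMat m} (hf : IsPolyMapIII f)
    {γ : ℂ → CMat n} (hγ : ∀ i j, IsPolyFun fun z => γ z i j) (i j : Fin m) :
    IsPolyFun fun z => f (γ z) i j := by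
  obtain ⟨p, hp⟩ := hf i j
  simp only [hp]
  clear hp
  induction p using MvPolynomial.induction_on with
  | C a => simpa using isPolyFun_const a
  | add p q hp hq => simpa using hp.add hq
  | mul_X p q hp => simpa using hp.mul (hγ q.1 q.2)

lemma exists_polynomial_matrix {ι : Type*} {M : ℂ → Matrix ι ι ℂ}
    (h : ∀ i j, IsPolyFun fun z => M z i j) :
    ∃ P : Matrix ι ι ℂ[X], ∀ z, P.map (evalRingHom z) = M z := by
  choose p hp using h
  exact ⟨of p, fun z => by
    ext i j
    simp [hp]⟩

lemma isPolyFun_det {ι : Type*} [Fintype ι] [DecidableEq ι] {M : ℂ → Matrix ι ι ℂ}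
    (h : ∀ i j, IsPolyFun fun z => M z i j) : IsPolyFun fun z => (M z).det := by
  obtain ⟨P, hP⟩ := exists_polynomial_matrix h
  refine ⟨P.det, fun z => ?_⟩
  beta_reduce
  rw [← hP z, ← coe_evalRingHom, RingHom.map_det]
  rfl

lemma isPolyFun_matrix_mul {ι : Type*} [Fintype ι] {M N : ℂ → Matrix ι ι ℂ}
    (hM : ∀ i j, IsPolyFun fun z => M z i j) (hN : ∀ i j, IsPolyFun fun z => N z i j) (i j : ι) :
    IsPolyFun fun z => (M z * N z) i j := by
  simp only [Matrix.mul_apply]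
  exact isPolyFun_sum fun k => (hM i k).mul (hN k j)

lemma isPolyFun_line {ι : Type*} (A B : Matrix ι ι ℂ) (i j : ι) :
    IsPolyFun fun z => (A + z • B) i j :=
  (isPolyFun_const (A i j)).add (isPolyFun_id.mul (isPolyFun_const (B i j)))

/-- A polynomial which is invertible after a Möbius change of variable is a power of the
denominator. -/
lemma exists_eval_eq_pow {q r : ℂ[X]} {α : ℂ} (hα : α ≠ 0) (h0 : q.eval 0 = 1)
    (h : ∀ z, 1 - α * z ≠ 0 → q.eval z * r.eval (z / (1 - α * z)) = 1) :
    ∃ k : ℕ, ∀ z, q.eval z = (1 - α * z) ^ k := by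
  have hroots : ∀ z ∈ q.roots, z = α⁻¹ := by
    intro z hz
    by_contra hne
    have h1 : 1 - α * z ≠ 0 := fun h1 => hne (by
      field_simp
      linear_combination -h1)
    have := h z h1
    rw [(mem_roots'.1 hz).2, zero_mul] at this
    exact zero_ne_one this
  set k := Multiset.card q.roots
  have hrep : q.roots = Multiset.replicate k α⁻¹ := Multiset.eq_replicate_card.2 hroots
  have hq := (IsAlgClosed.splits q).eq_prod_roots
  rw [hrep, Multiset.map_replicate, Multiset.prod_replicate] at hq
  have hev : ∀ z, q.eval z = q.leadingCoeff * (z - α⁻¹) ^ k := fun z => by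
    conv_lhs => rw [hq]
    simp
  refine ⟨k, fun z => ?_⟩
  rw [hev, zero_sub] at h0
  have h2 : z - α⁻¹ = (-α⁻¹) * (1 - α * z) := by
    field_simp
    ring
  rw [hev, h2, mul_pow, ← mul_assoc, h0, one_mul]

lemma natDegree_le_of_mobius {p r : ℂ[X]} {α : ℂ} (hα : α ≠ 0) {k : ℕ}
    (h : ∀ z, 1 - α * z ≠ 0 → p.eval z = r.eval (z / (1 - α * z)) * (1 - α * z) ^ k) :
    p.natDegree ≤ k := by
  by_contra! hk
  set N := p.natDegree with hN
  have hp0 : p ≠ 0 := by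
    rintro rfl
    simp at hN
    omega
  set P : ℂ[X] := ∑ j ∈ Finset.range (N + 1), C (p.coeff j) * X ^ j * (1 + C α * X) ^ (N - j)
  have h1 : ∀ v, 1 + α * v ≠ 0 → P.eval v = (r * (1 + C α * X) ^ (N - k)).eval v := by
    intro v hv
    have e1 : 1 - α * (v / (1 + α * v)) = (1 + α * v)⁻¹ := by
      field_simp
      ring
    have e2 : v / (1 + α * v) / (1 - α * (v / (1 + α * v))) = v := by
      rw [e1, div_inv_eq_mul, div_mul_cancel₀ _ hv]
    have e3 : P.eval v = p.eval (v / (1 + α * v)) * (1 + α * v) ^ N := by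
      rw [eval_eq_sum_range (p := p), Finset.sum_mul, eval_finsetSum]
      refine Finset.sum_congr rfl fun j hj => ?_
      have hj : j ≤ N := Nat.lt_succ_iff.1 (Finset.mem_range.1 hj)
      obtain ⟨d, hd⟩ := Nat.exists_eq_add_of_le hj
      rw [hd]
      simp only [eval_mul, eval_C, eval_pow, eval_X, eval_add, eval_one, Nat.add_sub_cancel_left]
      rw [div_pow, pow_add, mul_assoc, mul_assoc, ← mul_assoc (_ / _),
        div_mul_cancel₀ _ (pow_ne_zero j hv)]
    have h2 := h (v / (1 + α * v)) (by
      rw [e1]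
      exact inv_ne_zero hv)
    rw [e2, e1] at h2
    rw [e3, h2]
    obtain ⟨d, hd⟩ := Nat.exists_eq_add_of_le hk.le
    rw [hd]
    simp only [eval_mul, eval_C, eval_pow, eval_X, eval_add, eval_one, Nat.add_sub_cancel_left]
    rw [mul_assoc, pow_add, ← mul_assoc (_⁻¹ ^ k), ← mul_pow, inv_mul_cancel₀ hv, one_pow, one_mul]
  have h3 : P = r * (1 + C α * X) ^ (N - k) := by
    refine eq_of_infinite_eval_eq _ _ (Set.Infinite.mono (s := {-α⁻¹}ᶜ) (fun v hv => h1 v ?_)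
      (Set.finite_singleton _).infinite_compl)
    intro h0
    exact hv (by
      rw [Set.mem_singleton_iff]
      field_simp
      linear_combination h0)
  have h4 := congrArg (eval (-α⁻¹)) h3
  have h5 : 1 + α * (-α⁻¹) = 0 := by
    field_simp
    ring
  have h6 : P.eval (-α⁻¹) = p.coeff N * (-α⁻¹) ^ N := by
    rw [eval_finsetSum, Finset.sum_eq_single N]
    · simp
    · intro j hj hjN
      have hj : j < N + 1 := Finset.mem_range.1 hj
      simp only [eval_mul, eval_C, eval_pow, eval_X, eval_add, eval_one, h5]
      rw [zero_pow (by omega), mul_zero]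
    · simp
  rw [h6] at h4
  simp only [eval_mul, eval_C, eval_pow, eval_X, eval_add, eval_one, h5] at h4
  rw [zero_pow (by omega), mul_zero] at h4
  rcases mul_eq_zero.1 h4 with h7 | h7
  · exact hp0 (leadingCoeff_eq_zero.1 h7)
  · exact pow_ne_zero N (neg_ne_zero.2 (inv_ne_zero hα)) h7

variable {ι : Type*} [Fintype ι] [DecidableEq ι]

lemma eval_charpolyRev_eq_det (N : Matrix ι ι ℂ) (s : ℂ) :
    (charpolyRev N).eval s = (1 - s • N).det := by
  rw [charpolyRev, ← coe_evalRingHom, RingHom.map_det]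
  congr 1
  ext i j
  simp only [coe_evalRingHom, RingHom.mapMatrix_apply, Matrix.map_apply, Matrix.sub_apply,
    Matrix.smul_apply, smul_eq_mul, eval_sub, eval_mul, eval_X, eval_C, Matrix.one_apply]
  split_ifs <;> simp

/-- If `det (1 - s ζ M(ζ))` has degree at most `k` in `ζ` for all `s`, then
`det (1 - s M(ζ))` has degree at most `k` in `s` for all `ζ`. -/
lemma natDegree_charpolyRev_le {M : ℂ → Matrix ι ι ℂ} (hM : ∀ i j, IsPolyFun fun z => M z i j)
    {k : ℕ} (h : ∀ s : ℂ, ∃ p : ℂ[X], p.natDegree ≤ k ∧ ∀ z, p.eval z = (1 - (s * z) • M z).det)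
    (z : ℂ) : (charpolyRev (M z)).natDegree ≤ k := by
  obtain ⟨P, hP⟩ := exists_polynomial_matrix hM
  set Q := charpolyRev P with hQ
  have hmap : ∀ z, Q.map (evalRingHom z) = charpolyRev (M z) := by
    intro z
    rw [hQ, charpolyRev, charpolyRev, ← coe_mapRingHom, RingHom.map_det, ← hP z]
    congr 1
    ext i j : 2
    simp [Matrix.one_apply, apply_ite]
  have hcoeff : ∀ j, k < j → Q.coeff j = 0 := by
    have key : ∀ l, k < l → ∀ j, (X ^ j * Q.coeff j).coeff l = 0 := by
      intro l hl
      set R : ℂ[X] := ∑ j ∈ Finset.range (Q.natDegree + 1),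
        monomial j ((X ^ j * Q.coeff j).coeff l) with hR
      have hR0 : R = 0 := by
        refine Polynomial.funext fun s => ?_
        obtain ⟨p, hpk, hp⟩ := h s
        have hpe : p = ∑ j ∈ Finset.range (Q.natDegree + 1), C (s ^ j) * (X ^ j * Q.coeff j) := by
          refine Polynomial.funext fun z => ?_
          rw [hp, ← eval_charpolyRev_eq_det, ← hmap, eval_map, eval₂_eq_sum_range, eval_finsetSum]
          refine Finset.sum_congr rfl fun j _ => ?_
          simp
          ring
        have h1 := coeff_eq_zero_of_natDegree_lt (hpk.trans_lt hl)
        rw [hpe, finsetSum_coeff] at h1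
        rw [hR, eval_finsetSum, eval_zero, ← h1]
        refine Finset.sum_congr rfl fun j _ => ?_
        rw [eval_monomial, coeff_C_mul, mul_comm]
      intro j
      by_cases hj : j ∈ Finset.range (Q.natDegree + 1)
      · have h2 := congrArg (fun p => coeff p j) hR0
        simp only [hR, finsetSum_coeff, coeff_monomial, coeff_zero] at h2
        rwa [Finset.sum_ite_eq' , if_pos hj] at h2
      · rw [coeff_eq_zero_of_natDegree_lt (p := Q) (by simpa using hj), mul_zero, coeff_zero]
    intro j hj
    ext d
    have := key (d + j) (by omega) j
    rwa [coeff_X_pow_mul] at this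
  rw [← hmap, natDegree_le_iff_coeff_eq_zero]
  intro j hj
  rw [coeff_map, hcoeff j hj, map_zero]

end PolynomialTools

section TraceBounds

open Polynomial

variable {m : ℕ}

lemma hasDerivAt_det_of_eq_one {A : ℂ → CMat m} {A' : CMat m} {z : ℂ}
    (h : ∀ i j, HasDerivAt (fun z => A z i j) (A' i j) z) (h1 : A z = 1) :
    HasDerivAt (fun z => (A z).det) A'.trace z := by
  set Δ : (Fin m → Fin m → ℂ) → ℂ := fun B => (of B).det with hΔ
  have hd : Differentiable ℂ Δ := fun B => by
    rw [← differentiableWithinAt_univ]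
    refine DifferentiableWithinAt.matrix_det (differentiableWithinAt_matrix_iff.2 fun i j => ?_)
    exact (differentiable_pi.1 (differentiable_pi.1 differentiable_id i) j _).differentiableWithinAt
  have key : ∀ (A : ℂ → CMat m) (z : ℂ), (∀ i j, HasDerivAt (fun z => A z i j) (A' i j) z) →
      A z = 1 → HasDerivAt (fun z => (A z).det) (fderiv ℂ Δ (1 : CMat m) A') z := by
    intro A z h h1
    have hA : HasDerivAt (fun z => (A z : Fin m → Fin m → ℂ)) A' z :=
      hasDerivAt_pi.2 fun i => hasDerivAt_pi.2 fun j => h i j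
    have := (hd (A z)).hasFDerivAt.comp_hasDerivAt z hA
    rw [h1] at this
    exact this
  convert key A z h h1 using 1
  have h2 := key (fun z => 1 + z • A') 0 (fun i j => by
    simpa using ((hasDerivAt_id (0 : ℂ)).mul_const (A' i j)).const_add ((1 : CMat m) i j))
    (by simp)
  have h3 : (fun z : ℂ => (1 + z • A').det) = fun z => (det (1 + (X : ℂ[X]) • A'.map C)).eval z := by
    funext z
    rw [← coe_evalRingHom, RingHom.map_det]
    congr 1
    ext i j
    simp only [coe_evalRingHom, RingHom.mapMatrix_apply, Matrix.map_apply, Matrix.add_apply,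
      Matrix.smul_apply, smul_eq_mul, eval_add, eval_mul, eval_X, eval_C, Matrix.one_apply]
    split_ifs <;> simp
  rw [h3] at h2
  rw [h2.unique ((det (1 + (X : ℂ[X]) • A'.map C)).hasDerivAt 0), derivative_det_one_add_X_smul]

lemma norm_trace_mul_diagonal_le {A : CMat m} (hA : spNorm A ≤ 1) {d : Fin m → ℝ}
    (hd : ∀ i, 0 ≤ d i) : ‖trace (A * diagonal fun i => (d i : ℂ))‖ ≤ ∑ i, d i := by
  simp only [trace, diag_apply, mul_diagonal]
  refine (norm_sum_le _ _).trans (Finset.sum_le_sum fun i _ => ?_)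
  rw [norm_mul, Complex.norm_real, Real.norm_of_nonneg (hd i)]
  exact mul_le_of_le_one_left (hd i) ((norm_entry_le_spNorm A i i).trans hA)

/-- A symmetric contraction of rank at most `k` whose trace pairing with a contraction is `k` is a
partial isometry of rank `k`. -/
lemma partialIsometry_of_trace {B S : CMat m} (hB : spNorm B ≤ 1) (hST : Sᵀ = S)
    (hS : spNorm S ≤ 1) {k : ℕ} (hr : ∀ C : CMat m, (charpolyRev (C * S)).natDegree ≤ k)
    (ht : trace (Bᴴ * S) = k) :
    S * Sᴴ * S = S ∧ trace (Sᴴ * S) = k ∧ ∀ Y : CMat m, spNorm Y ≤ 1 → ‖trace (Sᴴ * Y)‖ ≤ k := by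
  obtain ⟨U, d, hU, hd0, rfl⟩ := exists_takagi hST
  set D : CMat m := diagonal fun i => (d i : ℂ) with hD
  set W : CMat m := (Uᵀ)ᴴ with hW
  have hU' : U * Uᴴ = 1 := mul_eq_one_comm.1 hU
  have hWU : W * Uᵀ = 1 := conjTranspose_mul_transpose hU
  have hUW : Uᵀ * W = 1 := mul_eq_one_comm.1 hWU
  have hWW : Wᴴ * W = 1 := by rw [hW, conjTranspose_conjTranspose, hUW]
  have hDH : Dᴴ = D := by
    rw [hD, diagonal_conjTranspose]
    congr 1
    ext i
    simp
  have hSH : (U * D * Uᵀ)ᴴ = W * D * Uᴴ := by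
    rw [conjTranspose_mul, conjTranspose_mul, hDH, Matrix.mul_assoc]
  have hd1 : ∀ i, d i ≤ 1 := fun i => by
    have h1 := norm_entry_le_spNorm D i i
    rw [← spNorm_eq_of_unitary (A := D) hU hWU] at h1
    simp only [hD, diagonal_apply_eq, Complex.norm_real, Real.norm_of_nonneg (hd0 i)] at h1
    exact h1.trans hS
  have hcard : (Finset.univ.filter fun i => d i ≠ 0).card ≤ k := by
    have h1 := hr (W * Uᴴ)
    have h2 : charpolyRev (W * Uᴴ * (U * D * Uᵀ)) = ∏ i, (1 - C (d i : ℂ) * X) := by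
      refine Polynomial.funext fun s => ?_
      have e : 1 - s • (W * Uᴴ * (U * D * Uᵀ)) = W * (1 - s • D) * Uᵀ := by
        have : W * Uᴴ * (U * D * Uᵀ) = W * (Uᴴ * U) * D * Uᵀ := by simp only [Matrix.mul_assoc]
        rw [this, hU, Matrix.mul_one, Matrix.mul_sub, Matrix.sub_mul, Matrix.mul_one, hWU]
        simp
      have e2 : 1 - s • D = diagonal fun i => 1 - s * (d i : ℂ) := by
        rw [hD, ← diagonal_smul, ← diagonal_one, diagonal_sub]
        rfl
      rw [eval_charpolyRev_eq_det, e, det_mul, det_mul, mul_right_comm, ← det_mul, hWU, det_one,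
        one_mul, e2, det_diagonal, eval_prod]
      refine Finset.prod_congr rfl fun i _ => ?_
      rw [eval_sub, eval_mul, eval_X, eval_C, eval_one, mul_comm]
    rw [h2, natDegree_prod] at h1
    · refine le_trans (le_of_eq ?_) h1
      rw [Finset.card_filter]
      refine Finset.sum_congr rfl fun i _ => ?_
      split_ifs with hi
      · have hi' : (-(d i : ℂ)) ≠ 0 := by simpa using hi
        have : (1 - C (d i : ℂ) * X : ℂ[X]) = C (-(d i : ℂ)) * X + C 1 := by
          rw [C_neg, C_1]
          ring
        rw [this, natDegree_linear hi']
      · have hi' : d i = 0 := not_not.1 hi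
        simp [hi']
    · intro i _ h0
      have h1 := congrArg (eval 0) h0
      rw [eval_sub, eval_mul, eval_X, mul_zero, sub_zero, eval_one, eval_zero] at h1
      exact one_ne_zero h1
  have hunit : ∀ Y : CMat m, spNorm Y ≤ 1 → ‖trace ((U * D * Uᵀ)ᴴ * Y)‖ ≤ ∑ i, d i := by
    intro Y hY
    have e : trace ((U * D * Uᵀ)ᴴ * Y) = trace (Uᴴ * Y * W * D) := by
      rw [hSH, Matrix.mul_assoc, Matrix.mul_assoc, trace_mul_comm, Matrix.mul_assoc, trace_mul_comm,
        Matrix.mul_assoc (Uᴴ * Y)]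
    rw [e]
    refine norm_trace_mul_diagonal_le ?_ hd0
    rwa [spNorm_eq_of_unitary (by rw [conjTranspose_conjTranspose, hU']) hWW]
  have hind : ∀ i, d i ≤ if d i ≠ 0 then 1 else 0 := fun i => by
    split_ifs with hi
    · exact hd1 i
    · exact (not_not.1 hi).le
  have hsum1 : ∑ i, d i ≤ ∑ i, if d i ≠ 0 then (1 : ℝ) else 0 :=
    Finset.sum_le_sum fun i _ => hind i
  have hsum2 : (∑ i, if d i ≠ 0 then (1 : ℝ) else 0) ≤ k := by
    rw [Finset.sum_boole]
    exact_mod_cast hcard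
  have hsum3 : (k : ℝ) ≤ ∑ i, d i := by
    have h1 := hunit B hB
    have h2 : trace ((U * D * Uᵀ)ᴴ * B) = star (trace (Bᴴ * (U * D * Uᵀ))) := by
      rw [← trace_conjTranspose, conjTranspose_mul Bᴴ, conjTranspose_conjTranspose]
    rw [h2, ht] at h1
    simpa using h1
  have hsumk : ∑ i, d i = k := le_antisymm (hsum1.trans hsum2) hsum3
  have hdind : ∀ i, d i = if d i ≠ 0 then 1 else 0 := fun i =>
    (Finset.sum_eq_sum_iff_of_le fun i _ => hind i).1 (le_antisymm hsum1 (hsum2.trans hsum3)) i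
      (Finset.mem_univ i)
  have hDD : D * D = D := by
    rw [hD, diagonal_mul_diagonal]
    congr 1
    ext i
    have := hdind i
    split_ifs at this with hi
    · simp [this]
    · simp [not_not.1 hi]
  refine ⟨?_, ?_, fun Y hY => (hunit Y hY).trans hsumk.le⟩
  · rw [hSH]
    have : U * D * Uᵀ * (W * D * Uᴴ) * (U * D * Uᵀ)
        = U * D * (Uᵀ * W) * D * (Uᴴ * U) * D * Uᵀ := by
      simp only [Matrix.mul_assoc]
    rw [this, hU, hUW, Matrix.mul_one, Matrix.mul_one, Matrix.mul_assoc U, hDD, Matrix.mul_assoc U,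
      hDD]
  · rw [hSH]
    have : W * D * Uᴴ * (U * D * Uᵀ) = W * (D * (Uᴴ * U) * D * Uᵀ) := by
      simp only [Matrix.mul_assoc]
    rw [this, hU, Matrix.mul_one, hDD, trace_mul_comm, Matrix.mul_assoc, hUW, Matrix.mul_one, hD,
      trace_diagonal]
    exact_mod_cast hsumk

end TraceBounds

section Conjugacy

open Polynomial

variable {n m : ℕ}

/-- The maps `g` and `P` are conjugate under the transformations `w ↦ w (1 - a w)⁻¹` and
`Y ↦ Y (1 - c Y)⁻¹`. -/
structure MobiusConj (g P : CMat n → CMat m) (a : CMat n) (c : CMat m) : Prop where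
  poly_left : IsPolyMapIII g
  poly_right : IsPolyMapIII P
  symm_left : ∀ Z, Zᵀ = Z → (g Z)ᵀ = g Z
  symm_right : ∀ Z, Zᵀ = Z → (P Z)ᵀ = P Z
  symm_base : aᵀ = a
  rel : ∀ w, wᵀ = w → (1 - a * w).det ≠ 0 → P (w * (1 - a * w)⁻¹) * (1 - c * g w) = g w

lemma one_add_mul_of_rel {p y c : CMat m} (h : p * (1 - c * y) = y) :
    (1 + c * p) * (1 - c * y) = 1 := by
  rw [Matrix.add_mul, Matrix.mul_assoc, h]
  simp

lemma mul_of_rel {p y c : CMat m} (h : p * (1 - c * y) = y) : y * (1 + c * p) = p := by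
  have h1 := mul_eq_one_comm.1 (one_add_mul_of_rel h)
  calc y * (1 + c * p) = p * (1 - c * y) * (1 + c * p) := by rw [h]
    _ = p := by rw [Matrix.mul_assoc, h1, Matrix.mul_one]

lemma mobius_shift {a v : CMat n} (h : (1 + a * v).det ≠ 0) :
    (1 - a * (v * (1 + a * v)⁻¹)).det ≠ 0 ∧
      v * (1 + a * v)⁻¹ * (1 - a * (v * (1 + a * v)⁻¹))⁻¹ = v := by
  have hR := mul_nonsing_inv (1 + a * v) (isUnit_iff_ne_zero.2 h)
  have e : 1 - a * (v * (1 + a * v)⁻¹) = (1 + a * v)⁻¹ := by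
    calc 1 - a * (v * (1 + a * v)⁻¹) = 1 - (1 + a * v) * (1 + a * v)⁻¹ + (1 + a * v)⁻¹ := by
          noncomm_ring
      _ = _ := by rw [hR]; simp
  have hR' := nonsing_inv_mul (1 + a * v) (isUnit_iff_ne_zero.2 h)
  rw [e, nonsing_inv_nonsing_inv _ (isUnit_iff_ne_zero.2 h), Matrix.mul_assoc, hR', Matrix.mul_one]
  exact ⟨(isUnit_nonsing_inv_det _ (isUnit_iff_ne_zero.2 h)).ne_zero, rfl⟩

lemma transpose_mul_one_sub_inv_of_det_ne_zero {a w : CMat n} (ha : aᵀ = a) (hw : wᵀ = w)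
    (h : (1 - a * w).det ≠ 0) : (w * (1 - a * w)⁻¹)ᵀ = w * (1 - a * w)⁻¹ :=
  transpose_mul_one_sub_inv ha hw (isUnit_iff_ne_zero.2 h)

lemma MobiusConj.swap {g P : CMat n → CMat m} {a : CMat n} {c : CMat m}
    (h : MobiusConj g P a c) : MobiusConj P g (-a) (-c) where
  poly_left := h.poly_right
  poly_right := h.poly_left
  symm_left := h.symm_right
  symm_right := h.symm_left
  symm_base := by rw [transpose_neg, h.symm_base]
  rel v hv hdet := by
    have e : 1 - -a * v = 1 + a * v := by simp
    rw [e] at hdet ⊢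
    have e' : 1 - -c * P v = 1 + c * P v := by simp
    rw [e']
    obtain ⟨h1, h2⟩ := mobius_shift hdet
    have hs : (v * (1 + a * v)⁻¹)ᵀ = v * (1 + a * v)⁻¹ := by
      have := transpose_mul_one_sub_inv (A := -a) (Y := v) (by rw [transpose_neg, h.symm_base]) hv
        (by rw [e]; exact isUnit_iff_ne_zero.2 hdet)
      rwa [e] at this
    have h3 := mul_of_rel (h.rel _ hs h1)
    rwa [h2] at h3

/-- Analytic continuation of the conjugacy relation from `OmegaIII`. -/
lemma mobiusConj_of_mem {g P : CMat n → CMat m} {a : CMat n} {c : CMat m}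
    (hg : IsPolyMapIII g) (hP : IsPolyMapIII P) (hgs : ∀ Z, Zᵀ = Z → (g Z)ᵀ = g Z)
    (hPs : ∀ Z, Zᵀ = Z → (P Z)ᵀ = P Z) (ha : aᵀ = a)
    (h : ∀ w ∈ OmegaIII n, P (w * (1 - a * w)⁻¹) * (1 - c * g w) = g w) :
    MobiusConj g P a c := by
  refine ⟨hg, hP, hgs, hPs, ha, fun w hw hdet => ?_⟩
  set U : Set ℂ := {ζ | (1 - ζ • (a * w)).det ≠ 0} with hU
  have hp : charpolyRev (a * w) ≠ 0 := fun h0 => by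
    have := eval_charpolyRev (M := a * w)
    rw [h0, eval_zero] at this
    exact zero_ne_one this
  have hUc : Uᶜ ⊆ ((charpolyRev (a * w)).roots.toFinset : Set ℂ) := fun ζ hζ => by
    simp only [Finset.mem_coe, Multiset.mem_toFinset, mem_roots hp, IsRoot.def]
    rw [eval_charpolyRev_eq_det]
    exact not_not.1 hζ
  have hconn : IsPreconnected U := by
    have := ((Finset.finite_toSet _).subset hUc).countable.isPathConnected_compl_of_one_lt_rank
      (E := ℂ) (by rw [Complex.rank_real_complex]; exact Cardinal.one_lt_two)
    rw [compl_compl] at this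
    exact this.isConnected.isPreconnected
  have hopen : IsOpen U := by
    have hc : Continuous fun ζ : ℂ => (1 - ζ • (a * w)).det := by fun_prop
    exact isOpen_ne.preimage hc
  have e : ∀ ζ : ℂ, 1 - a * (ζ • w) = 1 - ζ • (a * w) := fun ζ => by rw [Matrix.mul_smul]
  have hline : Differentiable ℂ fun ζ : ℂ => ζ • w := differentiable_id.smul_const w
  have hgl := hg.differentiable_comp hline
  have hd1 : DifferentiableOn ℂ (fun ζ : ℂ => P ((ζ • w) * (1 - a * (ζ • w))⁻¹)
      * (1 - c * g (ζ • w))) U := by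
    intro ζ hζ
    have h2 : DifferentiableAt ℂ (fun ζ : ℂ => 1 - a * (ζ • w)) ζ :=
      (differentiableAt_const (1 : CMat n)).sub
        ((differentiableAt_const a).matrix_mul hline.differentiableAt)
    have h3 := hline.differentiableAt (x := ζ) |>.matrix_mul
      (h2.matrix_inv (by rw [e]; exact hζ))
    have h4 : DifferentiableAt ℂ (fun ζ : ℂ => P ((ζ • w) * (1 - a * (ζ • w))⁻¹)) ζ := by
      refine differentiableAt_matrix_iff.2 fun i j => ?_
      obtain ⟨p, hp⟩ := hP i j
      simp only [hp]
      have h3' := differentiableAt_matrix_iff.1 h3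
      clear hp
      induction p using MvPolynomial.induction_on with
      | C r => simp
      | add p q hp hq => simpa only [MvPolynomial.eval_add] using! hp.add hq
      | mul_X p r hp =>
        simpa only [MvPolynomial.eval_mul, MvPolynomial.eval_X] using! hp.mul (h3' r.1 r.2)
    exact (h4.matrix_mul ((differentiableAt_const (1 : CMat m)).sub
      ((differentiableAt_const c).matrix_mul hgl.differentiableAt))).differentiableWithinAt
  have h0 : (0 : ℂ) ∈ U := by simp [hU]
  have key := (hd1.analyticOnNhd hopen).eqOn_of_preconnected_of_eventuallyEq
    (hgl.differentiableOn.analyticOnNhd hopen) hconn h0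
    ((eventually_smul_mem_OmegaIII hw).mono fun ζ hζ => h _ hζ)
  have h1 : (1 : ℂ) ∈ U := by
    change (1 - (1 : ℂ) • (a * w)).det ≠ 0
    rwa [one_smul]
  simpa using key h1

lemma mobius_line {a w₀ : CMat n} {i : Fin n} {α ζ : ℂ} (hae : a * eMat i = α • eMat i)
    (hea : eMat i * a = α • eMat i) (h0 : eMat i * w₀ = 0) (h0' : w₀ * eMat i = 0)
    (hdet : (1 - a * w₀).det ≠ 0) (hζ : 1 - α * ζ ≠ 0) :
    (1 - a * (w₀ + ζ • eMat i)).det ≠ 0 ∧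
      (w₀ + ζ • eMat i) * (1 - a * (w₀ + ζ • eMat i))⁻¹
        = w₀ * (1 - a * w₀)⁻¹ + (ζ / (1 - α * ζ)) • eMat i := by
  have hQ := eMat_mul_self i
  set R := (1 - a * w₀)⁻¹ with hR
  set η := ζ / (1 - α * ζ) with hη
  have hη1 : ζ * (1 + η * α) = η := by
    have h2 : η * (1 - α * ζ) = ζ := div_mul_cancel₀ _ hζ
    have h1 : 1 + η * α = (1 - α * ζ)⁻¹ :=
      eq_inv_of_mul_eq_one_left (by linear_combination α * h2)
    rw [h1, hη, div_eq_mul_inv]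
  have hR1 : (1 - a * w₀) * R = 1 := mul_nonsing_inv _ (isUnit_iff_ne_zero.2 hdet)
  have heR : eMat i * R = eMat i := by
    calc eMat i * R = (eMat i * (1 - a * w₀)) * R := by
          rw [Matrix.mul_sub, ← Matrix.mul_assoc, hea, Matrix.smul_mul, h0, smul_zero, sub_zero,
            Matrix.mul_one]
      _ = _ := by rw [Matrix.mul_assoc, hR1, Matrix.mul_one]
  have hinv : (1 - a * (w₀ + ζ • eMat i)) * (R + (η * α) • eMat i) = 1 := by
    have e : 1 - a * (w₀ + ζ • eMat i) = (1 - a * w₀) - (ζ * α) • eMat i := by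
      rw [Matrix.mul_add, Matrix.mul_smul, hae, smul_smul]
      abel
    rw [e, Matrix.sub_mul, Matrix.mul_add, hR1, Matrix.mul_smul, Matrix.sub_mul, Matrix.one_mul,
      Matrix.mul_assoc, h0', Matrix.mul_zero, sub_zero, Matrix.smul_mul, Matrix.mul_add, heR,
      Matrix.mul_smul, hQ]
    have : ζ * α * (1 + η * α) = η * α := by rw [mul_right_comm, hη1]
    calc 1 + (η * α) • eMat i - (ζ * α) • (eMat i + (η * α) • eMat i)
        = 1 + (η * α - ζ * α * (1 + η * α)) • eMat i := by module
      _ = 1 := by rw [this, sub_self, zero_smul, add_zero]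
  refine ⟨fun h => ?_, ?_⟩
  · have := congrArg det hinv
    rw [det_mul, h, zero_mul, det_one] at this
    exact zero_ne_one this
  · rw [inv_eq_right_inv hinv, Matrix.mul_add, Matrix.add_mul, Matrix.smul_mul, heR,
      Matrix.mul_smul, Matrix.add_mul, h0', Matrix.smul_mul, hQ]
    conv_rhs => rw [← hη1]
    module

lemma spNorm_le_one_of_circle {N : ℂ → CMat m} (hN : Differentiable ℂ N)
    (h : ∀ z : ℂ, ‖z‖ = 1 → spNorm (N z) ≤ 1) {z : ℂ} (hz : ‖z‖ ≤ 1) : spNorm (N z) ≤ 1 := by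
  refine spNorm_le_one_of fun x => ?_
  have hd := hN.toLp_mulVec x
  have := Complex.norm_le_of_forall_mem_frontier_norm_le (U := Metric.ball 0 1)
    (C := l2norm x) Metric.isBounded_ball hd.diffContOnCl (fun w hw => ?_) (z := z)
    (by rw [closure_ball _ one_ne_zero]; simpa using hz)
  · exact this
  · rw [frontier_ball _ one_ne_zero] at hw
    exact l2norm_mulVec_le_of_le_one (h w (by simpa using hw)) x

lemma IsPolyFun.differentiable {φ : ℂ → ℂ} (h : IsPolyFun φ) : Differentiable ℂ φ := by
  obtain ⟨p, hp⟩ := h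
  rw [funext hp]
  exact p.differentiable

/-- Schwarz' lemma for polynomial matrix functions. -/
lemma exists_eq_smul_of_circle {M : ℂ → CMat m} (hM : ∀ i j, IsPolyFun fun z => M z i j)
    (h0 : M 0 = 0) (h : ∀ z : ℂ, ‖z‖ = 1 → spNorm (M z) ≤ 1) :
    ∃ N : ℂ → CMat m, (∀ i j, IsPolyFun fun z => N z i j) ∧ (∀ z, M z = z • N z) ∧
      ∀ z : ℂ, ‖z‖ ≤ 1 → spNorm (N z) ≤ 1 := by
  choose p hp using hM
  have hp : ∀ i j z, M z i j = (p i j).eval z := hp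
  have hN : ∀ z, M z = z • (of fun i j => (p i j).divX.eval z : CMat m) := by
    intro z
    ext i j
    have h1 := congrArg (eval z) (p i j).X_mul_divX_add
    have h2 : (p i j).coeff 0 = 0 := by
      rw [coeff_zero_eq_eval_zero, ← hp, h0, Matrix.zero_apply]
    rw [h2, eval_add, eval_mul, eval_X, C_0, eval_zero, add_zero] at h1
    rw [Matrix.smul_apply, of_apply, smul_eq_mul, h1, hp]
  have hpoly : ∀ i j, IsPolyFun fun z => (of fun i j => (p i j).divX.eval z : CMat m) i j :=
    fun i j => ⟨(p i j).divX, fun z => rfl⟩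
  refine ⟨fun z => of fun i j => (p i j).divX.eval z, hpoly, hN, fun z hz => ?_⟩
  refine spNorm_le_one_of_circle (N := fun z => of fun i j => (p i j).divX.eval z)
    (differentiable_matrix_iff.2 fun i j => (hpoly i j).differentiable) (fun w hw => ?_) hz
  have h1 := h w hw
  rwa [hN, spNorm_smul, hw, one_mul] at h1

end Conjugacy

section FaceMap

open Polynomial

variable {n m : ℕ}

lemma isPolyFun_one_sub_mul {ι : Type*} [Fintype ι] [DecidableEq ι] {M : ℂ → Matrix ι ι ℂ}
    (A C : Matrix ι ι ℂ) (hM : ∀ i j, IsPolyFun fun z => M z i j) (i j : ι) :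
    IsPolyFun fun z => (A - C * M z) i j :=
  (isPolyFun_const (A i j)).sub
    (isPolyFun_matrix_mul (M := fun _ => C) (fun _ _ => isPolyFun_const _) hM i j)

lemma eq_of_trace_conjTranspose_mul {A B : CMat m} {k : ℕ} (hA : trace (Aᴴ * A) = k)
    (hB : trace (Bᴴ * B) = k) (hAB : trace (Bᴴ * A) = k) : A = B := by
  have h1 : trace (Aᴴ * B) = k := by
    have : Aᴴ * B = (Bᴴ * A)ᴴ := by rw [conjTranspose_mul, conjTranspose_conjTranspose]
    rw [this, trace_conjTranspose, hAB, star_natCast]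
  rw [← sub_eq_zero, ← trace_conjTranspose_mul_self_eq_zero_iff, conjTranspose_sub, Matrix.sub_mul,
    Matrix.mul_sub, Matrix.mul_sub, trace_sub, trace_sub, trace_sub, hA, hB, hAB, h1]
  ring

/-- A polynomial curve of symmetric contractions all of whose values have rank data bounded by `k`,
and which has extremal trace pairing `k` at the origin, is a constant partial isometry. -/
lemma eq_partialIsometry_of_trace {N : ℂ → CMat m} (hN : ∀ i j, IsPolyFun fun z => N z i j)
    (hT : ∀ z, (N z)ᵀ = N z) (h1 : ∀ z : ℂ, ‖z‖ ≤ 1 → spNorm (N z) ≤ 1) {k : ℕ}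
    (hr : ∀ (z : ℂ) (C : CMat m), (charpolyRev (C * N z)).natDegree ≤ k) {B : CMat m}
    (hB : spNorm B ≤ 1) (ht : trace (Bᴴ * N 0) = k) :
    N 0 * (N 0)ᴴ * N 0 = N 0 ∧ ∀ z, N z = N 0 := by
  obtain ⟨hV, hVt, hVb⟩ := partialIsometry_of_trace hB (hT 0) (h1 0 (by simp)) (hr 0) ht
  refine ⟨hV, ?_⟩
  have hd : Differentiable ℂ N := differentiable_matrix_iff.2 fun i j => (hN i j).differentiable
  have hθ : Differentiable ℂ fun z => trace ((N 0)ᴴ * N z) := by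
    have := (differentiable_const ((N 0)ᴴ)).matrix_mul hd
    simp only [trace, diag_apply]
    exact Differentiable.fun_sum fun i _ => this.entry i i
  have hmax := Complex.eqOn_of_isPreconnected_of_isMaxOn_norm
    (convex_ball (0 : ℂ) 1).isPreconnected Metric.isOpen_ball hθ.differentiableOn
    (Metric.mem_ball_self one_pos) (fun z hz => by
      change ‖trace ((N 0)ᴴ * N z)‖ ≤ ‖trace ((N 0)ᴴ * N 0)‖
      rw [hVt, Complex.norm_natCast]
      exact hVb _ (h1 z (by simpa using (Metric.mem_ball.1 hz).le)))
  refine congrFun (hd.eq_of_eventually (differentiable_const (N 0)) (z₀ := 0) ?_)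
  filter_upwards [Metric.ball_mem_nhds (0 : ℂ) one_pos] with z hz
  have hz1 : ‖z‖ ≤ 1 := by simpa using (Metric.mem_ball.1 hz).le
  have h2 : trace ((N 0)ᴴ * N z) = k := (hmax hz).trans hVt
  obtain ⟨-, h3, -⟩ := partialIsometry_of_trace (h1 0 (by simp)) (hT z) (h1 z hz1) (hr z) h2
  exact eq_of_trace_conjTranspose_mul h3 hVt h2

lemma one_sub_conjTranspose_add_mul {B β ψ c : CMat m} (hc : c = Bᴴ + βᴴ) (h1 : βᴴ * B = 0)
    (h2 : B * βᴴ = 0) (h3 : Bᴴ * ψ = 0) :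
    1 - c * (B + ψ) = (1 - Bᴴ * B) * (1 - βᴴ * ψ) := by
  have e : (1 - Bᴴ * B) * (1 - βᴴ * ψ) = 1 - βᴴ * ψ - Bᴴ * B + Bᴴ * (B * βᴴ) * ψ := by
    noncomm_ring
  rw [e, h2, hc, Matrix.add_mul, Matrix.mul_add, Matrix.mul_add, h1, h3]
  simp
  abel

lemma rel_factor {p y c : CMat m} (h : p * (1 - c * y) = y) (A C : CMat m) :
    A - C * y = (A - (C - A * c) * p) * (1 - c * y) := by
  have e : (A - (C - A * c) * p) * (1 - c * y) = A * (1 - c * y) - (C - A * c) * (p * (1 - c * y)) := by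
    noncomm_ring
  rw [e, h]
  noncomm_ring

/-- On a coordinate disc through an extremal point, a map admitting a polynomial Möbius conjugate
is linear, with a partial isometry as linear coefficient. -/
lemma MobiusConj.exists_partialIsometry {g P : CMat n → CMat m} {a : CMat n} {c : CMat m}
    (h : MobiusConj g P a c) {w₀ : CMat n} {i : Fin n} {α : ℝ} (hα : 0 < α)
    (hae : a * eMat i = (α : ℂ) • eMat i) (hea : eMat i * a = (α : ℂ) • eMat i)
    (hw : w₀ᵀ = w₀) (h0 : eMat i * w₀ = 0) (hdet : (1 - a * w₀).det ≠ 0) {B β : CMat m}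
    (hB : g w₀ = B) (hc : c = Bᴴ + βᴴ) (h1 : βᴴ * B = 0) (h2 : B * βᴴ = 0) (hβ : spNorm β ≤ α)
    (h3 : ∀ ζ : ℂ, Bᴴ * (g (w₀ + ζ • eMat i) - B) = 0)
    (h4 : ∀ ζ : ℂ, ‖ζ‖ = 1 → spNorm (g (w₀ + ζ • eMat i) - B) ≤ 1) :
    ∃ V : CMat m, Vᵀ = V ∧ V * Vᴴ * V = V ∧ ∀ ζ : ℂ, g (w₀ + ζ • eMat i) = B + ζ • V := by
  have h0' := mul_eMat_of_symm hw h0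
  have hα0 : (α : ℂ) ≠ 0 := by exact_mod_cast hα.ne'
  have hsym : ∀ ζ : ℂ, (w₀ + ζ • eMat i)ᵀ = w₀ + ζ • eMat i := fun ζ => by
    rw [transpose_add, hw, transpose_smul, eMat_transpose]
  set ψ : ℂ → CMat m := fun ζ => g (w₀ + ζ • eMat i) - B with hψ
  have hg : ∀ ζ : ℂ, g (w₀ + ζ • eMat i) = B + ψ ζ := fun ζ => by simp [hψ]
  have hψ0 : ψ 0 = 0 := by simp [hψ, hB]
  have hψp : ∀ j k, IsPolyFun fun ζ => ψ ζ j k := fun j k =>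
    (h.poly_left.isPolyFun_comp (isPolyFun_line w₀ (eMat i)) j k).sub (isPolyFun_const _)
  obtain ⟨N, hNp, hN, hN1⟩ := exists_eq_smul_of_circle hψp hψ0 h4
  have hNd : Differentiable ℂ N := differentiable_matrix_iff.2 fun j k => (hNp j k).differentiable
  have hBT : Bᵀ = B := by rw [← hB, h.symm_left _ hw]
  have hNT : ∀ z, (N z)ᵀ = N z := by
    have hd : Differentiable ℂ fun z => (N z)ᵀ :=
      differentiable_matrix_iff.2 fun j k => (hNp k j).differentiable
    refine congrFun (hd.eq_of_ne_zero hNd continuous_id one_ne_zero fun z hz => ?_)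
    have e : (ψ z)ᵀ = ψ z := by
      simp only [hψ]
      rw [transpose_sub, hBT, h.symm_left _ (hsym z)]
    rw [hN, transpose_smul] at e
    exact smul_right_injective _ hz e
  have hfac : ∀ ζ, 1 - c * g (w₀ + ζ • eMat i) = (1 - Bᴴ * B) * (1 - βᴴ * ψ ζ) := fun ζ => by
    rw [hg, one_sub_conjTranspose_add_mul hc h1 h2 (h3 ζ)]
  set v₀ := w₀ * (1 - a * w₀)⁻¹ with hv
  have hrel : ∀ ζ : ℂ, 1 - α * ζ ≠ 0 → P (v₀ + (ζ / (1 - α * ζ)) • eMat i)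
      * (1 - c * g (w₀ + ζ • eMat i)) = g (w₀ + ζ • eMat i) := fun ζ hζ => by
    obtain ⟨hd, he⟩ := mobius_line hae hea h0 h0' hdet hζ
    have := h.rel _ (hsym ζ) hd
    rwa [he] at this
  set d₀ := (1 - Bᴴ * B).det with hd₀
  have hPp : ∀ j k, IsPolyFun fun ζ => P (v₀ + ζ • eMat i) j k :=
    h.poly_right.isPolyFun_comp (isPolyFun_line v₀ (eMat i))
  obtain ⟨q, hq⟩ := isPolyFun_det (isPolyFun_one_sub_mul 1 βᴴ hψp)
  obtain ⟨r, hr⟩ := isPolyFun_det (isPolyFun_one_sub_mul 1 (-c) hPp)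
  beta_reduce at hq hr
  obtain ⟨k, hk⟩ := exists_eval_eq_pow (q := q) (r := C d₀ * r) hα0
    (by rw [← hq, hψ0]; simp) (fun ζ hζ => by
      have e := congrArg det (one_add_mul_of_rel (hrel ζ hζ))
      rw [det_mul, hfac, det_mul, det_one] at e
      rw [eval_mul, eval_C, ← hr, ← hq, Matrix.neg_mul, sub_neg_eq_add]
      linear_combination e)
  have hdeg : ∀ (z : ℂ) (D : CMat m), (charpolyRev (D * N z)).natDegree ≤ k := by
    intro z D
    refine natDegree_charpolyRev_le (M := fun z => D * N z)
      (isPolyFun_matrix_mul (fun _ _ => isPolyFun_const _) hNp) (fun s => ?_) z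
    obtain ⟨p, hp⟩ := isPolyFun_det (isPolyFun_one_sub_mul 1 (s • D) hψp)
    obtain ⟨r', hr'⟩ := isPolyFun_det (isPolyFun_one_sub_mul (1 + (s • D) * B)
      ((s • D) - (1 + (s • D) * B) * c) hPp)
    beta_reduce at hp hr'
    refine ⟨p, ?_, fun z => ?_⟩
    · refine natDegree_le_of_mobius (r := C d₀ * r') hα0 fun ζ hζ => ?_
      have e := congrArg det (rel_factor (hrel ζ hζ) (1 + (s • D) * B) (s • D))
      rw [det_mul, hfac, det_mul, hq, hk, hr'] at e
      have e' : 1 + (s • D) * B - (s • D) * g (w₀ + ζ • eMat i) = 1 - (s • D) * ψ ζ := by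
        rw [hg]
        noncomm_ring
      rw [e', hp] at e
      rw [e, eval_mul, eval_C]
      ring
    · rw [← hp, hN, Matrix.smul_mul, Matrix.mul_smul, smul_smul]
  have htr : trace (βᴴ * N 0) = α * k := by
    have hd1 : ∀ j l, HasDerivAt (fun z => (1 - βᴴ * ψ z) j l) ((-(βᴴ * N 0)) j l) 0 := by
      intro j l
      have hd2 := ((((differentiable_const (βᴴ)).matrix_mul hNd).entry j l) 0).hasDerivAt
      have hd3 := ((hasDerivAt_id (0 : ℂ)).mul hd2).const_sub ((1 : CMat m) j l)
      have e : (fun z => (1 - βᴴ * ψ z) j l)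
          = fun z => (1 : CMat m) j l - ((id : ℂ → ℂ) * fun z => (βᴴ * N z) j l) z := by
        funext z
        rw [hN, Matrix.mul_smul]
        rfl
      rw [e]
      have e2 : (-(βᴴ * N 0)) j l
          = -(1 * (βᴴ * N 0) j l + id (0 : ℂ) * deriv (fun z => (βᴴ * N z) j l) 0) := by
        rw [id, zero_mul, add_zero, one_mul, Matrix.neg_apply]
      rw [e2]
      exact hd3
    have hd4 := hasDerivAt_det_of_eq_one hd1 (by rw [hψ0]; simp)
    have e : (fun z => (1 - βᴴ * ψ z).det) = fun z => (1 - (α : ℂ) * z) ^ k := by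
      funext z
      rw [← hk, ← hq]
    rw [e] at hd4
    have hd5 : HasDerivAt (fun z => (1 - (α : ℂ) * z) ^ k) _ 0 :=
      (((hasDerivAt_id (0 : ℂ)).const_mul (α : ℂ)).const_sub 1).pow k
    have := hd4.unique hd5
    simp only [trace_neg, id, mul_zero, sub_zero, one_pow, mul_one] at this
    linear_combination -this
  have hB1 : spNorm ((α : ℂ)⁻¹ • β) ≤ 1 := by
    rw [spNorm_smul, norm_inv, Complex.norm_real, Real.norm_of_nonneg hα.le,
      inv_mul_le_iff₀ hα, mul_one]
    exact hβ
  obtain ⟨hV, hVc⟩ := eq_partialIsometry_of_trace hNp hNT hN1 hdeg hB1 (by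
    rw [conjTranspose_smul, Matrix.smul_mul, trace_smul, htr, star_inv₀]
    have : star (α : ℂ) = α := Complex.conj_ofReal α
    rw [this, smul_eq_mul]
    field_simp)
  refine ⟨N 0, hNT 0, hV, fun ζ => ?_⟩
  rw [hg, hN, hVc]

end FaceMap

section Staircase

variable {n m : ℕ}

lemma FixesBlock.left {F : CMat n → CMat m} (hs : ∀ Z, Zᵀ = Z → (F Z)ᵀ = F Z) {i : Fin n}
    {V : CMat m} (hV : Vᵀ = V) (h : FixesBlock F i V) (ζ : ℂ) {w : CMat n} (hw : wᵀ = w)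
    (h0 : eMat i * w = 0) : Vᴴ * F (ζ • eMat i + w) = ζ • (Vᴴ * V) := by
  have h1 := congrArg transpose (h ζ w hw h0)
  have hVs : (Vᴴ)ᵀ = Vᴴ := congrArg conjTranspose hV
  rw [transpose_mul, hVs, hs _ (by rw [transpose_add, hw, transpose_smul, eMat_transpose]),
    transpose_smul, transpose_mul, hVs, hV] at h1
  exact h1

lemma eMat_mul_diagonal (i : Fin n) (δ : Fin n → ℂ) : eMat i * diagonal δ = δ i • eMat i := by
  rw [eMat, ← diagonal_single, diagonal_mul_diagonal, ← diagonal_smul]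
  congr 1
  ext j
  by_cases hj : j = i
  · subst hj; simp
  · simp [hj]

lemma diagonal_mul_eMat (i : Fin n) (δ : Fin n → ℂ) : diagonal δ * eMat i = δ i • eMat i := by
  have := congrArg transpose (eMat_mul_diagonal i δ)
  rwa [transpose_mul, diagonal_transpose, transpose_smul, eMat_transpose] at this

lemma diagonal_eq_smul_eMat_add (i : Fin n) (δ : Fin n → ℂ) :
    diagonal δ = δ i • eMat i + diagonal (Function.update δ i 0) := by
  ext j k
  by_cases hj : j = i
  · subst hj
    by_cases hk : j = k <;> simp [eMat, hk]
  · by_cases hk : j = k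
    · subst hk; simp [eMat, hj, Ne.symm hj]
    · simp [eMat, hk, Ne.symm hj]

lemma FixesBlock.apply_diagonal {F : CMat n → CMat m} {i : Fin n} {V : CMat m}
    (h : FixesBlock F i V) (δ : Fin n → ℂ) : F (diagonal δ) * Vᴴ = δ i • (V * Vᴴ) := by
  rw [diagonal_eq_smul_eMat_add i δ]
  exact h _ _ (diagonal_transpose _) (by rw [eMat_mul_diagonal]; simp)

lemma FixesBlock.left_apply_diagonal {F : CMat n → CMat m}
    (hs : ∀ Z, Zᵀ = Z → (F Z)ᵀ = F Z) {i : Fin n} {V : CMat m} (hV : Vᵀ = V)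
    (h : FixesBlock F i V) (δ : Fin n → ℂ) : Vᴴ * F (diagonal δ) = δ i • (Vᴴ * V) := by
  rw [diagonal_eq_smul_eMat_add i δ]
  exact h.left hs hV _ (diagonal_transpose _) (by rw [eMat_mul_diagonal]; simp)

lemma FixesBlock.orthogonal {F : CMat n → CMat m} (hs : ∀ Z, Zᵀ = Z → (F Z)ᵀ = F Z)
    {i j : Fin n} (hij : i ≠ j) {V W : CMat m} (hV : V * Vᴴ * V = V) (hWs : Wᵀ = W)
    (hW : W * Wᴴ * W = W) (hi : FixesBlock F i V) (hj : FixesBlock F j W) :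
    Wᴴ * V = 0 ∧ W * Vᴴ = 0 := by
  have key : ∀ δ : Fin n → ℂ, δ i • (Wᴴ * V * Vᴴ) = δ j • (Wᴴ * W * Vᴴ) := fun δ => by
    have h1 := congrArg (Wᴴ * ·) (hi.apply_diagonal δ)
    have h2 := congrArg (· * Vᴴ) (hj.left_apply_diagonal hs hWs δ)
    beta_reduce at h1 h2
    rw [Matrix.mul_smul, ← Matrix.mul_assoc, ← Matrix.mul_assoc] at h1
    rw [Matrix.smul_mul] at h2
    exact h1.symm.trans h2
  have h1 := key (Pi.single i 1)
  have h2 := key (Pi.single j 1)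
  rw [Pi.single_eq_same, Pi.single_eq_of_ne hij.symm, one_smul, zero_smul] at h1
  rw [Pi.single_eq_same, Pi.single_eq_of_ne hij, one_smul, zero_smul] at h2
  constructor
  · calc Wᴴ * V = Wᴴ * V * Vᴴ * V := by rw [Matrix.mul_assoc, Matrix.mul_assoc, ← Matrix.mul_assoc V, hV]
      _ = 0 := by rw [h1, Matrix.zero_mul]
  · calc W * Vᴴ = W * (Wᴴ * W * Vᴴ) := by
          rw [← Matrix.mul_assoc, ← Matrix.mul_assoc, hW]
      _ = 0 := by rw [← h2, Matrix.mul_zero]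

lemma spNorm_one_sub_le_one {Q : CMat m} (hQ : Qᴴ = Q) (hQQ : Q * Q = Q) :
    spNorm (1 - Q) ≤ 1 := by
  have h1 := spNorm_conjTranspose_mul_self (1 - Q)
  have e : (1 - Q)ᴴ * (1 - Q) = 1 - Q := by
    rw [conjTranspose_sub, hQ, conjTranspose_one, Matrix.sub_mul, Matrix.mul_sub, Matrix.mul_sub,
      hQQ]
    simp
  rw [e] at h1
  nlinarith [spNorm_nonneg (1 - Q)]

/-- The diagonal matrix with entries `α j` for `j ∈ S`. -/
def maskDiag (α : Fin n → ℝ) (S : Finset (Fin n)) : CMat n :=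
  diagonal fun j => if j ∈ S then (α j : ℂ) else 0

/-- The map `g` decouples the diagonal variables in `S` through the partial isometries `V j`. -/
structure Decouples (g : CMat n → CMat m) (α : Fin n → ℝ) (S : Finset (Fin n))
    (V : Fin n → CMat m) : Prop where
  pos : ∀ j ∈ S, 0 < α j
  symm : ∀ j ∈ S, (V j)ᵀ = V j
  isometry : ∀ j ∈ S, V j * (V j)ᴴ * V j = V j
  fixes : ∀ j ∈ S, FixesBlock g j (V j)
  base : ∀ j ∈ S, ∃ w ∈ OmegaIII n, ∃ B : CMat m, eMat j * w = 0 ∧ (V j)ᴴ * B = 0 ∧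
    B * (V j)ᴴ = 0 ∧ ∀ ζ : ℂ, g (w + ζ • eMat j) = B + ζ • V j
  val : g (maskDiag α S) = ∑ j ∈ S, (α j : ℂ) • V j

section

variable {g : CMat n → CMat m} {α : Fin n → ℝ} {S : Finset (Fin n)} {V : Fin n → CMat m}

lemma Decouples.orthogonal (hs : ∀ Z, Zᵀ = Z → (g Z)ᵀ = g Z) (h : Decouples g α S V)
    {j l : Fin n} (hj : j ∈ S) (hl : l ∈ S) (hjl : j ≠ l) :
    (V j)ᴴ * V l = 0 ∧ V j * (V l)ᴴ = 0 :=
  (h.fixes l hl).orthogonal hs hjl.symm (h.isometry l hl) (h.symm j hj) (h.isometry j hj)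
    (h.fixes j hj)

lemma Decouples.sum_mul (hs : ∀ Z, Zᵀ = Z → (g Z)ᵀ = g Z) (h : Decouples g α S V)
    {j : Fin n} (hj : j ∈ S) :
    (∑ l ∈ S, (α l : ℂ) • V l) * (V j)ᴴ = (α j : ℂ) • (V j * (V j)ᴴ) := by
  rw [Finset.sum_mul, Finset.sum_eq_single j, Matrix.smul_mul]
  · intro l hl hlj
    rw [Matrix.smul_mul, (h.orthogonal hs hl hj hlj).2, smul_zero]
  · exact fun h' => absurd hj h'

lemma Decouples.mul_sum (hs : ∀ Z, Zᵀ = Z → (g Z)ᵀ = g Z) (h : Decouples g α S V)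
    {j : Fin n} (hj : j ∈ S) :
    (V j)ᴴ * (∑ l ∈ S, (α l : ℂ) • V l) = (α j : ℂ) • ((V j)ᴴ * V j) := by
  rw [Finset.mul_sum, Finset.sum_eq_single j, Matrix.mul_smul]
  · intro l hl hlj
    rw [Matrix.mul_smul, (h.orthogonal hs hj hl hlj.symm).1, smul_zero]
  · exact fun h' => absurd hj h'

lemma Decouples.spNorm_sub_le_one (hs : ∀ Z, Zᵀ = Z → (g Z)ᵀ = g Z) (h : Decouples g α S V)
    {Y : CMat m} (hY : spNorm Y ≤ 1)
    (hYV : ∀ j ∈ S, Y * (V j)ᴴ = (α j : ℂ) • (V j * (V j)ᴴ)) :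
    spNorm (Y - ∑ j ∈ S, (α j : ℂ) • V j) ≤ 1 := by
  set E : CMat m := ∑ j ∈ S, (V j)ᴴ * V j with hE
  have hYE : Y - ∑ j ∈ S, (α j : ℂ) • V j = Y * (1 - E) := by
    rw [Matrix.mul_sub, Matrix.mul_one, hE, Finset.mul_sum]
    congr 1
    refine Finset.sum_congr rfl fun j hj => ?_
    rw [← Matrix.mul_assoc, hYV j hj, Matrix.smul_mul, h.isometry j hj]
  have hEh : Eᴴ = E := by
    rw [hE, conjTranspose_sum]
    refine Finset.sum_congr rfl fun j _ => ?_
    rw [conjTranspose_mul, conjTranspose_conjTranspose]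
  have hEE : E * E = E := by
    conv_lhs => rw [hE, Finset.sum_mul]
    refine Finset.sum_congr rfl fun j hj => ?_
    rw [Finset.mul_sum, Finset.sum_eq_single j]
    · rw [← Matrix.mul_assoc, partialIsometry_conjTranspose (h.isometry j hj)]
    · intro l hl hlj
      rw [Matrix.mul_assoc, ← Matrix.mul_assoc (V j), (h.orthogonal hs hj hl hlj.symm).2,
        Matrix.zero_mul, Matrix.mul_zero]
    · exact fun h' => absurd hj h'
  rw [hYE]
  exact spNorm_mul_le_one hY (spNorm_one_sub_le_one hEh hEE)

lemma Decouples.exists_insert {P : CMat n → CMat m} {β : Fin m → ℝ} (hg : IsContractive g)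
    (hgP : MobiusConj g P (cdiag α) (cdiag β)) (hα0 : ∀ i, 0 ≤ α i) (hα1 : ∀ i, α i < 1)
    (hval : g (cdiag α) = cdiag β) (h : Decouples g α S V) {i : Fin n} (hi : i ∉ S)
    (hpos : 0 < α i) (hmax : ∀ l ∉ S, α l ≤ α i) :
    ∃ V', Decouples g α (insert i S) V' := by
  have hs := hg.symm
  have habs : ∀ i, |α i| < 1 := fun i => by rw [abs_of_nonneg (hα0 i)]; exact hα1 i
  have hαn : ∀ i, ‖(α i : ℂ)‖ = α i := fun i => by
    rw [Complex.norm_real, Real.norm_of_nonneg (hα0 i)]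
  set B : CMat m := ∑ j ∈ S, (α j : ℂ) • V j with hB
  set w₀ := maskDiag α S with hw₀
  have hgd : ∀ δ : Fin n → ℂ, (∀ j ∈ S, δ j = α j) → ∀ j ∈ S,
      (V j)ᴴ * (g (diagonal δ) - B) = 0 ∧ (g (diagonal δ) - B) * (V j)ᴴ = 0 := by
    intro δ hδ j hj
    rw [Matrix.mul_sub, Matrix.sub_mul, (h.fixes j hj).apply_diagonal,
      (h.fixes j hj).left_apply_diagonal hs (h.symm j hj), hB, h.sum_mul hs hj, h.mul_sum hs hj,
      hδ j hj, sub_self, sub_self]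
    exact ⟨rfl, rfl⟩
  have hgn : ∀ δ : Fin n → ℂ, (∀ j ∈ S, δ j = α j) → (∀ j, ‖δ j‖ ≤ 1) →
      spNorm (g (diagonal δ) - B) ≤ 1 := by
    intro δ hδ hn
    refine h.spNorm_sub_le_one hs (hg.bound _ (diagonal_transpose _)
      (spNorm_diagonal_le zero_le_one hn)) fun j hj => ?_
    rw [(h.fixes j hj).apply_diagonal, hδ j hj]
  have hBmul : ∀ X : CMat m, (∀ j ∈ S, X * V j = 0) → X * B = 0 := fun X hX => by
    rw [hB, Finset.mul_sum]
    exact Finset.sum_eq_zero fun j hj => by rw [Matrix.mul_smul, hX j hj, smul_zero]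
  have hmulB : ∀ X : CMat m, (∀ j ∈ S, V j * X = 0) → B * X = 0 := fun X hX => by
    rw [hB, Finset.sum_mul]
    exact Finset.sum_eq_zero fun j hj => by rw [Matrix.smul_mul, hX j hj, smul_zero]
  have hline : ∀ ζ : ℂ, w₀ + ζ • eMat i
      = diagonal fun j => if j ∈ S then (α j : ℂ) else if j = i then ζ else 0 := by
    intro ζ
    rw [hw₀, maskDiag, eMat, ← diagonal_single, ← diagonal_smul, diagonal_add]
    congr 1
    ext j
    by_cases hj : j = i
    · subst hj; simp [hi]
    · simp [hj]
  have hcd : cdiag α = diagonal fun j => (α j : ℂ) := rfl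
  have hβV : ∀ j ∈ S, (V j)ᴴ * (cdiag β - B) = 0 ∧ (cdiag β - B) * (V j)ᴴ = 0 := by
    rw [← hval, hcd]
    exact hgd _ fun _ _ => rfl
  have hct : ∀ X : CMat m, Xᴴ = 0 → X = 0 := fun X hX => conjTranspose_eq_zero.1 hX
  have hmem : w₀ ∈ OmegaIII n := by
    refine mem_OmegaIII_iff.2 ⟨diagonal_transpose _, spNorm_diagonal_lt_one fun j => ?_⟩
    split_ifs
    · rw [hαn]; exact hα1 j
    · rw [norm_zero]; exact one_pos
  have hew : eMat i * w₀ = 0 := by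
    rw [hw₀, maskDiag, eMat_mul_diagonal, if_neg hi, zero_smul]
  have hβn : spNorm (cdiag β - B) ≤ α i := by
    have hα0' : (α i : ℂ) ≠ 0 := by exact_mod_cast hpos.ne'
    set D : ℂ → Fin n → ℂ := fun ζ j => if j ∈ S then (α j : ℂ) else ζ * (α j / α i) with hD
    have hDl : ∀ ζ, diagonal (D ζ) = w₀ + ζ • diagonal fun j =>
        if j ∈ S then (0 : ℂ) else α j / α i := fun ζ => by
      rw [hw₀, maskDiag, ← diagonal_smul, diagonal_add]
      congr 1
      ext j
      by_cases hj : j ∈ S <;> simp [hD, hj]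
    obtain ⟨N, -, hN, hN1⟩ := exists_eq_smul_of_circle (M := fun ζ => g (diagonal (D ζ)) - B)
      (fun j k => by
        simp only [hDl, Matrix.sub_apply]
        exact (hg.poly.isPolyFun_comp (isPolyFun_line _ _) j k).sub (isPolyFun_const _))
      (by
        rw [hDl, zero_smul, add_zero, hw₀, h.val, sub_self])
      (fun ζ hζ => hgn _ (fun j hj => by simp [hD, hj]) fun j => by
        by_cases hj : j ∈ S
        · simp only [hD, hj, if_true, hαn]; exact (hα1 j).le
        · simp only [hD, hj, if_false, norm_mul, norm_div, hαn, hζ, one_mul]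
          exact (div_le_one hpos).2 (hmax j hj))
    have h1 := hN (α i)
    have h2 : diagonal (D (α i)) = cdiag α := by
      rw [hcd]
      congr 1
      ext j
      by_cases hj : j ∈ S
      · simp [hD, hj]
      · simp only [hD, hj, if_false]
        exact mul_div_cancel₀ _ hα0'
    beta_reduce at h1
    rw [h2, hval] at h1
    rw [h1, spNorm_smul, hαn]
    exact mul_le_of_le_one_right (hα0 i) (hN1 _ (by rw [hαn]; exact (hα1 i).le))
  have hζS : ∀ ζ : ℂ, ∀ j ∈ S, (if j ∈ S then (α j : ℂ) else if j = i then ζ else 0) = α j :=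
    fun ζ j hj => if_pos hj
  obtain ⟨W, hWs, hW, hWl⟩ := hgP.exists_partialIsometry (w₀ := w₀) (i := i) (B := B)
    (β := cdiag β - B) hpos
    (by rw [hcd, diagonal_mul_eMat]) (by rw [hcd, eMat_mul_diagonal])
    (diagonal_transpose _) hew
    (isUnit_det_one_sub_mul (spNorm_cdiag_lt_one habs) (mem_OmegaIII_iff.1 hmem).2).ne_zero
    (by rw [hw₀, h.val])
    (by rw [← conjTranspose_add, add_sub_cancel, cdiag_conjTranspose])
    (hBmul _ fun j hj => hct _ (by
      rw [conjTranspose_mul, conjTranspose_conjTranspose, (hβV j hj).1]))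
    (hmulB _ fun j hj => hct _ (by
      rw [conjTranspose_mul, conjTranspose_conjTranspose, (hβV j hj).2]))
    hβn
    (fun ζ => hct _ (by
      rw [conjTranspose_mul, conjTranspose_conjTranspose]
      refine hBmul _ fun j hj => hct _ ?_
      rw [conjTranspose_mul, conjTranspose_conjTranspose, hline]
      exact (hgd _ (hζS ζ) j hj).1))
    (fun ζ hζ => by
      rw [hline]
      refine hgn _ (hζS ζ) fun j => ?_
      split_ifs
      · rw [hαn]; exact (hα1 j).le
      · exact hζ.le
      · rw [norm_zero]; exact zero_le_one)
  have hVW : ∀ j ∈ S, (V j)ᴴ * W = 0 ∧ W * (V j)ᴴ = 0 := fun j hj => by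
    have := hgd _ (hζS 1) j hj
    rwa [← hline, hWl, add_sub_cancel_left, one_smul] at this
  have hWB : Wᴴ * B = 0 := hBmul _ fun j hj => hct _ (by
    rw [conjTranspose_mul, conjTranspose_conjTranspose, (hVW j hj).1])
  have hBW : B * Wᴴ = 0 := hmulB _ fun j hj => hct _ (by
    rw [conjTranspose_mul, conjTranspose_conjTranspose, (hVW j hj).2])
  have hWf : FixesBlock g i W := by
    refine fixesBlock_of_base hg hW (diagonal_transpose _) hew (mem_OmegaIII_iff.1 hmem).2
      fun ζ _ => ?_
    rw [add_comm, ← maskDiag, ← hw₀, hWl, Matrix.add_mul, hBW, zero_add, Matrix.smul_mul]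
  have hup : ∀ j ∈ S, Function.update V i W j = V j := fun j hj =>
    Function.update_of_ne (ne_of_mem_of_not_mem hj hi) _ _
  refine ⟨Function.update V i W, ?_, ?_, ?_, ?_, ?_, ?_⟩
  · exact Finset.forall_mem_insert _ _ _ |>.2 ⟨hpos, h.pos⟩
  · refine Finset.forall_mem_insert _ _ _ |>.2 ⟨by rwa [Function.update_self], fun j hj => ?_⟩
    rw [hup j hj]; exact h.symm j hj
  · refine Finset.forall_mem_insert _ _ _ |>.2 ⟨by rwa [Function.update_self], fun j hj => ?_⟩
    rw [hup j hj]; exact h.isometry j hj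
  · refine Finset.forall_mem_insert _ _ _ |>.2 ⟨by rwa [Function.update_self], fun j hj => ?_⟩
    rw [hup j hj]; exact h.fixes j hj
  · refine Finset.forall_mem_insert _ _ _ |>.2 ⟨?_, fun j hj => ?_⟩
    · rw [Function.update_self]
      exact ⟨w₀, hmem, B, hew, hWB, hBW, hWl⟩
    · rw [hup j hj]; exact h.base j hj
  · rw [Finset.sum_insert hi, Function.update_self, Finset.sum_congr rfl fun j hj =>
      congrArg ((α j : ℂ) • ·) (hup j hj)]
    have e : maskDiag α (insert i S) = w₀ + (α i : ℂ) • eMat i := by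
      rw [hline, maskDiag]
      congr 1
      ext j
      by_cases hj : j = i
      · subst hj; simp [hi]
      · simp [hj]
    rw [e, hWl, add_comm]

/-- A contractive polynomial map fixing `0` which is conjugate to a polynomial map decouples
all the variables `i` with `α i ≠ 0`. -/
lemma exists_decouples {P : CMat n → CMat m} {β : Fin m → ℝ} (hg : IsContractive g)
    (h0 : g 0 = 0) (hgP : MobiusConj g P (cdiag α) (cdiag β)) (hα0 : ∀ i, 0 ≤ α i)
    (hα1 : ∀ i, α i < 1) (hval : g (cdiag α) = cdiag β) :
    ∃ V, Decouples g α (Finset.univ.filter (0 < α ·)) V ∧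
      cdiag β = ∑ j ∈ Finset.univ.filter (0 < α ·), (α j : ℂ) • V j := by
  set T : Finset (Fin n) := Finset.univ.filter (0 < α ·) with hT
  have key : ∀ k ≤ T.card, ∃ S ⊆ T, S.card = k ∧ ∃ V, Decouples g α S V := by
    intro k
    induction k with
    | zero =>
      refine fun _ => ⟨∅, by simp, rfl, 0, by simp, by simp, by simp, by simp, by simp, ?_⟩
      have : maskDiag α ∅ = 0 := by simp [maskDiag]
      rw [this, h0, Finset.sum_empty]
    | succ k ih =>
      intro hk
      obtain ⟨S, hST, hSk, V, hV⟩ := ih (by omega)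
      have hne : (T \ S).Nonempty := by
        rw [← Finset.card_pos, Finset.card_sdiff_of_subset hST]
        omega
      obtain ⟨i, hi, hmax⟩ := (T \ S).exists_max_image α hne
      rw [Finset.mem_sdiff] at hi
      have hpos : 0 < α i := (Finset.mem_filter.1 hi.1).2
      obtain ⟨V', hV'⟩ := hV.exists_insert hg hgP hα0 hα1 hval hi.2 hpos fun l hl => by
        by_cases hlT : l ∈ T
        · exact hmax l (Finset.mem_sdiff.2 ⟨hlT, hl⟩)
        · exact (not_lt.1 fun h => hlT (Finset.mem_filter.2 ⟨Finset.mem_univ _, h⟩)).trans hpos.le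
      exact ⟨insert i S, Finset.insert_subset hi.1 hST, by
        rw [Finset.card_insert_of_notMem hi.2, hSk], V', hV'⟩
  obtain ⟨S, hST, hSc, V, hV⟩ := key _ le_rfl
  obtain rfl := Finset.eq_of_subset_of_card_le hST hSc.ge
  refine ⟨V, hV, ?_⟩
  rw [← hV.val, ← hval, maskDiag, cdiag]
  congr 2
  ext j
  by_cases hj : 0 < α j
  · simp [hT, hj]
  · simp [hT, le_antisymm (not_lt.1 hj) (hα0 j)]

end

end Staircase

section Linked

variable {n m : ℕ}

/-- The formula for the conjugate map on a line where `g` is affine. -/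
lemma MobiusConj.line {g P : CMat n → CMat m} {a : CMat n} {c : CMat m}
    (h : MobiusConj g P a c) {i : Fin n} {α : ℂ} {V B : CMat m} {w₀ : CMat n}
    (hae : a * eMat i = α • eMat i) (hea : eMat i * a = α • eMat i)
    (hV : V * Vᴴ * V = V) (hcV : c * V = α • (Vᴴ * V)) (hVc : V * c = α • (V * Vᴴ))
    (hw : w₀ᵀ = w₀) (h0 : eMat i * w₀ = 0) (hdet : (1 - a * w₀).det ≠ 0)
    (hVB : Vᴴ * B = 0) (hBV : B * Vᴴ = 0) (hg : ∀ ζ : ℂ, g (w₀ + ζ • eMat i) = B + ζ • V) :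
    Vᴴ * P (w₀ * (1 - a * w₀)⁻¹) = 0 ∧ P (w₀ * (1 - a * w₀)⁻¹) * Vᴴ = 0 ∧
      ∀ η : ℂ, P (w₀ * (1 - a * w₀)⁻¹ + η • eMat i) = P (w₀ * (1 - a * w₀)⁻¹) + η • V := by
  have h0' := mul_eMat_of_symm hw h0
  set v₀ := w₀ * (1 - a * w₀)⁻¹ with hv₀
  have hg0 : g w₀ = B := by simpa using hg 0
  have hB1 : P v₀ * (1 - c * B) = B := by
    have := h.rel w₀ hw hdet
    rwa [hg0] at this
  have hB2 := mul_of_rel hB1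
  have h1 : Vᴴ * P v₀ = 0 := by
    rw [← hB2, ← Matrix.mul_assoc, hVB, Matrix.zero_mul]
  have h2 : P v₀ * Vᴴ = 0 := by
    calc P v₀ * Vᴴ = P v₀ * (1 - c * B) * Vᴴ + P v₀ * c * (B * Vᴴ) := by noncomm_ring
      _ = 0 := by rw [hB1, hBV, Matrix.mul_zero, add_zero]
  have hsym : ∀ ζ : ℂ, (w₀ + ζ • eMat i)ᵀ = w₀ + ζ • eMat i := fun ζ => by
    rw [transpose_add, hw, transpose_smul, eMat_transpose]
  have key : ∀ ζ : ℂ, 1 - α * ζ ≠ 0 →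
      P (v₀ + (ζ / (1 - α * ζ)) • eMat i) = P v₀ + (ζ / (1 - α * ζ)) • V := by
    intro ζ hζ
    obtain ⟨hd, he⟩ := mobius_line hae hea h0 h0' hdet hζ
    have hr := h.rel _ (hsym ζ) hd
    rw [he, hg] at hr
    have hinv := mul_eq_one_comm.1 (one_add_mul_of_rel hr)
    set X := P (v₀ + (ζ / (1 - α * ζ)) • eMat i) with hX
    set η := ζ / (1 - α * ζ) with hη
    have hη1 : η * (1 - ζ * α) = ζ := by
      rw [mul_comm ζ]; exact div_mul_cancel₀ _ hζ
    have hY : (P v₀ + η • V) * (1 - c * (B + ζ • V)) = B + ζ • V := by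
      have e1 : V * c * B = 0 := by
        rw [hVc, Matrix.smul_mul, Matrix.mul_assoc, hVB, Matrix.mul_zero, smul_zero]
      have e2 : P v₀ * (c * V) = 0 := by
        rw [hcV, Matrix.mul_smul, ← Matrix.mul_assoc, h2, Matrix.zero_mul, smul_zero]
      have e3 : V * (c * V) = α • V := by
        rw [hcV, Matrix.mul_smul, ← Matrix.mul_assoc, hV]
      have e4 : P v₀ * (c * B) = P v₀ - B := by
        rw [Matrix.mul_sub, Matrix.mul_one] at hB1
        rw [eq_sub_iff_add_eq, ← sub_eq_iff_eq_add'.1 hB1]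
      rw [Matrix.mul_assoc] at e1
      simp only [Matrix.mul_sub, Matrix.add_mul, Matrix.mul_one, Matrix.mul_add, Matrix.mul_smul,
        Matrix.smul_mul, e1, e2, e3, e4, smul_zero, add_zero, zero_add, smul_smul]
      calc P v₀ + η • V - (P v₀ - B + (ζ * (η * α)) • V)
          = B + (η * (1 - ζ * α)) • V := by module
        _ = _ := by rw [hη1]
    calc X = X * (1 - c * (B + ζ • V)) * (1 + c * X) := by
          rw [Matrix.mul_assoc, hinv, Matrix.mul_one]
      _ = P v₀ + η • V := by
          rw [hr, ← hY, Matrix.mul_assoc, hinv, Matrix.mul_one]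
  refine ⟨h1, h2, fun η => ?_⟩
  have hd1 : Differentiable ℂ fun η : ℂ => P (v₀ + η • eMat i) :=
    h.poly_right.differentiable_comp (differentiable_line _ _)
  refine congrFun (hd1.eq_of_ne_zero (differentiable_line (P v₀) V) (q := fun η => 1 + α * η)
    (by fun_prop) (z₀ := 0) (by simp) fun η hη => ?_) η
  have e : 1 - α * (η / (1 + α * η)) = (1 + α * η)⁻¹ := by
    field_simp
    ring
  have := key (η / (1 + α * η)) (by rw [e]; exact inv_ne_zero hη)
  rwa [e, div_inv_eq_mul, div_mul_cancel₀ _ hη] at this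

/-- Conjugate maps `g` and `P` that both send the variable `Z i i` to `V`. -/
structure Linked (g P : CMat n → CMat m) (a : CMat n) (c : CMat m) (i : Fin n) (α : ℂ)
    (V : CMat m) : Prop where
  conj : MobiusConj g P a c
  ne_zero : α ≠ 0
  base_mul : a * eMat i = α • eMat i
  mul_base : eMat i * a = α • eMat i
  symm : Vᵀ = V
  isometry : V * Vᴴ * V = V
  base_mul_isometry : c * V = α • (Vᴴ * V)
  isometry_mul_base : V * c = α • (V * Vᴴ)
  fixes_left : FixesBlock g i V
  fixes_right : FixesBlock P i V
  flat_left : FlatBlock g i V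
  flat_right : FlatBlock P i V
  line : ∃ (w : CMat n) (B : CMat m), wᵀ = w ∧ eMat i * w = 0 ∧ (1 - a * w).det ≠ 0 ∧
    Vᴴ * B = 0 ∧ B * Vᴴ = 0 ∧ ∀ ζ : ℂ, g (w + ζ • eMat i) = B + ζ • V

lemma Linked.swap {g P : CMat n → CMat m} {a : CMat n} {c : CMat m} {i : Fin n} {α : ℂ}
    {V : CMat m} (h : Linked g P a c i α V) : Linked P g (-a) (-c) i (-α) V where
  conj := h.conj.swap
  ne_zero := neg_ne_zero.2 h.ne_zero
  base_mul := by rw [Matrix.neg_mul, h.base_mul, neg_smul]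
  mul_base := by rw [Matrix.mul_neg, h.mul_base, neg_smul]
  symm := h.symm
  isometry := h.isometry
  base_mul_isometry := by rw [Matrix.neg_mul, h.base_mul_isometry, neg_smul]
  isometry_mul_base := by rw [Matrix.mul_neg, h.isometry_mul_base, neg_smul]
  fixes_left := h.fixes_right
  fixes_right := h.fixes_left
  flat_left := h.flat_right
  flat_right := h.flat_left
  line := by
    obtain ⟨w, B, hw, h0, hdet, hVB, hBV, hg⟩ := h.line
    obtain ⟨h1, h2, h3⟩ := h.conj.line h.base_mul h.mul_base h.isometry h.base_mul_isometry
      h.isometry_mul_base hw h0 hdet hVB hBV hg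
    refine ⟨_, _, transpose_mul_one_sub_inv_of_det_ne_zero h.conj.symm_base hw hdet,
      by rw [← Matrix.mul_assoc, h0, Matrix.zero_mul], ?_, h1, h2, h3⟩
    have hR := mul_nonsing_inv _ (isUnit_iff_ne_zero.2 hdet)
    have e : 1 - -a * (w * (1 - a * w)⁻¹) = (1 - a * w)⁻¹ := by
      calc 1 - -a * (w * (1 - a * w)⁻¹)
          = 1 - (1 - a * w) * (1 - a * w)⁻¹ + (1 - a * w)⁻¹ := by noncomm_ring
        _ = _ := by rw [hR]; simp
    rw [e]
    exact (isUnit_nonsing_inv_det _ (isUnit_iff_ne_zero.2 hdet)).ne_zero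

end Linked

section Deflate

variable {n m : ℕ}

/-- The map `f` transported by the affine parts of Möbius transformations. -/
def deflate (f : CMat n → CMat m) (α : Fin n → ℝ) (β : Fin m → ℝ) (v : CMat n) : CMat m :=
  cdiag (coSqrt β)⁻¹ * (f (cdiag (coSqrt α) * v * cdiag (coSqrt α) - cdiag α) + cdiag β)
    * cdiag (coSqrt β)⁻¹

variable {f g : CMat n → CMat m} {α : Fin n → ℝ} {β : Fin m → ℝ}

lemma isPolyMapIII_deflate (hf : IsPolyMapIII f) (α : Fin n → ℝ) (β : Fin m → ℝ) :
    IsPolyMapIII (deflate f α β) := by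
  refine IsPolyMapIII.mul (IsPolyMapIII.mul (isPolyMapIII_const _)
    (IsPolyMapIII.add ?_ (isPolyMapIII_const _))) (isPolyMapIII_const _)
  refine hf.comp ?_
  simp only [sub_eq_add_neg]
  exact ((isPolyMapIII_const _).mul isPolyMapIII_id |>.mul (isPolyMapIII_const _)).add
    (isPolyMapIII_const _)

lemma transpose_cdiag_mul_mul {s : Fin n → ℝ} {v : CMat n} (hv : vᵀ = v) :
    (cdiag s * v * cdiag s)ᵀ = cdiag s * v * cdiag s := by
  rw [transpose_mul, transpose_mul, cdiag_transpose, hv, Matrix.mul_assoc]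

lemma deflate_transpose (hf : ∀ Z, Zᵀ = Z → (f Z)ᵀ = f Z) (v : CMat n) (hv : vᵀ = v) :
    (deflate f α β v)ᵀ = deflate f α β v := by
  refine transpose_cdiag_mul_mul ?_
  rw [transpose_add, hf _ (by rw [transpose_sub, transpose_cdiag_mul_mul hv, cdiag_transpose]),
    cdiag_transpose]

lemma cdiag_mul_mul_of_inv {s : Fin n → ℝ} (hs : ∀ i, 0 < s i) (X : CMat n) :
    cdiag s * (cdiag s⁻¹ * X * cdiag s⁻¹) * cdiag s = X := by
  calc _ = (cdiag s * cdiag s⁻¹) * X * (cdiag s⁻¹ * cdiag s) := by simp only [Matrix.mul_assoc]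
    _ = X := by rw [cdiag_mul_inv hs, cdiag_inv_mul hs, Matrix.one_mul, Matrix.mul_one]

lemma cdiag_inv_mul_mul {s : Fin n → ℝ} (hs : ∀ i, 0 < s i) (X : CMat n) :
    cdiag s⁻¹ * (cdiag s * X * cdiag s) * cdiag s⁻¹ = X := by
  calc _ = (cdiag s⁻¹ * cdiag s) * X * (cdiag s * cdiag s⁻¹) := by simp only [Matrix.mul_assoc]
    _ = X := by rw [cdiag_mul_inv hs, cdiag_inv_mul hs, Matrix.one_mul, Matrix.mul_one]

lemma apply_eq_deflate (hβ : ∀ i, |β i| < 1) (v : CMat n) :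
    f (cdiag (coSqrt α) * v * cdiag (coSqrt α) - cdiag α)
      = cdiag (coSqrt β) * deflate f α β v * cdiag (coSqrt β) - cdiag β := by
  rw [deflate, cdiag_mul_mul_of_inv (coSqrt_pos hβ), add_sub_cancel_right]

lemma mobiusConj_deflate (hf : IsContractive f) (hg : IsPolyMapIII g)
    (hgm : Set.MapsTo g (OmegaIII n) (OmegaIII m)) (hβ : ∀ i, |β i| < 1)
    (hrel : ∀ w ∈ OmegaIII n, f (mobius α w) = mobius β (g w)) :
    MobiusConj g (deflate f α β) (cdiag α) (cdiag β) := by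
  refine mobiusConj_of_mem hg (isPolyMapIII_deflate hf.poly α β)
    (fun Z hZ => transpose_apply_of_mapsTo hg hgm hZ) (deflate_transpose hf.symm)
    (cdiag_transpose α) fun w hw => ?_
  have h1 := hrel w hw
  rw [mobius, mobius] at h1
  have e : deflate f α β (w * (1 - cdiag α * w)⁻¹) = g w * (1 - cdiag β * g w)⁻¹ := by
    rw [deflate, sub_eq_neg_add, h1, neg_add_eq_sub, sub_add_cancel,
      cdiag_inv_mul_mul (coSqrt_pos hβ)]
  rw [e, Matrix.mul_assoc, nonsing_inv_mul, Matrix.mul_one]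
  exact isUnit_det_one_sub_mul (spNorm_cdiag_lt_one hβ) (mem_OmegaIII_iff.1 (hgm hw)).2

/-- Left multiplication by `cdiag (coSqrt β)` on an eigenspace of `cdiag β ^ 2`. -/
lemma cdiag_coSqrt_mul_of_sq {β : Fin m → ℝ} {r : ℝ} {V : CMat m}
    (h : cdiag β * (cdiag β * V) = ((r ^ 2 : ℝ) : ℂ) • V) :
    cdiag (coSqrt β) * V = (√(1 - r ^ 2) : ℂ) • V := by
  ext j k
  have h1 := congrFun (congrFun h j) k
  simp only [cdiag, diagonal_mul, Matrix.smul_apply, smul_eq_mul] at h1 ⊢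
  by_cases hV : V j k = 0
  · simp [hV]
  · have h2 : ((β j ^ 2 : ℝ) : ℂ) = ((r ^ 2 : ℝ) : ℂ) := by
      refine mul_right_cancel₀ hV ?_
      rw [← h1]
      push_cast
      ring
    rw [coSqrt, Complex.ofReal_inj.1 h2]

lemma linked_deflate (hf : IsContractive f) (hg : IsContractive g)
    (hconj : MobiusConj g (deflate f α β) (cdiag α) (cdiag β)) (hα : ∀ i, |α i| < 1)
    (hβ : ∀ i, |β i| < 1) {i : Fin n} (hi : 0 < α i) {V : CMat m} (hVs : Vᵀ = V)
    (hV : V * Vᴴ * V = V) (hcV : cdiag β * V = (α i : ℂ) • (Vᴴ * V))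
    (hVc : V * cdiag β = (α i : ℂ) • (V * Vᴴ)) (hfix : FixesBlock g i V)
    {w : CMat n} {B : CMat m} (hw : w ∈ OmegaIII n) (h0 : eMat i * w = 0) (hVB : Vᴴ * B = 0)
    (hBV : B * Vᴴ = 0) (hline : ∀ ζ : ℂ, g (w + ζ • eMat i) = B + ζ • V) :
    Linked g (deflate f α β) (cdiag α) (cdiag β) i (α i) V := by
  obtain ⟨hws, hw1⟩ := mem_OmegaIII_iff.1 hw
  have hdet := (isUnit_det_one_sub_mul (spNorm_cdiag_lt_one hα) hw1).ne_zero
  have hae : cdiag α * eMat i = (α i : ℂ) • eMat i := diagonal_mul_eMat i _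
  have hea : eMat i * cdiag α = (α i : ℂ) • eMat i := eMat_mul_diagonal i _
  have hse : cdiag (coSqrt α) * eMat i = (coSqrt α i : ℂ) • eMat i := diagonal_mul_eMat i _
  have hes : eMat i * cdiag (coSqrt α) = (coSqrt α i : ℂ) • eMat i := eMat_mul_diagonal i _
  have hα0 : (α i : ℂ) ≠ 0 := by exact_mod_cast hi.ne'
  obtain ⟨h1, h2, h3⟩ := hconj.line hae hea hV hcV hVc hws h0 hdet hVB hBV hline
  set v := w * (1 - cdiag α * w)⁻¹ with hv
  set a := cdiag α with ha
  set b := cdiag β with hb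
  set s := cdiag (coSqrt α) with hs
  set s' := cdiag (coSqrt β) with hs'
  set t := cdiag (coSqrt β)⁻¹ with ht
  set A : ℂ := (α i : ℂ) with hA
  set r : ℂ := (coSqrt α i : ℂ) with hr
  have hr2 : r * r = 1 - A * A := by
    rw [hr, hA, ← Complex.ofReal_mul, ← pow_two, coSqrt_sq hα]
    push_cast
    ring
  have hr0 : r ≠ 0 := by
    rw [hr]; exact_mod_cast (coSqrt_pos hα i).ne'
  have hbh : bᴴ = b := cdiag_conjTranspose β
  have hs'h : s'ᴴ = s' := cdiag_conjTranspose _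
  have hbV' : b * Vᴴ = A • (V * Vᴴ) := by
    have := congrArg conjTranspose hVc
    rwa [conjTranspose_mul, hbh, conjTranspose_smul, conjTranspose_mul, conjTranspose_conjTranspose,
      hA, Complex.star_def, Complex.conj_ofReal] at this
  have hV'b : Vᴴ * b = A • (Vᴴ * V) := by
    have := congrArg conjTranspose hcV
    rwa [conjTranspose_mul, hbh, conjTranspose_smul, conjTranspose_mul, conjTranspose_conjTranspose,
      hA, Complex.star_def, Complex.conj_ofReal] at this
  have hs'V : s' * V = r • V := by
    refine cdiag_coSqrt_mul_of_sq (r := α i) ?_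
    rw [← hb, hcV, Matrix.mul_smul, ← Matrix.mul_assoc, hbV', Matrix.smul_mul, hV, smul_smul]
    push_cast
    rw [pow_two]
  have hV' := partialIsometry_conjTranspose hV
  have hs'V' : s' * Vᴴ = r • Vᴴ := by
    refine cdiag_coSqrt_mul_of_sq (r := α i) ?_
    rw [← hb, hbV', Matrix.mul_smul, ← Matrix.mul_assoc, hcV, Matrix.smul_mul, hV', smul_smul]
    push_cast
    rw [pow_two]
  have hVs' : V * s' = r • V := by
    have := congrArg conjTranspose hs'V'
    rwa [conjTranspose_mul, hs'h, conjTranspose_smul, conjTranspose_conjTranspose,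
      hr, Complex.star_def, Complex.conj_ofReal] at this
  have hV's' : Vᴴ * s' = r • Vᴴ := by
    have := congrArg conjTranspose hs'V
    rwa [conjTranspose_mul, hs'h, conjTranspose_smul,
      hr, Complex.star_def, Complex.conj_ofReal] at this
  have hts : t * s' = 1 := cdiag_inv_mul (coSqrt_pos hβ)
  have hst : s' * t = 1 := cdiag_mul_inv (coSqrt_pos hβ)
  have htV : ∀ X : CMat m, s' * X = r • X → t * X = r⁻¹ • X := fun X hX => by
    calc t * X = t * (r⁻¹ • (r • X)) := by rw [smul_smul, inv_mul_cancel₀ hr0, one_smul]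
      _ = r⁻¹ • X := by rw [← hX, Matrix.mul_smul, ← Matrix.mul_assoc, hts, Matrix.one_mul]
  have hVt : ∀ X : CMat m, X * s' = r • X → X * t = r⁻¹ • X := fun X hX => by
    calc X * t = (r⁻¹ • (r • X)) * t := by rw [smul_smul, inv_mul_cancel₀ hr0, one_smul]
      _ = r⁻¹ • X := by rw [← hX, Matrix.smul_mul, Matrix.mul_assoc, hst, Matrix.mul_one]
  have hfl : FixesBlock f i V := by
    have hmz : mobius α w = -a + s * v * s := rfl
    have hem : eMat i * mobius α w = -A • eMat i := by
      rw [hmz, Matrix.mul_add, Matrix.mul_neg, hea, ← Matrix.mul_assoc, ← Matrix.mul_assoc, hes,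
        Matrix.smul_mul, hv, ← Matrix.mul_assoc, h0]
      simp
    obtain ⟨hms, hm1⟩ := mem_OmegaIII_iff.1 (mobius_mem hα hw)
    have hz : mobius α w + A • eMat i = (1 - eMat i) * mobius α w := by
      rw [Matrix.sub_mul, hem, Matrix.one_mul]
      module
    refine fixesBlock_of_base hf hV (z₀ := mobius α w + A • eMat i) ?_ ?_ ?_ fun φ hφ => ?_
    · rw [transpose_add, hms, transpose_smul, eMat_transpose]
    · rw [Matrix.mul_add, hem, Matrix.mul_smul, eMat_mul_self]
      module
    · rw [hz]
      refine (spNorm_mul_le _ _).trans_lt ?_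
      have := spNorm_one_sub_le_one (eMat_conjTranspose i) (eMat_mul_self i)
      nlinarith [spNorm_nonneg (mobius α w), spNorm_nonneg (1 - eMat i)]
    · have e : φ • eMat i + (mobius α w + A • eMat i)
          = s * (v + ((φ + A) / (r * r)) • eMat i) * s - a := by
        rw [hmz, Matrix.mul_add, Matrix.add_mul, Matrix.mul_smul, hse, Matrix.smul_mul,
          Matrix.smul_mul, hes, smul_smul, smul_smul, mul_assoc _ r r, div_mul_cancel₀ _ (mul_ne_zero hr0 hr0)]
        module
      rw [e, hs, ha, apply_eq_deflate (f := f) hβ, h3, ← hs', ← hb, Matrix.sub_mul, hbV', Matrix.mul_assoc, hs'V',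
        Matrix.mul_smul, Matrix.mul_add, Matrix.add_mul, Matrix.mul_assoc, h2, Matrix.mul_zero,
        zero_add, Matrix.mul_smul, hs'V, Matrix.smul_mul, Matrix.smul_mul, smul_smul, smul_smul,
        ← sub_smul]
      congr 1
      field_simp
      ring
  have hff := flatBlock_of_fixesBlock hf hV hfl
  refine ⟨hconj, hα0, hae, hea, hVs, hV, hcV, hVc, hfix, ?_, flatBlock_of_fixesBlock hg hV hfix, ?_,
    w, B, hws, h0, hdet, hVB, hBV, hline⟩
  · intro ζ u hu hu0
    have h0' := mul_eMat_of_symm hu hu0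
    have e : s * (ζ • eMat i + u) * s - a
        = (ζ * (r * r) - A) • eMat i + (s * u * s - a + A • eMat i) := by
      rw [Matrix.mul_add, Matrix.add_mul, Matrix.mul_smul, hse, Matrix.smul_mul, Matrix.smul_mul,
        hes]
      module
    have h4 := hfl (ζ * (r * r) - A) (s * u * s - a + A • eMat i)
      (by rw [transpose_add, transpose_sub, transpose_cdiag_mul_mul hu, ha, cdiag_transpose,
        transpose_smul, eMat_transpose])
      (by
        rw [Matrix.mul_add, Matrix.mul_sub, hea, ← Matrix.mul_assoc, ← Matrix.mul_assoc, hes,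
          Matrix.smul_mul, hu0, Matrix.mul_smul, eMat_mul_self]
        simp)
    rw [deflate, ← hs, ← ha, e, ← ht, ← hb, Matrix.mul_assoc, htV _ hs'V', Matrix.mul_smul,
      Matrix.mul_assoc, Matrix.add_mul, h4, hbV', ← add_smul, Matrix.mul_smul, ← Matrix.mul_assoc,
      htV _ hs'V, Matrix.smul_mul, smul_smul, smul_smul]
    congr 1
    field_simp
    ring
  · intro κ u hu j k
    have hd := hff (κ * (r * r) - A) (s * u * s - a + A • eMat i)
      (by rw [transpose_add, transpose_sub, transpose_cdiag_mul_mul hu, ha, cdiag_transpose,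
        transpose_smul, eMat_transpose]) j k
    have hsc : ∀ τ, stretch (eMat i) τ * s = s * stretch (eMat i) τ := fun τ => by
      rw [stretch, Matrix.add_mul, Matrix.mul_add, Matrix.smul_mul, Matrix.mul_smul, hse, hes]
      simp
    have hfix' : ∀ τ, stretch (eMat i) τ * (a - A • eMat i) * stretch (eMat i) τ
        = a - A • eMat i := fun τ => by
      have e1 : eMat i * (a - A • eMat i) = 0 := by
        rw [Matrix.mul_sub, hea, Matrix.mul_smul, eMat_mul_self, sub_self]
      have e2 : (a - A • eMat i) * eMat i = 0 := by
        rw [Matrix.sub_mul, hae, Matrix.smul_mul, eMat_mul_self, sub_self]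
      rw [stretch, Matrix.add_mul, Matrix.smul_mul, e1, smul_zero, add_zero, Matrix.one_mul,
        Matrix.mul_add, Matrix.mul_smul, e2, smul_zero, add_zero, Matrix.mul_one]
    have e : ∀ τ, s * (κ • eMat i + stretch (eMat i) τ * u * stretch (eMat i) τ) * s - a
        = (κ * (r * r) - A) • eMat i + stretch (eMat i) τ * (s * u * s - a + A • eMat i)
          * stretch (eMat i) τ := fun τ => by
      have e1 : stretch (eMat i) τ * (s * u * s - a + A • eMat i) * stretch (eMat i) τ
          = s * (stretch (eMat i) τ * u * stretch (eMat i) τ) * s - (a - A • eMat i) := by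
        rw [sub_add, Matrix.mul_sub, Matrix.sub_mul, hfix']
        congr 1
        calc stretch (eMat i) τ * (s * u * s) * stretch (eMat i) τ
            = (stretch (eMat i) τ * s) * u * (s * stretch (eMat i) τ) := by
              simp only [Matrix.mul_assoc]
          _ = (s * stretch (eMat i) τ) * u * (stretch (eMat i) τ * s) := by rw [hsc]
          _ = _ := by simp only [Matrix.mul_assoc]
      rw [e1, Matrix.mul_add, Matrix.add_mul, Matrix.mul_smul, hse, Matrix.smul_mul,
        Matrix.smul_mul, hes]
      module
    have e2 : ∀ τ, (Vᴴ * deflate f α β (κ • eMat i + stretch (eMat i) τ * u * stretch (eMat i) τ)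
        * Vᴴ) j k = (r⁻¹ * r⁻¹) * ((Vᴴ * f ((κ * (r * r) - A) • eMat i + stretch (eMat i) τ
          * (s * u * s - a + A • eMat i) * stretch (eMat i) τ) * Vᴴ) j k + (Vᴴ * b * Vᴴ) j k) := by
      intro τ
      rw [deflate, ← hs, ← ha, e, ← ht, ← hb, Matrix.mul_assoc Vᴴ, Matrix.mul_assoc _ t,
        htV _ hs'V', ← Matrix.mul_assoc, ← Matrix.mul_assoc, hVt _ hV's', Matrix.mul_smul,
        Matrix.smul_mul, Matrix.smul_mul, smul_smul, Matrix.mul_add, Matrix.add_mul,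
        Matrix.smul_apply, smul_eq_mul, Matrix.add_apply]
    have e3 := (hd.add_const ((Vᴴ * b * Vᴴ) j k)).const_mul (r⁻¹ * r⁻¹)
    rw [mul_zero] at e3
    rw [funext e2]
    exact e3

end Deflate

section PolyFamily

open Polynomial

variable {n m : ℕ} {X : Type*} [TopologicalSpace X]

/-- A function of `τ : ℂ` and `u : X` which is polynomial in `τ` with coefficients continuous
in `u`. -/
def IsPolyFamily (φ : ℂ → X → ℂ) : Prop :=
  ∃ p : C(X, ℂ)[X], ∀ τ u, φ τ u = p.eval (ContinuousMap.const X τ) u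

lemma isPolyFamily_of_continuous {q : X → ℂ} (hq : Continuous q) :
    IsPolyFamily fun _ u => q u :=
  ⟨C ⟨q, hq⟩, fun τ u => by rw [eval_C]; rfl⟩

lemma isPolyFamily_fst : IsPolyFamily fun τ (_ : X) => τ :=
  ⟨Polynomial.X, fun τ u => by rw [eval_X]; rfl⟩

lemma IsPolyFamily.add {φ ψ : ℂ → X → ℂ} (hφ : IsPolyFamily φ) (hψ : IsPolyFamily ψ) :
    IsPolyFamily fun τ u => φ τ u + ψ τ u := by
  obtain ⟨p, hp⟩ := hφ
  obtain ⟨q, hq⟩ := hψ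
  exact ⟨p + q, fun τ u => by beta_reduce; rw [hp, hq, eval_add]; rfl⟩

lemma IsPolyFamily.mul {φ ψ : ℂ → X → ℂ} (hφ : IsPolyFamily φ) (hψ : IsPolyFamily ψ) :
    IsPolyFamily fun τ u => φ τ u * ψ τ u := by
  obtain ⟨p, hp⟩ := hφ
  obtain ⟨q, hq⟩ := hψ
  exact ⟨p * q, fun τ u => by beta_reduce; rw [hp, hq, eval_mul]; rfl⟩

lemma isPolyFamily_sum {ι : Type*} (s : Finset ι) {φ : ι → ℂ → X → ℂ}
    (h : ∀ i, IsPolyFamily (φ i)) : IsPolyFamily fun τ u => ∑ i ∈ s, φ i τ u := by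
  classical
  induction s using Finset.induction_on with
  | empty => simpa using isPolyFamily_of_continuous (X := X) (continuous_const (y := (0 : ℂ)))
  | insert i s hi ih =>
    simp only [Finset.sum_insert hi]
    exact (h i).add ih

lemma IsPolyFamily.continuous {φ : ℂ → X → ℂ} (h : IsPolyFamily φ) :
    Continuous fun p : ℂ × X => φ p.1 p.2 := by
  obtain ⟨p, hp⟩ := h
  simp only [hp, eval_eq_sum_range, ContinuousMap.coe_sum, Finset.sum_apply,
    ContinuousMap.mul_apply, ContinuousMap.pow_apply, ContinuousMap.const_apply]
  fun_prop

lemma IsPolyFamily.differentiable {φ : ℂ → X → ℂ} (h : IsPolyFamily φ) (u : X) :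
    Differentiable ℂ fun τ => φ τ u := by
  obtain ⟨p, hp⟩ := h
  simp only [hp, eval_eq_sum_range, ContinuousMap.coe_sum, Finset.sum_apply,
    ContinuousMap.mul_apply, ContinuousMap.pow_apply, ContinuousMap.const_apply]
  fun_prop

lemma IsPolyFamily.exists_divX {φ : ℂ → X → ℂ} (h : IsPolyFamily φ) :
    ∃ ψ : ℂ → X → ℂ, IsPolyFamily ψ ∧ ∀ τ u, φ τ u = φ 0 u + τ * ψ τ u := by
  obtain ⟨p, hp⟩ := h
  refine ⟨fun τ u => p.divX.eval (ContinuousMap.const X τ) u, ⟨p.divX, fun _ _ => rfl⟩,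
    fun τ u => ?_⟩
  have h0 : φ 0 u = p.coeff 0 u := by
    rw [hp, coeff_zero_eq_eval_zero]
    rfl
  have h1 := congrArg (eval (ContinuousMap.const X τ)) p.X_mul_divX_add
  rw [eval_add, eval_mul, eval_X, eval_C] at h1
  rw [h0, hp, ← h1, add_comm]
  rfl

/-- Matrix families with entries in `IsPolyFamily`. -/
def IsMatrixFamily (Φ : ℂ → X → CMat m) : Prop := ∀ j k, IsPolyFamily fun τ u => Φ τ u j k

lemma IsMatrixFamily.add {Φ Ψ : ℂ → X → CMat m} (hΦ : IsMatrixFamily Φ) (hΨ : IsMatrixFamily Ψ) :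
    IsMatrixFamily fun τ u => Φ τ u + Ψ τ u := fun j k => (hΦ j k).add (hΨ j k)

lemma IsMatrixFamily.mul {Φ Ψ : ℂ → X → CMat m} (hΦ : IsMatrixFamily Φ) (hΨ : IsMatrixFamily Ψ) :
    IsMatrixFamily fun τ u => Φ τ u * Ψ τ u := fun j k => by
  simp only [mul_apply]
  exact isPolyFamily_sum _ fun l => (hΦ j l).mul (hΨ l k)

lemma isMatrixFamily_of_continuous {q : X → CMat m} (hq : Continuous q) :
    IsMatrixFamily fun (_ : ℂ) u => q u := fun j k =>
  isPolyFamily_of_continuous (hq.matrix_elem j k)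

lemma isMatrixFamily_const (A : CMat m) : IsMatrixFamily fun (_ : ℂ) (_ : X) => A :=
  isMatrixFamily_of_continuous continuous_const

lemma isMatrixFamily_stretch (Q : CMat m) : IsMatrixFamily fun τ (_ : X) => stretch Q τ := by
  simp only [stretch_eq]
  exact (isMatrixFamily_const _).add fun j k =>
    isPolyFamily_fst.mul (isPolyFamily_of_continuous continuous_const)

lemma IsMatrixFamily.continuous {Φ : ℂ → X → CMat m} (h : IsMatrixFamily Φ) :
    Continuous fun p : ℂ × X => Φ p.1 p.2 :=
  continuous_matrix fun j k => (h j k).continuous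

lemma IsMatrixFamily.exists_divX {Φ : ℂ → X → CMat m} (h : IsMatrixFamily Φ) :
    ∃ Ψ : ℂ → X → CMat m, IsMatrixFamily Ψ ∧ ∀ τ u, Φ τ u = Φ 0 u + τ • Ψ τ u := by
  choose ψ hψ hφ using fun j k => (h j k).exists_divX
  exact ⟨fun τ u => of fun j k => ψ j k τ u, hψ, fun τ u => by
    ext j k
    exact hφ j k τ u⟩

lemma IsPolyMapIII.isMatrixFamily {F : CMat n → CMat m} (hF : IsPolyMapIII F)
    {Φ : ℂ → X → CMat n} (h : IsMatrixFamily Φ) : IsMatrixFamily fun τ u => F (Φ τ u) := by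
  intro j k
  obtain ⟨p, hp⟩ := hF j k
  simp only [hp]
  clear hp
  induction p using MvPolynomial.induction_on with
  | C r => simpa using isPolyFamily_of_continuous (X := X) (continuous_const (y := r))
  | add p q hp hq => simpa only [MvPolynomial.eval_add] using hp.add hq
  | mul_X p r hp =>
    simpa only [MvPolynomial.eval_mul, MvPolynomial.eval_X] using hp.mul (h r.1 r.2)

/-- A map fixing a block, with no first order term, factors through the stretchings. -/
lemma FixesBlock.exists_factor {F : CMat n → CMat m} (hF : IsPolyMapIII F)
    (hs : ∀ Z, Zᵀ = Z → (F Z)ᵀ = F Z) {i : Fin n} {V : CMat m} (hVs : Vᵀ = V)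
    (hV : V * Vᴴ * V = V) (hb : FixesBlock F i V) (hf : FlatBlock F i V) (κ : ℂ) :
    ∃ G : ℂ → CMat n → CMat m, IsMatrixFamily G ∧ ∀ τ u, uᵀ = u →
      F (κ • eMat i + stretch (eMat i) τ * u * stretch (eMat i) τ)
        = κ • V + stretch (V * Vᴴ) τ * G τ u * stretch (Vᴴ * V) τ := by
  have hV' := partialIsometry_conjTranspose hV
  set Φ : ℂ → CMat n → CMat m := fun τ u =>
    F (κ • eMat i + stretch (eMat i) τ * u * stretch (eMat i) τ) + -(κ • V) with hΦ
  have hΦf : IsMatrixFamily Φ :=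
    (hF.isMatrixFamily ((isMatrixFamily_const _).add (((isMatrixFamily_stretch _).mul
      (isMatrixFamily_of_continuous continuous_id)).mul (isMatrixFamily_stretch _)))).add
      (isMatrixFamily_const _)
  obtain ⟨Ψ, hΨf, hΨ⟩ := hΦf.exists_divX
  obtain ⟨Ξ, hΞf, hΞ⟩ := hΨf.exists_divX
  set Q := Vᴴ * V with hQ
  set Q' := V * Vᴴ with hQ'
  have hQQ : Q * Q = Q := by rw [hQ, ← Matrix.mul_assoc, hV']
  have hQQ' : Q' * Q' = Q' := by rw [hQ', ← Matrix.mul_assoc, hV]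
  refine ⟨fun τ u => (1 - Q') * Φ τ u * (1 - Q) + Q' * Ψ τ u * (1 - Q) + (1 - Q') * Ψ τ u * Q
    + Q' * Ξ τ u * Q, ?_, fun τ u hu => ?_⟩
  · have hc := fun A : CMat m => isMatrixFamily_const (X := CMat n) A
    exact (((((hc _).mul hΦf).mul (hc _)).add (((hc _).mul hΨf).mul (hc _))).add
      (((hc _).mul hΨf).mul (hc _))).add (((hc _).mul hΞf).mul (hc _))
  · have hue : eMat i * ((1 - eMat i) * u * (1 - eMat i)) = 0 := by
      have e : eMat i * (1 - eMat i) = 0 := by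
        rw [Matrix.mul_sub, Matrix.mul_one, eMat_mul_self, sub_self]
      rw [← Matrix.mul_assoc, ← Matrix.mul_assoc, e, Matrix.zero_mul, Matrix.zero_mul]
    have hus : ((1 - eMat i) * u * (1 - eMat i))ᵀ = (1 - eMat i) * u * (1 - eMat i) := by
      simp only [transpose_mul, transpose_sub, transpose_one, eMat_transpose, hu, Matrix.mul_assoc]
    have h0 : Φ 0 u * Vᴴ = 0 := by
      simp only [hΦ, stretch_zero]
      rw [Matrix.add_mul, hb κ _ hus hue, Matrix.neg_mul, Matrix.smul_mul, add_neg_cancel]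
    have h0' : Vᴴ * Φ 0 u = 0 := by
      simp only [hΦ, stretch_zero]
      rw [Matrix.mul_add, hb.left hs hVs κ hus hue, Matrix.mul_neg, Matrix.mul_smul, add_neg_cancel]
    have h1 : Vᴴ * Ψ 0 u * Vᴴ = 0 := by
      ext j k
      have e : ∀ τ, (Vᴴ * F (κ • eMat i + stretch (eMat i) τ * u * stretch (eMat i) τ) * Vᴴ) j k
          = (Vᴴ * (κ • V) * Vᴴ) j k + τ * (Vᴴ * Ψ τ u * Vᴴ) j k := fun τ => by
        have e1 : F (κ • eMat i + stretch (eMat i) τ * u * stretch (eMat i) τ)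
            = κ • V + Φ τ u := by
          simp only [hΦ]
          abel
        rw [e1, hΨ, Matrix.mul_add, Matrix.add_mul, Matrix.mul_add Vᴴ (Φ 0 u), h0', zero_add,
          Matrix.mul_smul Vᴴ τ, Matrix.smul_mul τ]
        rfl
      have hd : DifferentiableAt ℂ (fun τ => (Vᴴ * Ψ τ u * Vᴴ) j k) 0 := by
        have hc := fun A : CMat m => isMatrixFamily_const (X := CMat n) A
        exact (((hc Vᴴ).mul hΨf).mul (hc Vᴴ) j k).differentiable u 0
      have h2 := ((hasDerivAt_id (0 : ℂ)).mul hd.hasDerivAt).const_add ((Vᴴ * (κ • V) * Vᴴ) j k)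
      have h3 := hf κ u hu j k
      rw [funext e] at h3
      have := h3.unique h2
      simpa using this.symm
    have hQ0 : Φ τ u * Q = τ • (Ψ τ u * Q) := by
      rw [hΨ, Matrix.add_mul, hQ, ← Matrix.mul_assoc, h0]
      simp
    have hQ0' : Q' * Φ τ u = τ • (Q' * Ψ τ u) := by
      rw [hΨ, Matrix.mul_add, hQ', Matrix.mul_assoc V, h0']
      simp
    have hQ1 : Q' * Ψ τ u * Q = τ • (Q' * Ξ τ u * Q) := by
      have : Q' * Ψ 0 u * Q = 0 := by
        calc Q' * Ψ 0 u * Q = V * (Vᴴ * Ψ 0 u * Vᴴ) * V := by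
              simp only [hQ, hQ', Matrix.mul_assoc]
          _ = 0 := by rw [h1]; simp
      rw [hΞ, Matrix.mul_add, Matrix.add_mul, this]
      simp
    have e1 : F (κ • eMat i + stretch (eMat i) τ * u * stretch (eMat i) τ)
        = κ • V + Φ τ u := by
      simp only [hΦ]
      abel
    rw [e1]
    congr 1
    have z1 : Q' * (1 - Q') = 0 := by rw [Matrix.mul_sub, hQQ', Matrix.mul_one, sub_self]
    have z2 : (1 - Q) * Q = 0 := by rw [Matrix.sub_mul, hQQ, Matrix.one_mul, sub_self]
    have l1 : stretch Q' τ * (1 - Q') = 1 - Q' := by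
      rw [stretch, Matrix.add_mul, Matrix.smul_mul, z1, smul_zero, add_zero, Matrix.one_mul]
    have r1 : (1 - Q) * stretch Q τ = 1 - Q := by
      rw [stretch, Matrix.mul_add, Matrix.mul_smul, z2, smul_zero, add_zero, Matrix.mul_one]
    have l2 := stretch_mul_self hQQ' τ
    have r2 := mul_stretch hQQ τ
    have key : ∀ A B Y : CMat m, stretch Q' τ * (A * Y * B) * stretch Q τ
        = (stretch Q' τ * A) * Y * (B * stretch Q τ) := fun A B Y => by
      simp only [Matrix.mul_assoc]
    rw [Matrix.mul_add, Matrix.mul_add, Matrix.mul_add, Matrix.add_mul, Matrix.add_mul,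
      Matrix.add_mul, key, key, key, key, l1, r1, l2, r2]
    calc Φ τ u = (1 - Q') * Φ τ u * (1 - Q) + Q' * Φ τ u * (1 - Q) + (1 - Q') * (Φ τ u * Q)
          + Q' * Φ τ u * Q := by noncomm_ring
      _ = _ := by
          rw [hQ0', hQ0, Matrix.smul_mul τ _ Q, hQ1]
          simp only [Matrix.smul_mul, Matrix.mul_smul, Matrix.mul_assoc]

end PolyFamily

section Scaling

variable {n m : ℕ}

lemma stretch_mul_inv {Q : CMat n} (hQ : Q * Q = Q) {τ : ℂ} (hτ : τ ≠ 0) :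
    stretch Q τ * stretch Q τ⁻¹ = 1 := by
  rw [stretch_mul hQ, mul_inv_cancel₀ hτ, stretch_one]

lemma stretch_inv_mul {Q : CMat n} (hQ : Q * Q = Q) {τ : ℂ} (hτ : τ ≠ 0) :
    stretch Q τ⁻¹ * stretch Q τ = 1 := by
  rw [stretch_mul hQ, inv_mul_cancel₀ hτ, stretch_one]

/-- The transformation `w ↦ w (1 - a w)⁻¹` at a stretched argument. -/
lemma mul_one_sub_inv_stretch {a w : CMat n} {i : Fin n} {α τ : ℂ} (hα : α ≠ 0) (hτ : τ ≠ 0)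
    (hae : a * eMat i = α • eMat i) (hea : eMat i * a = α • eMat i)
    (hD : (stretch (eMat i) (τ ^ 2) - a * w).det ≠ 0) :
    (1 - a * (stretch (eMat i) τ⁻¹ * w * stretch (eMat i) τ⁻¹)).det ≠ 0 ∧
      stretch (eMat i) τ⁻¹ * w * stretch (eMat i) τ⁻¹
          * (1 - a * (stretch (eMat i) τ⁻¹ * w * stretch (eMat i) τ⁻¹))⁻¹
        = -α⁻¹ • eMat i + stretch (eMat i) τ * (((1 - eMat i) * w + α⁻¹ • eMat i)
          * (stretch (eMat i) (τ ^ 2) - a * w)⁻¹) * stretch (eMat i) τ := by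
  have he := eMat_mul_self i
  set e := eMat i with hedef
  set D := stretch e (τ ^ 2) - a * w with hDdef
  set s := stretch e τ with hs
  set r := stretch e τ⁻¹ with hr
  have hsr : s * r = 1 := stretch_mul_inv he hτ
  have hrs : r * s = 1 := stretch_inv_mul he hτ
  have har : a * r = r * a := by
    rw [hr, stretch, Matrix.mul_add, Matrix.add_mul, Matrix.mul_smul, Matrix.smul_mul, hae, hea,
      Matrix.mul_one, Matrix.one_mul]
  have hss : stretch e (τ ^ 2) = s * s := by rw [hs, stretch_mul he, sq]
  have hrs2 : s * (r * r) = r := by rw [← Matrix.mul_assoc, hsr, Matrix.one_mul]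
  have h1 : 1 - a * (r * w * r) = r * D * r := by
    calc 1 - a * (r * w * r) = 1 - (a * r) * w * r := by noncomm_ring
      _ = (r * s) * (s * r) - r * (a * w) * r := by rw [har, hsr, hrs]; noncomm_ring
      _ = r * D * r := by rw [hDdef, hss]; noncomm_ring
  have hDi := mul_nonsing_inv D (isUnit_iff_ne_zero.2 hD)
  have hDi' := nonsing_inv_mul D (isUnit_iff_ne_zero.2 hD)
  have h2 : r * D * r * (s * D⁻¹ * s) = 1 := by
    calc r * D * r * (s * D⁻¹ * s) = r * D * (r * s) * D⁻¹ * s := by noncomm_ring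
      _ = r * (D * D⁻¹) * s := by rw [hrs, Matrix.mul_one]; noncomm_ring
      _ = 1 := by rw [hDi, Matrix.mul_one, hrs]
  have hdet : (r * D * r).det ≠ 0 := fun h0 => by
    have := congrArg det h2
    rw [det_mul, h0, zero_mul, det_one] at this
    exact zero_ne_one this
  rw [h1]
  refine ⟨hdet, ?_⟩
  rw [inv_eq_right_inv h2]
  have h3 : (1 - e) * w + α⁻¹ • e = r * r * w + (α⁻¹ * τ⁻¹ ^ 2) • (e * D) := by
    have e1 : (α⁻¹ * τ⁻¹ ^ 2) • (e * D) = α⁻¹ • e - (τ⁻¹ ^ 2) • (e * w) := by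
      rw [hDdef, Matrix.mul_sub, mul_stretch he, ← Matrix.mul_assoc, hea, Matrix.smul_mul,
        smul_sub, smul_smul, smul_smul]
      congr 2
      · field_simp
      · field_simp
    have e2 : r * r = (1 - e) + τ⁻¹ ^ 2 • e := by
      rw [hr, stretch_mul he, ← sq, stretch_eq]
    rw [e1, e2, Matrix.add_mul, Matrix.smul_mul]
    abel
  have h4 : s * e * s = τ ^ 2 • e := by
    rw [hs, stretch_mul_self he, Matrix.smul_mul, mul_stretch he, smul_smul, sq]
  rw [h3]
  calc r * w * r * (s * D⁻¹ * s) = r * w * (r * s) * D⁻¹ * s := by noncomm_ring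
    _ = s * (r * r) * w * D⁻¹ * s := by rw [hrs, Matrix.mul_one, hrs2]
    _ = -α⁻¹ • e + (s * (r * r) * w * D⁻¹ * s
          + (α⁻¹ * τ⁻¹ ^ 2) • (s * (e * (D * D⁻¹)) * s)) := by
        have h5 : α⁻¹ * τ⁻¹ ^ 2 * τ ^ 2 = α⁻¹ := by field_simp
        rw [hDi, Matrix.mul_one, h4, smul_smul, h5]
        module
    _ = _ := by
        congr 1
        simp only [Matrix.add_mul, Matrix.mul_add, Matrix.smul_mul, Matrix.mul_smul,
          Matrix.mul_assoc]

/-- The relations between the stretched factors of two conjugate maps. -/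
lemma Linked.factor_rel {g P : CMat n → CMat m} {a : CMat n} {c : CMat m} {i : Fin n} {α : ℂ}
    {V : CMat m} (h : Linked g P a c i α V) {G H : ℂ → CMat n → CMat m}
    (hG : ∀ τ u, uᵀ = u → g (stretch (eMat i) τ * u * stretch (eMat i) τ)
      = stretch (V * Vᴴ) τ * G τ u * stretch (Vᴴ * V) τ)
    (hH : ∀ τ u, uᵀ = u → P (-α⁻¹ • eMat i + stretch (eMat i) τ * u * stretch (eMat i) τ)
      = -α⁻¹ • V + stretch (V * Vᴴ) τ * H τ u * stretch (Vᴴ * V) τ)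
    {τ : ℂ} (hτ : τ ≠ 0) {w u : CMat n} (hw : wᵀ = w)
    (hD : (stretch (eMat i) (τ ^ 2) - a * w).det ≠ 0)
    (hu : u = ((1 - eMat i) * w + α⁻¹ • eMat i) * (stretch (eMat i) (τ ^ 2) - a * w)⁻¹) :
    G τ⁻¹ w * (1 - Vᴴ * V + c * H τ u) = -α⁻¹ • V + stretch (V * Vᴴ) (τ ^ 2) * H τ u ∧
      (1 - Vᴴ * V + c * H τ u) * (stretch (Vᴴ * V) τ
        * (1 - c * g (stretch (eMat i) τ⁻¹ * w * stretch (eMat i) τ⁻¹))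
        * stretch (Vᴴ * V) τ) = 1 := by
  obtain ⟨h1, h2⟩ := mul_one_sub_inv_stretch h.ne_zero hτ h.base_mul h.mul_base hD
  rw [← hu] at h2
  have he := eMat_mul_self i
  have hV := h.isometry
  have hV' := partialIsometry_conjTranspose hV
  set Q := Vᴴ * V with hQ
  set Q' := V * Vᴴ with hQ'
  have hQQ : Q * Q = Q := by rw [hQ, ← Matrix.mul_assoc, hV']
  have hQQ' : Q' * Q' = Q' := by rw [hQ', ← Matrix.mul_assoc, hV]
  have hWs := stretch_symm (eMat_transpose i) hw τ⁻¹
  have hus : uᵀ = u := by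
    have h3 := transpose_mul_one_sub_inv_of_det_ne_zero h.conj.symm_base hWs h1
    rw [h2, transpose_add, transpose_smul, eMat_transpose, add_right_inj, transpose_mul,
      transpose_mul, stretch_transpose, eMat_transpose] at h3
    have h4 : ∀ x : CMat n, x = stretch (eMat i) τ⁻¹ * (stretch (eMat i) τ * (x *
        stretch (eMat i) τ)) * stretch (eMat i) τ⁻¹ := fun x => by
      rw [← Matrix.mul_assoc, ← Matrix.mul_assoc, stretch_inv_mul he hτ, Matrix.one_mul,
        Matrix.mul_assoc, stretch_mul_inv he hτ, Matrix.mul_one]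
    rw [h4 uᵀ, h3, Matrix.mul_assoc (stretch (eMat i) τ) u, ← h4]
  have hr := h.conj.rel _ hWs h1
  rw [h2, hH τ u hus] at hr
  have hr1 := mul_of_rel hr
  have hr2 := one_add_mul_of_rel hr
  set s := stretch Q τ with hs
  set s' := stretch Q' τ with hs'
  set r := stretch Q τ⁻¹ with hr'
  set r' := stretch Q' τ⁻¹ with hr''
  have hsr : s * r = 1 := stretch_mul_inv hQQ hτ
  have hrs : r * s = 1 := stretch_inv_mul hQQ hτ
  have hsr' : s' * r' = 1 := stretch_mul_inv hQQ' hτ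
  have hcs : c * s' = s * c := by
    have e1 : c * Q' = Q * c := by
      rw [hQ', hQ, ← Matrix.mul_assoc, h.base_mul_isometry, Matrix.mul_assoc, h.isometry_mul_base,
        Matrix.smul_mul, Matrix.mul_smul, Matrix.mul_assoc]
    rw [hs, hs', stretch, stretch, Matrix.mul_add, Matrix.add_mul, Matrix.mul_smul,
      Matrix.smul_mul, e1, Matrix.mul_one, Matrix.one_mul]
  have hsQ : s * (1 - Q) * s = 1 - Q := by
    rw [hs, Matrix.mul_sub, Matrix.mul_one, stretch_mul_self hQQ, Matrix.sub_mul, Matrix.smul_mul,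
      mul_stretch hQQ, stretch_mul hQQ, stretch_eq]
    module
  have hK : 1 + c * (-α⁻¹ • V + s' * H τ u * s) = s * (1 - Q + c * H τ u) * s := by
    calc 1 + c * (-α⁻¹ • V + s' * H τ u * s)
        = 1 + -α⁻¹ • (c * V) + (c * s') * H τ u * s := by
          rw [Matrix.mul_add, Matrix.mul_smul]
          simp only [Matrix.mul_assoc]
          abel
      _ = (1 - Q) + s * c * H τ u * s := by
          rw [h.base_mul_isometry, ← hQ, hcs, smul_smul, neg_mul, inv_mul_cancel₀ h.ne_zero]
          simp only [neg_smul, one_smul, sub_eq_add_neg]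
      _ = s * (1 - Q) * s + s * c * H τ u * s := by rw [hsQ]
      _ = _ := by noncomm_ring
  rw [hK] at hr1 hr2
  constructor
  · rw [hG _ _ hw] at hr1
    have hsV : s' * V * r = V := by
      have e1 : s' * V = τ • V := by
        conv_lhs => rw [← hV]
        rw [← Matrix.mul_assoc, hs', stretch_mul_self hQQ', Matrix.smul_mul, hV]
      have e2 : V * r = τ⁻¹ • V := by
        conv_lhs => rw [← hV]
        rw [hQ', Matrix.mul_assoc, Matrix.mul_assoc, ← Matrix.mul_assoc Vᴴ, ← hQ, hr',
          mul_stretch hQQ, Matrix.mul_smul, hQ, ← Matrix.mul_assoc, ← hQ', hV]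
      rw [e1, Matrix.smul_mul, e2, smul_smul, mul_inv_cancel₀ hτ, one_smul]
    calc G τ⁻¹ w * (1 - Q + c * H τ u)
        = s' * r' * G τ⁻¹ w * (r * s) * (1 - Q + c * H τ u) * (s * r) := by
          rw [hsr', hrs, hsr]; simp
      _ = s' * (r' * G τ⁻¹ w * r * (s * (1 - Q + c * H τ u) * s)) * r := by
          simp only [Matrix.mul_assoc]
      _ = -α⁻¹ • (s' * V * r) + s' * s' * H τ u * (s * r) := by
          rw [hr1, Matrix.mul_add, Matrix.add_mul, Matrix.mul_smul, Matrix.smul_mul]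
          simp only [Matrix.mul_assoc]
      _ = _ := by rw [hsV, hsr, Matrix.mul_one, hs', stretch_mul hQQ', sq]
  · set X := 1 - c * g (stretch (eMat i) τ⁻¹ * w * stretch (eMat i) τ⁻¹) with hX
    have hX1 := congrArg (fun Y => r * Y * s) hr2
    simp only [Matrix.mul_one, hrs] at hX1
    calc (1 - Q + c * H τ u) * (s * X * s) = r * s * (1 - Q + c * H τ u) * (s * X * s) := by
          rw [hrs, Matrix.one_mul]
      _ = r * (s * (1 - Q + c * H τ u) * s * X) * s := by simp only [Matrix.mul_assoc]
      _ = 1 := hX1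

end Scaling

section ScalingLimit

variable {n m : ℕ}

open Filter Topology

lemma ContinuousAt.matrix_inv {X : Type*} [TopologicalSpace X] {F : X → CMat n} {x : X}
    (hF : ContinuousAt F x) (h : (F x).det ≠ 0) : ContinuousAt (fun y => (F y)⁻¹) x := by
  simp only [inv_def, Ring.inverse_eq_inv']
  have h1 : ContinuousAt (fun y => (F y).det) x :=
    (continuous_id.matrix_det (A := fun A : CMat n => A)).continuousAt.comp hF
  have h2 : ContinuousAt (fun y => (F y).adjugate) x :=
    (continuous_id.matrix_adjugate (A := fun A : CMat n => A)).continuousAt.comp hF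
  exact (h1.inv₀ h).smul h2

lemma ContinuousAt.eventually_det_ne_zero {X : Type*} [TopologicalSpace X] {F : X → CMat n} {x : X}
    (hF : ContinuousAt F x) (h : (F x).det ≠ 0) : ∀ᶠ y in 𝓝 x, (F y).det ≠ 0 :=
  ((continuous_id.matrix_det (A := fun A : CMat n => A)).continuousAt.comp hF).eventually_ne h

/-- The symmetric matrix at which the conjugate map is evaluated after stretching by `τ⁻¹`. -/
def stretchArg (a : CMat n) (i : Fin n) (α τ : ℂ) (w : CMat n) : CMat n :=
  ((1 - eMat i) * w + α⁻¹ • eMat i) * (stretch (eMat i) (τ ^ 2) - a * w)⁻¹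

lemma continuous_stretch (Q : CMat n) : Continuous (stretch Q) := by
  unfold stretch
  fun_prop

lemma ContinuousAt.stretchArg {X : Type*} [TopologicalSpace X] {a : CMat n} {i : Fin n} {α : ℂ}
    {τ : X → ℂ} {w : X → CMat n} {x : X} (hτ : ContinuousAt τ x) (hw : ContinuousAt w x)
    (hD : (stretch (eMat i) (τ x ^ 2) - a * w x).det ≠ 0) :
    ContinuousAt (fun y => stretchArg a i α (τ y) (w y)) x := by
  unfold _root_.stretchArg
  refine ContinuousAt.mul ?_ (ContinuousAt.matrix_inv (ContinuousAt.sub ?_ ?_) hD)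
  · exact (continuousAt_const.mul hw).add continuousAt_const
  · exact (continuous_stretch _).continuousAt.comp (hτ.pow 2)
  · exact continuousAt_const.mul hw

/-- A polynomial family whose stretched factor has a finite limit at infinity is constant. -/
lemma IsMatrixFamily.eq_of_rel {X : Type*} [TopologicalSpace X] {G : ℂ → X → CMat m}
    (hG : IsMatrixFamily G) {w : X} {K R : ℂ → CMat m} (hK : ContinuousAt K 0)
    (hR : ContinuousAt R 0) (hK0 : (K 0).det ≠ 0)
    (h : ∀ᶠ τ in 𝓝[≠] 0, G τ⁻¹ w * K τ = R τ) (s t : ℂ) : G s w = G t w := by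
  have h1 : ContinuousAt (fun τ => R τ * (K τ)⁻¹) 0 := hR.mul (hK.matrix_inv hK0)
  have h2 : Tendsto (fun τ : ℂ => G τ⁻¹ w) (𝓝[≠] 0) (𝓝 (R 0 * (K 0)⁻¹)) := by
    refine (h1.tendsto.mono_left nhdsWithin_le_nhds).congr' ?_
    filter_upwards [h, (hK.eventually_det_ne_zero hK0).filter_mono nhdsWithin_le_nhds]
      with τ hτ hd
    rw [← hτ, Matrix.mul_assoc, mul_nonsing_inv _ (isUnit_iff_ne_zero.2 hd), Matrix.mul_one]
  have h3 : Tendsto (fun τ : ℂ => G τ w) (cocompact ℂ) (𝓝 (R 0 * (K 0)⁻¹)) := by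
    rw [← Metric.cobounded_eq_cocompact]
    refine (h2.comp tendsto_inv₀_cobounded').congr fun τ => ?_
    simp
  ext j k
  have hd : Differentiable ℂ fun τ => G τ w j k := (hG j k).differentiable w
  have h4 : Tendsto (fun τ => G τ w j k) (cocompact ℂ) (𝓝 ((R 0 * (K 0)⁻¹) j k)) :=
    ((continuous_id.matrix_elem j k).tendsto _).comp h3
  exact (hd.apply_eq_of_tendsto_cocompact s h4).trans (hd.apply_eq_of_tendsto_cocompact t h4).symm

/-- A map linked to another one commutes with the stretchings of the corresponding variable. -/
theorem Linked.apply_stretch {g P : CMat n → CMat m} {a : CMat n} {c : CMat m} {i : Fin n} {α : ℂ}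
    {V : CMat m} (h : Linked g P a c i α V) {w : CMat n} (hw : wᵀ = w) (t : ℂ) :
    g (stretch (eMat i) t * w * stretch (eMat i) t)
      = stretch (V * Vᴴ) t * g w * stretch (Vᴴ * V) t := by
  have he := eMat_mul_self i
  have hV' := partialIsometry_conjTranspose h.isometry
  have hQQ : Vᴴ * V * (Vᴴ * V) = Vᴴ * V := by rw [← Matrix.mul_assoc, hV']
  obtain ⟨G, hGf, hG⟩ := h.fixes_left.exists_factor h.conj.poly_left h.conj.symm_left h.symm
    h.isometry h.flat_left 0
  obtain ⟨H, hHf, hH⟩ := h.fixes_right.exists_factor h.conj.poly_right h.conj.symm_right h.symm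
    h.isometry h.flat_right (-α⁻¹)
  simp only [zero_smul, zero_add] at hG
  set K : ℂ → CMat n → CMat m := fun τ w => 1 - Vᴴ * V + c * H τ (stretchArg a i α τ w) with hKdef
  have hrel : ∀ {τ : ℂ}, τ ≠ 0 → ∀ {w : CMat n}, wᵀ = w →
      (stretch (eMat i) (τ ^ 2) - a * w).det ≠ 0 → _ := fun hτ _ hw hD =>
    h.factor_rel hG hH hτ hw hD rfl
  have hHc : ∀ {X : Type} [TopologicalSpace X] {τ : X → ℂ} {w : X → CMat n} {x : X},
      ContinuousAt τ x → ContinuousAt w x → (stretch (eMat i) (τ x ^ 2) - a * w x).det ≠ 0 →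
      ContinuousAt (fun y => H (τ y) (stretchArg a i α (τ y) (w y))) x :=
    fun hτ hw hD => hHf.continuous.continuousAt.comp (hτ.prodMk (hτ.stretchArg hw hD))
  have hKc : ∀ {X : Type} [TopologicalSpace X] {τ : X → ℂ} {w : X → CMat n} {x : X},
      ContinuousAt τ x → ContinuousAt w x → (stretch (eMat i) (τ x ^ 2) - a * w x).det ≠ 0 →
      ContinuousAt (fun y => K (τ y) (w y)) x :=
    fun hτ hw hD => continuousAt_const.add (continuousAt_const.mul (hHc hτ hw hD))
  have hDc : ∀ w : CMat n, Continuous fun τ : ℂ => stretch (eMat i) (τ ^ 2) - a * w := fun w =>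
    ((continuous_stretch _).comp (continuous_pow 2)).sub continuous_const
  have hconst : ∀ {w : CMat n}, wᵀ = w → (stretch (eMat i) (0 ^ 2) - a * w).det ≠ 0 →
      (K 0 w).det ≠ 0 → g (stretch (eMat i) t * w * stretch (eMat i) t)
        = stretch (V * Vᴴ) t * g w * stretch (Vᴴ * V) t := by
    intro w hw hD hK
    have e1 : G t w = G 1 w := by
      refine hGf.eq_of_rel (K := fun τ => K τ w)
        (R := fun τ => -α⁻¹ • V + stretch (V * Vᴴ) (τ ^ 2) * H τ (stretchArg a i α τ w))
        (hKc continuousAt_id continuousAt_const hD) ?_ hK ?_ _ _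
      · exact continuousAt_const.add
          (((continuous_stretch _).comp (continuous_pow 2)).continuousAt.mul
            (hHc continuousAt_id continuousAt_const hD))
      · filter_upwards [self_mem_nhdsWithin,
          ((hDc w).continuousAt.eventually_det_ne_zero hD).filter_mono nhdsWithin_le_nhds]
          with τ hτ hd
        exact (hrel hτ hw hd).1
    have e2 := hG 1 w hw
    simp only [stretch_one, Matrix.one_mul, Matrix.mul_one] at e2
    rw [hG t w hw, e1, e2]
  obtain ⟨w₀, B, hw₀, h0, hdet, hVB, hBV, hg⟩ := h.line
  have h0' := mul_eMat_of_symm hw₀ h0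
  set w₁ := w₀ + eMat i with hw₁
  have hw₁s : w₁ᵀ = w₁ := by rw [hw₁, transpose_add, hw₀, eMat_transpose]
  have hD₁ : (stretch (eMat i) (0 ^ 2) - a * w₁).det ≠ 0 := by
    have e0 : (1 - a * w₀) * eMat i = eMat i := by
      rw [Matrix.sub_mul, Matrix.mul_assoc, h0', Matrix.mul_zero, sub_zero, Matrix.one_mul]
    have e1 : stretch (eMat i) (0 ^ 2) - a * w₁ = (1 - a * w₀) * stretch (eMat i) (-α) := by
      rw [hw₁, Matrix.mul_add, h.base_mul, stretch, stretch, Matrix.mul_add, Matrix.mul_smul,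
        e0, Matrix.mul_one]
      module
    have e2 := congrArg det (stretch_mul_inv he (neg_ne_zero.2 h.ne_zero))
    rw [det_mul, det_one] at e2
    rw [e1, det_mul]
    exact mul_ne_zero hdet (left_ne_zero_of_mul_eq_one e2)
  have hK₁ : (K 0 w₁).det ≠ 0 := by
    have e1 : ∀ᶠ τ : ℂ in 𝓝[≠] 0,
        K τ w₁ * (stretch (Vᴴ * V) (τ ^ 2) - c * B - α • (Vᴴ * V)) = 1 := by
      filter_upwards [self_mem_nhdsWithin,
          ((hDc w₁).continuousAt.eventually_det_ne_zero hD₁).filter_mono nhdsWithin_le_nhds]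
          with τ hτ hd
      have hτ0 : τ ≠ 0 := hτ
      rw [← (hrel hτ0 hw₁s hd).2]
      congr 1
      have e2 : stretch (eMat i) τ⁻¹ * w₁ * stretch (eMat i) τ⁻¹ = w₀ + (τ⁻¹ ^ 2) • eMat i := by
        rw [hw₁, stretch_mul_mul_stretch]
        simp only [Matrix.mul_add, Matrix.add_mul, Matrix.mul_sub, Matrix.sub_mul, Matrix.mul_one,
          Matrix.one_mul, h0, h0', he, Matrix.zero_mul]
        module
      have e3 : Vᴴ * V * (c * B) = 0 := by
        rw [Matrix.mul_assoc, ← Matrix.mul_assoc V, h.isometry_mul_base, Matrix.smul_mul,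
          Matrix.mul_assoc, hVB]
        simp
      have e4 : c * B * (Vᴴ * V) = 0 := by
        rw [Matrix.mul_assoc, ← Matrix.mul_assoc B, hBV]
        simp
      rw [e2, hg, Matrix.mul_add, Matrix.mul_smul, h.base_mul_isometry, Matrix.mul_sub,
        Matrix.sub_mul, Matrix.mul_one, stretch_mul hQQ, ← sq, sub_sub]
      congr 1
      rw [Matrix.mul_add, Matrix.add_mul, stretch_mul_mul_stretch _ (c * B), Matrix.mul_smul,
        Matrix.mul_smul, stretch_mul_self hQQ, Matrix.smul_mul, Matrix.smul_mul,
        Matrix.smul_mul, mul_stretch hQQ, smul_smul, smul_smul, smul_smul]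
      have e5 : τ⁻¹ ^ 2 * (α * (τ * τ)) = α := by field_simp
      simp only [Matrix.sub_mul, Matrix.mul_sub, Matrix.one_mul, Matrix.mul_one, e3, e4,
        Matrix.zero_mul]
      rw [mul_assoc, mul_assoc, e5]
      simp
    have e2 : ContinuousAt (fun τ => K τ w₁) 0 := hKc continuousAt_id continuousAt_const hD₁
    have e3 : ContinuousAt
        (fun τ : ℂ => K τ w₁ * (stretch (Vᴴ * V) (τ ^ 2) - c * B - α • (Vᴴ * V))) 0 :=
      e2.mul ((((continuous_stretch _).comp (continuous_pow 2)).sub continuous_const).sub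
        continuous_const).continuousAt
    have e4 := tendsto_nhds_unique ((e3.tendsto.mono_left nhdsWithin_le_nhds).congr' e1)
      tendsto_const_nhds
    have e5 := congrArg det e4
    rw [det_mul, det_one] at e5
    exact left_ne_zero_of_mul_eq_one e5
  have hW : Continuous fun ζ : ℂ => w₁ + ζ • (w - w₁) := by fun_prop
  have hWs : ∀ ζ : ℂ, (w₁ + ζ • (w - w₁))ᵀ = w₁ + ζ • (w - w₁) := fun ζ => by
    rw [transpose_add, transpose_smul, transpose_sub, hw, hw₁s]
  have hW0 : w₁ + (0 : ℂ) • (w - w₁) = w₁ := by simp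
  have hWD : ContinuousAt (fun ζ : ℂ => stretch (eMat i) (0 ^ 2) - a * (w₁ + ζ • (w - w₁))) 0 :=
    (continuous_const.sub (continuous_const.mul hW)).continuousAt
  have hWK : ContinuousAt (fun ζ : ℂ => K 0 (w₁ + ζ • (w - w₁))) 0 :=
    hKc continuousAt_const hW.continuousAt (by rwa [hW0])
  have hev : ∀ᶠ ζ : ℂ in 𝓝 0,
      g (stretch (eMat i) t * (w₁ + ζ • (w - w₁)) * stretch (eMat i) t)
        = stretch (V * Vᴴ) t * g (w₁ + ζ • (w - w₁)) * stretch (Vᴴ * V) t := by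
    filter_upwards [hWD.eventually_det_ne_zero (by rwa [hW0]),
      hWK.eventually_det_ne_zero (by rwa [hW0])] with ζ h1 h2
    exact hconst (hWs ζ) h1 h2
  have hl := differentiable_line w₁ (w - w₁)
  have hc : ∀ (A : CMat m), Differentiable ℂ fun _ : ℂ => A := fun A => differentiable_const A
  have hc' : ∀ (A : CMat n), Differentiable ℂ fun _ : ℂ => A := fun A => differentiable_const A
  have hd1 := h.conj.poly_left.differentiable_comp
    (((hc' (stretch (eMat i) t)).matrix_mul hl).matrix_mul (hc' (stretch (eMat i) t)))
  have hd2 := ((hc (stretch (V * Vᴴ) t)).matrix_mul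
    (h.conj.poly_left.differentiable_comp hl)).matrix_mul (hc (stretch (Vᴴ * V) t))
  have := congrFun (hd1.eq_of_eventually hd2 hev) 1
  have e : w₁ + (1 : ℂ) • (w - w₁) = w := by module
  simpa only [e] using this

end ScalingLimit

section Frame

variable {n m : ℕ}

open Filter Topology

/-- A map linked to another one is affine in the corresponding diagonal variable. -/
theorem Linked.apply_add {g P : CMat n → CMat m} {a : CMat n} {c : CMat m} {i : Fin n} {α : ℂ}
    {V : CMat m} (h : Linked g P a c i α V) {w : CMat n} (hw : wᵀ = w) (ζ : ℂ) :
    g (w + ζ • eMat i) = g w + ζ • V := by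
  have he := eMat_mul_self i
  have hV := h.isometry
  have hV' := partialIsometry_conjTranspose hV
  have hQQ : Vᴴ * V * (Vᴴ * V) = Vᴴ * V := by rw [← Matrix.mul_assoc, hV']
  have hQQ' : V * Vᴴ * (V * Vᴴ) = V * Vᴴ := by rw [← Matrix.mul_assoc, hV]
  obtain ⟨G, hGf, hG⟩ := h.fixes_left.exists_factor h.conj.poly_left h.conj.symm_left h.symm
    hV h.flat_left 1
  have key : ∀ s : ℂ, s ≠ 0 → G s⁻¹ w = g (w + s ^ 2 • eMat i) + (-s ^ 2) • V := by
    intro s hs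
    have hs' := inv_ne_zero hs
    have hws : (w + s ^ 2 • eMat i)ᵀ = w + s ^ 2 • eMat i := by
      rw [transpose_add, transpose_smul, hw, eMat_transpose]
    have e1 := h.apply_stretch hws s⁻¹
    have e2 : stretch (eMat i) s⁻¹ * (w + s ^ 2 • eMat i) * stretch (eMat i) s⁻¹
        = (1 : ℂ) • eMat i + stretch (eMat i) s⁻¹ * w * stretch (eMat i) s⁻¹ := by
      rw [Matrix.mul_add, Matrix.mul_smul, stretch_mul_self he, Matrix.add_mul, Matrix.smul_mul,
        Matrix.smul_mul, mul_stretch he, smul_smul, smul_smul, add_comm]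
      congr 2
      field_simp
    rw [e2, hG _ _ hw] at e1
    have e3 : stretch (V * Vᴴ) s * V = s • V := by
      rw [stretch, Matrix.add_mul, Matrix.one_mul, Matrix.smul_mul, hV]
      module
    have e4 : V * stretch (Vᴴ * V) s = s • V := by
      rw [stretch, Matrix.mul_add, Matrix.mul_one, Matrix.mul_smul, ← Matrix.mul_assoc, hV]
      module
    have e5 : ∀ Y : CMat m, stretch (V * Vᴴ) s * (stretch (V * Vᴴ) s⁻¹ * Y
        * stretch (Vᴴ * V) s⁻¹) * stretch (Vᴴ * V) s = Y := fun Y => by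
      calc _ = stretch (V * Vᴴ) s * stretch (V * Vᴴ) s⁻¹ * Y
            * (stretch (Vᴴ * V) s⁻¹ * stretch (Vᴴ * V) s) := by simp only [Matrix.mul_assoc]
        _ = Y := by
            rw [stretch_mul_inv hQQ' hs, stretch_inv_mul hQQ hs, Matrix.one_mul, Matrix.mul_one]
    have e6 := congrArg (fun Y => stretch (V * Vᴴ) s * Y * stretch (Vᴴ * V) s) e1
    simp only [e5, one_smul] at e6
    rw [Matrix.mul_add, Matrix.add_mul, e5, e3, Matrix.smul_mul, e4, smul_smul] at e6
    rw [← e6, sq]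
    module
  have hev : Tendsto (fun s : ℂ => g (w + s ^ 2 • eMat i) + (-s ^ 2) • V) (cocompact ℂ)
      (𝓝 (G 0 w)) := by
    have e1 : Tendsto (fun s : ℂ => G s⁻¹ w) (cocompact ℂ) (𝓝 (G 0 w)) := by
      rw [← Metric.cobounded_eq_cocompact]
      have e2 : Continuous fun τ : ℂ => G τ w := hGf.continuous.comp (Continuous.prodMk_left w)
      exact (e2.tendsto 0).comp tendsto_inv₀_cobounded
    refine e1.congr' ?_
    filter_upwards [(isCompact_singleton (x := (0 : ℂ))).compl_mem_cocompact] with s hs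
    exact key s hs
  obtain ⟨s, hs⟩ : ∃ s : ℂ, s ^ 2 = ζ := IsAlgClosed.exists_pow_nat_eq ζ two_pos
  have hd : Differentiable ℂ fun s : ℂ => g (w + s ^ 2 • eMat i) + (-s ^ 2) • V := by
    have e1 : Differentiable ℂ fun s : ℂ => w + s ^ 2 • eMat i :=
      (differentiable_line w (eMat i)).comp (differentiable_id.pow 2)
    have e2 : Differentiable ℂ fun s : ℂ => (-s ^ 2) • V :=
      (differentiable_id.pow 2).neg.smul_const V
    exact (h.conj.poly_left.differentiable_comp e1).add e2
  have e1 : ∀ j k, g (w + s ^ 2 • eMat i) j k + -s ^ 2 * V j k = g w j k := fun j k => by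
    have hd' : Differentiable ℂ fun s : ℂ => (g (w + s ^ 2 • eMat i) + (-s ^ 2) • V) j k :=
      differentiable_matrix_iff.1 hd j k
    have ht := ((continuous_id.matrix_elem j k).tendsto _).comp hev
    have := (hd'.apply_eq_of_tendsto_cocompact s ht).trans
      (hd'.apply_eq_of_tendsto_cocompact 0 ht).symm
    simpa using this
  ext j k
  rw [← hs, Matrix.add_apply, ← e1, Matrix.smul_apply, smul_eq_mul]
  ring

/-- The product of commuting stretchings. -/
def multiStretch (S : Finset (Fin n)) (Q : Fin n → CMat m) (t : Fin n → ℂ) : CMat m :=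
  1 + ∑ i ∈ S, (t i - 1) • Q i

lemma multiStretch_insert {S : Finset (Fin n)} {Q : Fin n → CMat m} {j : Fin n} (hj : j ∉ S)
    (h : ∀ i ∈ S, Q j * Q i = 0) (t : Fin n → ℂ) :
    multiStretch (insert j S) Q t = stretch (Q j) (t j) * multiStretch S Q t := by
  have e : (t j - 1) • Q j * ∑ i ∈ S, (t i - 1) • Q i = 0 := by
    rw [Finset.mul_sum]
    refine Finset.sum_eq_zero fun i hi => ?_
    rw [Matrix.smul_mul, Matrix.mul_smul, h i hi, smul_zero, smul_zero]
  rw [multiStretch, multiStretch, stretch, Finset.sum_insert hj, Matrix.add_mul, Matrix.one_mul,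
    Matrix.mul_add, Matrix.mul_one, e]
  abel

lemma multiStretch_insert' {S : Finset (Fin n)} {Q : Fin n → CMat m} {j : Fin n} (hj : j ∉ S)
    (h : ∀ i ∈ S, Q i * Q j = 0) (t : Fin n → ℂ) :
    multiStretch (insert j S) Q t = multiStretch S Q t * stretch (Q j) (t j) := by
  have e : (∑ i ∈ S, (t i - 1) • Q i) * (t j - 1) • Q j = 0 := by
    rw [Finset.sum_mul]
    refine Finset.sum_eq_zero fun i hi => ?_
    rw [Matrix.smul_mul, Matrix.mul_smul, h i hi, smul_zero, smul_zero]
  rw [multiStretch, multiStretch, stretch, Finset.sum_insert hj, Matrix.mul_add, Matrix.mul_one,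
    Matrix.add_mul, Matrix.one_mul, e]
  abel

lemma multiStretch_mul_of_orthogonal {S : Finset (Fin n)} {Q : Fin n → CMat m} {j : Fin n}
    (hj : j ∈ S) {X : CMat m} (hX : Q j * X = X) (h : ∀ i ∈ S, i ≠ j → Q i * X = 0)
    (t : Fin n → ℂ) : multiStretch S Q t * X = t j • X := by
  rw [multiStretch, Matrix.add_mul, Matrix.one_mul, Finset.sum_mul, Finset.sum_eq_single j,
    Matrix.smul_mul, hX]
  · module
  · intro i hi hij
    rw [Matrix.smul_mul, h i hi hij, smul_zero]
  · exact fun h' => absurd hj h'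

lemma mul_multiStretch_of_orthogonal {S : Finset (Fin n)} {Q : Fin n → CMat m} {j : Fin n}
    (hj : j ∈ S) {X : CMat m} (hX : X * Q j = X) (h : ∀ i ∈ S, i ≠ j → X * Q i = 0)
    (t : Fin n → ℂ) : X * multiStretch S Q t = t j • X := by
  rw [multiStretch, Matrix.mul_add, Matrix.mul_one, Finset.mul_sum, Finset.sum_eq_single j,
    Matrix.mul_smul, hX]
  · module
  · intro i hi hij
    rw [Matrix.mul_smul, h i hi hij, smul_zero]
  · exact fun h' => absurd hj h'

lemma eMat_mul_eMat_of_ne {i j : Fin n} (h : i ≠ j) : eMat i * eMat j = 0 := by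
  simp [eMat, h]

lemma multiStretch_eMat_symm {S : Finset (Fin n)} {w : CMat n} (hw : wᵀ = w) (t : Fin n → ℂ) :
    (multiStretch S eMat t * w * multiStretch S eMat t)ᵀ
      = multiStretch S eMat t * w * multiStretch S eMat t := by
  have e : (multiStretch S eMat t)ᵀ = multiStretch S (eMat (n := n)) t := by
    simp [multiStretch, transpose_sum, eMat_transpose]
  rw [transpose_mul, transpose_mul, e, hw, Matrix.mul_assoc]

/-- Conjugate maps linked through an orthogonal family of partial isometries. -/
structure LinkedFrame (g P : CMat n → CMat m) (a : CMat n) (c : CMat m) (S : Finset (Fin n))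
    (α : Fin n → ℂ) (V : Fin n → CMat m) : Prop where
  conj : MobiusConj g P a c
  linked : ∀ i ∈ S, Linked g P a c i (α i) (V i)
  orth_left : ∀ i ∈ S, ∀ j ∈ S, i ≠ j → (V i)ᴴ * V j = 0
  orth_right : ∀ i ∈ S, ∀ j ∈ S, i ≠ j → V i * (V j)ᴴ = 0
  base_eq : a = ∑ i ∈ S, α i • eMat i
  value_eq : c = ∑ i ∈ S, α i • V i
  value_eq' : c = ∑ i ∈ S, α i • (V i)ᴴ

variable {g P : CMat n → CMat m} {a : CMat n} {c : CMat m} {S : Finset (Fin n)} {α : Fin n → ℂ}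
  {V : Fin n → CMat m}

lemma LinkedFrame.swap (h : LinkedFrame g P a c S α V) :
    LinkedFrame P g (-a) (-c) S (fun i => -α i) V where
  conj := h.conj.swap
  linked i hi := (h.linked i hi).swap
  orth_left := h.orth_left
  orth_right := h.orth_right
  base_eq := by rw [h.base_eq]; simp
  value_eq := by rw [h.value_eq]; simp
  value_eq' := by rw [h.value_eq']; simp

lemma LinkedFrame.apply_add_base (h : LinkedFrame g P a c S α V) {w : CMat n} (hw : wᵀ = w) :
    g (w + a) = g w + c := by
  have key : ∀ T ⊆ S, g (w + ∑ i ∈ T, α i • eMat i) = g w + ∑ i ∈ T, α i • V i := by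
    intro T
    induction T using Finset.induction_on with
    | empty => simp
    | insert j T hj ih =>
      intro hT
      have hs : (w + ∑ i ∈ T, α i • eMat i)ᵀ = w + ∑ i ∈ T, α i • eMat i := by
        simp [transpose_sum, eMat_transpose, hw]
      rw [Finset.sum_insert hj, Finset.sum_insert hj, add_comm (α j • eMat j), ← add_assoc,
        (h.linked j (hT (Finset.mem_insert_self j T))).apply_add hs,
        ih ((Finset.subset_insert j T).trans hT)]
      abel
  rw [h.base_eq, key S subset_rfl, ← h.value_eq]

lemma LinkedFrame.apply_multiStretch (h : LinkedFrame g P a c S α V) {w : CMat n} (hw : wᵀ = w)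
    (t : Fin n → ℂ) :
    g (multiStretch S eMat t * w * multiStretch S eMat t)
      = multiStretch S (fun i => V i * (V i)ᴴ) t * g w
        * multiStretch S (fun i => (V i)ᴴ * V i) t := by
  have key : ∀ T ⊆ S, g (multiStretch T eMat t * w * multiStretch T eMat t)
      = multiStretch T (fun i => V i * (V i)ᴴ) t * g w
        * multiStretch T (fun i => (V i)ᴴ * V i) t := by
    intro T
    induction T using Finset.induction_on with
    | empty => simp [multiStretch]
    | insert j T hj ih =>
      intro hT
      have hjS := hT (Finset.mem_insert_self j T)
      have hTS := (Finset.subset_insert j T).trans hT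
      have hne : ∀ i ∈ T, i ≠ j := fun i hi => ne_of_mem_of_not_mem hi hj
      have e1 : ∀ i ∈ T, V j * (V j)ᴴ * (V i * (V i)ᴴ) = 0 := fun i hi => by
        rw [Matrix.mul_assoc, ← Matrix.mul_assoc (V j)ᴴ,
          h.orth_left j hjS i (hTS hi) (hne i hi).symm, Matrix.zero_mul, Matrix.mul_zero]
      have e2 : ∀ i ∈ T, (V i)ᴴ * V i * ((V j)ᴴ * V j) = 0 := fun i hi => by
        rw [Matrix.mul_assoc, ← Matrix.mul_assoc (V i),
          h.orth_right i (hTS hi) j hjS (hne i hi), Matrix.zero_mul, Matrix.mul_zero]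
      have e3 : ∀ i ∈ T, eMat j * eMat i = 0 := fun i hi => eMat_mul_eMat_of_ne (hne i hi).symm
      have e4 : ∀ i ∈ T, eMat i * eMat j = 0 := fun i hi => eMat_mul_eMat_of_ne (hne i hi)
      have e5 : multiStretch (insert j T) eMat t * w * multiStretch (insert j T) eMat t
          = stretch (eMat j) (t j) * (multiStretch T eMat t * w * multiStretch T eMat t)
            * stretch (eMat j) (t j) := by
        have e6 := multiStretch_insert hj e3 t
        rw [Matrix.mul_assoc, ← Matrix.mul_assoc]
        nth_rw 2 [multiStretch_insert' hj e4]
        rw [e6]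
        simp only [Matrix.mul_assoc]
      rw [e5, (h.linked j hjS).apply_stretch (multiStretch_eMat_symm hw t), ih hTS,
        multiStretch_insert hj e1, multiStretch_insert' hj e2]
      simp only [Matrix.mul_assoc]
  exact key S subset_rfl

end Frame

section Core

variable {n m : ℕ}

open Filter Topology

lemma multiStretch_mul {S : Finset (Fin n)} {Q : Fin n → CMat m} (hQ : ∀ i ∈ S, Q i * Q i = Q i)
    (h : ∀ i ∈ S, ∀ j ∈ S, i ≠ j → Q i * Q j = 0) (s t : Fin n → ℂ) :
    multiStretch S Q s * multiStretch S Q t = multiStretch S Q (s * t) := by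
  have e : multiStretch S Q s * ∑ i ∈ S, (t i - 1) • Q i = ∑ i ∈ S, ((t i - 1) * s i) • Q i := by
    rw [Finset.mul_sum]
    refine Finset.sum_congr rfl fun j hj => ?_
    rw [Matrix.mul_smul, multiStretch_mul_of_orthogonal hj (hQ j hj) fun i hi hij => h i hi j hj hij,
      smul_smul]
  conv_lhs => rw [multiStretch.eq_1 S Q t]
  rw [Matrix.mul_add, Matrix.mul_one, e, multiStretch, multiStretch, add_assoc,
    ← Finset.sum_add_distrib]
  congr 1
  refine Finset.sum_congr rfl fun j _ => ?_
  rw [Pi.mul_apply]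
  module

lemma multiStretch_mul_inv {S : Finset (Fin n)} {Q : Fin n → CMat m}
    (hQ : ∀ i ∈ S, Q i * Q i = Q i) (h : ∀ i ∈ S, ∀ j ∈ S, i ≠ j → Q i * Q j = 0) {t : ℂ}
    (ht : t ≠ 0) : multiStretch S Q (fun _ => t) * multiStretch S Q (fun _ => t⁻¹) = 1 := by
  rw [multiStretch_mul hQ h]
  simp [multiStretch, ht]

section

variable {g P : CMat n → CMat m} {a : CMat n} {c : CMat m} {S : Finset (Fin n)} {α : Fin n → ℂ}
  {V : Fin n → CMat m}

lemma LinkedFrame.rel_smul (h : LinkedFrame g P a c S α V) {w : CMat n} (hw : wᵀ = w) {t : ℂ}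
    (ht : t ≠ 0) (hdet : (1 - (t ^ 2 • a) * w).det ≠ 0) :
    P (w * (1 - (t ^ 2 • a) * w)⁻¹) * (1 - t ^ 2 • (c * g w)) = g w := by
  have hE : ∀ i ∈ S, eMat i * eMat i = eMat i := fun i _ => eMat_mul_self i
  have hE' : ∀ i ∈ S, ∀ j ∈ S, i ≠ j → eMat i * eMat j = 0 := fun i _ j _ => eMat_mul_eMat_of_ne
  have hL : ∀ i ∈ S, (V i)ᴴ * V i * ((V i)ᴴ * V i) = (V i)ᴴ * V i := fun i hi => by
    rw [← Matrix.mul_assoc, partialIsometry_conjTranspose (h.linked i hi).isometry]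
  have hL' : ∀ i ∈ S, ∀ j ∈ S, i ≠ j → (V i)ᴴ * V i * ((V j)ᴴ * V j) = 0 := fun i hi j hj hij => by
    rw [Matrix.mul_assoc, ← Matrix.mul_assoc (V i), h.orth_right i hi j hj hij, Matrix.zero_mul,
      Matrix.mul_zero]
  have hR : ∀ i ∈ S, V i * (V i)ᴴ * (V i * (V i)ᴴ) = V i * (V i)ᴴ := fun i hi => by
    rw [← Matrix.mul_assoc, (h.linked i hi).isometry]
  have hR' : ∀ i ∈ S, ∀ j ∈ S, i ≠ j → V i * (V i)ᴴ * (V j * (V j)ᴴ) = 0 := fun i hi j hj hij => by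
    rw [Matrix.mul_assoc, ← Matrix.mul_assoc (V i)ᴴ, h.orth_left i hi j hj hij, Matrix.zero_mul,
      Matrix.mul_zero]
  have hδ := multiStretch_mul_inv hE hE' ht
  have hδl := multiStretch_mul_inv hL hL' ht
  have hδr := mul_eq_one_comm.1 (multiStretch_mul_inv hR hR' ht)
  have hgδ := h.apply_multiStretch hw fun _ => t
  have hPδ := fun x hx => h.swap.apply_multiStretch (w := x) hx fun _ => t
  have hδs := multiStretch_eMat_symm (S := S) hw fun _ => t
  have hδa : multiStretch S eMat (fun _ => t) * a = t • a := by
    rw [h.base_eq, Finset.mul_sum, Finset.smul_sum]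
    refine Finset.sum_congr rfl fun j hj => ?_
    rw [Matrix.mul_smul, multiStretch_mul_of_orthogonal hj (hE j hj) fun i hi hij =>
      hE' i hi j hj hij, smul_comm]
  have haδ : a * multiStretch S eMat (fun _ => t) = t • a := by
    rw [h.base_eq, Finset.sum_mul, Finset.smul_sum]
    refine Finset.sum_congr rfl fun j hj => ?_
    rw [Matrix.smul_mul, mul_multiStretch_of_orthogonal hj (hE j hj) fun i hi hij =>
      hE' j hj i hi hij.symm, smul_comm]
  have hcl : multiStretch S (fun i => (V i)ᴴ * V i) (fun _ => t) * c = t • c := by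
    rw [h.value_eq', Finset.mul_sum, Finset.smul_sum]
    refine Finset.sum_congr rfl fun j hj => ?_
    rw [Matrix.mul_smul, multiStretch_mul_of_orthogonal hj
      (partialIsometry_conjTranspose (h.linked j hj).isometry) fun i hi hij => ?_, smul_comm]
    rw [Matrix.mul_assoc, h.orth_right i hi j hj hij, Matrix.mul_zero]
  have hcr : c * multiStretch S (fun i => V i * (V i)ᴴ) (fun _ => t) = t • c := by
    rw [h.value_eq', Finset.sum_mul, Finset.smul_sum]
    refine Finset.sum_congr rfl fun j hj => ?_
    rw [Matrix.smul_mul, mul_multiStretch_of_orthogonal hj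
      (by rw [← Matrix.mul_assoc, partialIsometry_conjTranspose (h.linked j hj).isometry])
      fun i hi hij => ?_, smul_comm]
    rw [← Matrix.mul_assoc, h.orth_left j hj i hi hij.symm, Matrix.zero_mul]
  set δ := multiStretch S eMat fun _ => t
  set δl := multiStretch S (fun i => (V i)ᴴ * V i) fun _ => t
  set δr := multiStretch S (fun i => V i * (V i)ᴴ) fun _ => t
  set ε := multiStretch S eMat fun _ => t⁻¹
  set εl := multiStretch S (fun i => (V i)ᴴ * V i) fun _ => t⁻¹
  set εr := multiStretch S (fun i => V i * (V i)ᴴ) fun _ => t⁻¹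
  have hδ' : ε * δ = 1 := mul_eq_one_comm.1 hδ
  have hN := mul_nonsing_inv _ (isUnit_iff_ne_zero.2 hdet)
  have hxs := transpose_mul_one_sub_inv_of_det_ne_zero (a := t ^ 2 • a)
    (by rw [transpose_smul, h.conj.symm_base]) hw hdet
  set N := 1 - (t ^ 2 • a) * w with hNdef
  have h1 : 1 - a * (δ * w * δ) = ε * N * δ := by
    have e1 : δ * (a * (δ * w * δ)) = (t ^ 2 • a) * w * δ := by
      rw [Matrix.mul_assoc δ, ← Matrix.mul_assoc a, haδ, Matrix.smul_mul, Matrix.mul_smul,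
        ← Matrix.mul_assoc, hδa]
      simp only [Matrix.smul_mul, smul_smul, sq, Matrix.mul_assoc]
    calc 1 - a * (δ * w * δ) = ε * δ - ε * δ * (a * (δ * w * δ)) := by
          rw [hδ', Matrix.one_mul]
      _ = ε * δ - ε * ((t ^ 2 • a) * w * δ) := by rw [Matrix.mul_assoc ε δ, e1]
      _ = _ := by rw [hNdef]; noncomm_ring
  have h2 : (1 - a * (δ * w * δ)) * (ε * N⁻¹ * δ) = 1 := by
    rw [h1]
    calc _ = ε * N * (δ * ε) * N⁻¹ * δ := by simp only [Matrix.mul_assoc]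
      _ = ε * (N * N⁻¹) * δ := by rw [hδ, Matrix.mul_one]; simp only [Matrix.mul_assoc]
      _ = 1 := by rw [hN, Matrix.mul_one, hδ']
  have hdet' : (1 - a * (δ * w * δ)).det ≠ 0 := fun h0 => by
    have := congrArg det h2
    rw [det_mul, h0, zero_mul, det_one] at this
    exact zero_ne_one this
  have hr := h.conj.rel _ hδs hdet'
  have h3 : δ * w * δ * (ε * N⁻¹ * δ) = δ * (w * N⁻¹) * δ := by
    calc _ = δ * w * (δ * ε) * N⁻¹ * δ := by simp only [Matrix.mul_assoc]
      _ = _ := by rw [hδ, Matrix.mul_one]; simp only [Matrix.mul_assoc]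
  rw [inv_eq_right_inv h2, h3, hPδ _ hxs, hgδ] at hr
  have h4 : c * (δr * g w * δl) = t • (c * g w * δl) := by
    rw [← Matrix.mul_assoc, ← Matrix.mul_assoc, hcr]
    simp only [Matrix.smul_mul]
  have h5 : δl * (c * g w * δl) = t • (c * g w * δl) := by
    rw [← Matrix.mul_assoc, ← Matrix.mul_assoc, hcl]
    simp only [Matrix.smul_mul]
  have h6 : δr * (P (w * N⁻¹) * (1 - t ^ 2 • (c * g w))) * δl = δr * g w * δl := by
    rw [← hr, h4, Matrix.mul_assoc (δr * P (w * N⁻¹)) δl, Matrix.mul_sub δl, Matrix.mul_smul δl, h5,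
      Matrix.mul_one, smul_smul, ← sq, Matrix.mul_assoc δr, Matrix.mul_assoc, Matrix.mul_assoc,
      Matrix.mul_assoc, Matrix.sub_mul, Matrix.one_mul, Matrix.smul_mul, Matrix.mul_assoc c]
  have h7 : ∀ X : CMat m, X = εr * (δr * X * δl) * εl := fun X => by
    calc X = (εr * δr) * X * (δl * εl) := by rw [hδr, hδl, Matrix.one_mul, Matrix.mul_one]
      _ = _ := by simp only [Matrix.mul_assoc]
  rw [h7 (P (w * N⁻¹) * _), h6, ← h7]

/-- Conjugate maps linked through a full frame coincide. -/
theorem LinkedFrame.eq (h : LinkedFrame g P a c S α V) {w : CMat n} (hw : wᵀ = w) : P w = g w := by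
  have hN : Continuous fun t : ℂ => 1 - (t ^ 2 • a) * w := by fun_prop
  have hN0 : (1 - (((0 : ℂ) ^ 2) • a) * w).det ≠ 0 := by simp
  have h1 : ContinuousAt (fun t : ℂ => P (w * (1 - (t ^ 2 • a) * w)⁻¹) * (1 - t ^ 2 • (c * g w)))
      0 := by
    refine ContinuousAt.mul ?_ (Continuous.continuousAt (by fun_prop))
    exact ContinuousAt.comp h.conj.poly_right.continuous.continuousAt
      (continuousAt_const.mul (hN.continuousAt.matrix_inv hN0))
  have h2 : ∀ᶠ t : ℂ in 𝓝[≠] 0,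
      P (w * (1 - (t ^ 2 • a) * w)⁻¹) * (1 - t ^ 2 • (c * g w)) = g w := by
    filter_upwards [self_mem_nhdsWithin,
      (hN.continuousAt.eventually_det_ne_zero hN0).filter_mono nhdsWithin_le_nhds] with t ht hd
    exact h.rel_smul hw ht hd
  have h3 := tendsto_nhds_unique ((h1.tendsto.mono_left nhdsWithin_le_nhds).congr' h2)
    tendsto_const_nhds
  rw [← h3]
  simp

end

lemma exists_linkedFrame {f g : CMat n → CMat m} {α : Fin n → ℝ} {β : Fin m → ℝ}
    (hf : IsContractive f) (hg : IsContractive g)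
    (hgm : Set.MapsTo g (OmegaIII n) (OmegaIII m)) (h0 : g 0 = 0) (hα0 : ∀ i, 0 ≤ α i)
    (hα1 : ∀ i, α i < 1) (hβ : ∀ i, |β i| < 1) (hval : g (cdiag α) = cdiag β)
    (hrel : ∀ w ∈ OmegaIII n, f (mobius α w) = mobius β (g w)) :
    ∃ V, LinkedFrame g (deflate f α β) (cdiag α) (cdiag β) (Finset.univ.filter (0 < α ·))
      (fun i => (α i : ℂ)) V := by
  have hα : ∀ i, |α i| < 1 := fun i => by rw [abs_of_nonneg (hα0 i)]; exact hα1 i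
  have hconj := mobiusConj_deflate hf hg.poly hgm hβ hrel
  obtain ⟨V, hV, hc⟩ := exists_decouples hg h0 hconj hα0 hα1 hval
  have hs := hg.symm
  have hc' : cdiag β = ∑ j ∈ Finset.univ.filter (0 < α ·), (α j : ℂ) • (V j)ᴴ := by
    rw [← cdiag_conjTranspose, hc, conjTranspose_sum]
    simp
  refine ⟨V, hconj, fun i hi => ?_, fun i hi j hj hij => (hV.orthogonal hs hi hj hij).1,
    fun i hi j hj hij => (hV.orthogonal hs hi hj hij).2, ?_, hc, hc'⟩
  · obtain ⟨w, hw, B, hw0, hVB, hBV, hline⟩ := hV.base i hi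
    refine linked_deflate hf hg hconj hα hβ (hV.pos i hi) (hV.symm i hi) (hV.isometry i hi) ?_ ?_
      (hV.fixes i hi) hw hw0 hVB hBV hline
    · have := congrArg conjTranspose (hV.mul_sum hs hi)
      rw [← hc] at this
      simpa [cdiag_conjTranspose] using this
    · have := congrArg conjTranspose (hV.sum_mul hs hi)
      rw [← hc] at this
      simpa [cdiag_conjTranspose] using this
  · ext j k
    rw [Matrix.sum_apply]
    by_cases hjk : j = k
    · subst hjk
      rcases (hα0 j).eq_or_lt with h | h
      · simp [cdiag, eMat, single_apply, ← h]
      · simp [cdiag, eMat, single_apply, h]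
    · rw [cdiag, diagonal_apply_ne _ hjk, eq_comm]
      refine Finset.sum_eq_zero fun i _ => ?_
      rw [Matrix.smul_apply, eMat, single_apply, if_neg fun h => hjk (h.1.symm.trans h.2),
        smul_zero]

lemma LinkedFrame.cdiag_coSqrt_mul {g P : CMat n → CMat m} {a : CMat n} {β : Fin m → ℝ}
    {S : Finset (Fin n)} {α : Fin n → ℝ} {V : Fin n → CMat m}
    (h : LinkedFrame g P a (cdiag β) S (fun i => (α i : ℂ)) V) (hα : ∀ i, |α i| < 1) :
    cdiag (coSqrt β) * multiStretch S (fun i => V i * (V i)ᴴ) (fun i => ((coSqrt α i : ℂ))⁻¹)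
      = 1 := by
  have hV : ∀ i ∈ S, cdiag (coSqrt β) * V i = (coSqrt α i : ℂ) • V i := fun i hi => by
    refine cdiag_coSqrt_mul_of_sq ?_
    have e : cdiag β * (V i)ᴴ = (α i : ℂ) • (V i * (V i)ᴴ) := by
      rw [h.value_eq, Finset.sum_mul, Finset.sum_eq_single i, Matrix.smul_mul]
      · intro j hj hji
        rw [Matrix.smul_mul, h.orth_right j hj i hi hji, smul_zero]
      · exact fun h' => absurd hi h'
    rw [(h.linked i hi).base_mul_isometry, Matrix.mul_smul, ← Matrix.mul_assoc, e,
      Matrix.smul_mul, (h.linked i hi).isometry, smul_smul]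
    push_cast
    rw [sq]
  have hc : cdiag β * (1 - ∑ i ∈ S, V i * (V i)ᴴ) = 0 := by
    rw [Matrix.mul_sub, Matrix.mul_one, h.value_eq', sub_eq_zero, Finset.sum_mul]
    refine Finset.sum_congr rfl fun i hi => ?_
    rw [Finset.mul_sum, Finset.sum_eq_single i, Matrix.smul_mul, ← Matrix.mul_assoc,
      partialIsometry_conjTranspose (h.linked i hi).isometry]
    · intro j hj hji
      rw [Matrix.smul_mul, ← Matrix.mul_assoc, h.orth_left i hi j hj hji.symm, Matrix.zero_mul,
        smul_zero]
    · exact fun h' => absurd hi h'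
  have h0 : cdiag (coSqrt β) * (1 - ∑ i ∈ S, V i * (V i)ᴴ) = 1 - ∑ i ∈ S, V i * (V i)ᴴ := by
    rw [cdiag_coSqrt_mul_of_sq (r := 0) (by rw [hc, Matrix.mul_zero]; simp)]
    simp
  have e : multiStretch S (fun i => V i * (V i)ᴴ) (fun i => ((coSqrt α i : ℂ))⁻¹)
      = (1 - ∑ i ∈ S, V i * (V i)ᴴ) + ∑ i ∈ S, ((coSqrt α i : ℂ))⁻¹ • (V i * (V i)ᴴ) := by
    simp only [multiStretch, sub_smul, one_smul, Finset.sum_sub_distrib]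
    abel
  rw [e, Matrix.mul_add, h0, Finset.mul_sum, sub_add_eq_add_sub, sub_eq_iff_eq_add]
  congr 1
  refine Finset.sum_congr rfl fun i hi => ?_
  rw [Matrix.mul_smul, ← Matrix.mul_assoc, hV i hi, Matrix.smul_mul, smul_smul, inv_mul_cancel₀,
    one_smul]
  exact Complex.ofReal_ne_zero.2 (coSqrt_pos hα i).ne'

lemma LinkedFrame.mul_cdiag_coSqrt {g P : CMat n → CMat m} {a : CMat n} {β : Fin m → ℝ}
    {S : Finset (Fin n)} {α : Fin n → ℝ} {V : Fin n → CMat m}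
    (h : LinkedFrame g P a (cdiag β) S (fun i => (α i : ℂ)) V) (hα : ∀ i, |α i| < 1) :
    multiStretch S (fun i => (V i)ᴴ * V i) (fun i => ((coSqrt α i : ℂ))⁻¹) * cdiag (coSqrt β)
      = 1 := by
  have e := congrArg transpose (h.cdiag_coSqrt_mul hα)
  rw [transpose_mul, cdiag_transpose, transpose_one] at e
  rw [← e]
  congr 1
  simp only [multiStretch, transpose_add, transpose_one, transpose_sum, transpose_smul]
  congr 1
  refine Finset.sum_congr rfl fun i hi => ?_
  rw [transpose_mul, (h.linked i hi).symm,
    show ((V i)ᴴ)ᵀ = (V i)ᴴ from congrArg conjTranspose (h.linked i hi).symm]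

lemma multiStretch_eMat_coSqrt {α : Fin n → ℝ} (hα0 : ∀ i, 0 ≤ α i) :
    multiStretch (Finset.univ.filter (0 < α ·)) eMat (fun i => ((coSqrt α i : ℂ))⁻¹)
      = cdiag (coSqrt α)⁻¹ := by
  ext j k
  rw [multiStretch, Matrix.add_apply, Matrix.sum_apply]
  by_cases hjk : j = k
  · subst hjk
    rcases (hα0 j).eq_or_lt with h | h
    · simp [cdiag, eMat, single_apply, ← h, coSqrt]
    · simp [cdiag, eMat, single_apply, h]
  · rw [cdiag, diagonal_apply_ne _ hjk, one_apply_ne hjk, zero_add]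
    refine Finset.sum_eq_zero fun i _ => ?_
    rw [Matrix.smul_apply, eMat, single_apply, if_neg fun h => hjk (h.1.symm.trans h.2),
      smul_zero]

/-- A contractive polynomial map conjugate to `g` under the transvections `mobius α` and `mobius β`
is equal to `g`. -/
theorem eq_of_mobius_rel {f g : CMat n → CMat m} {α : Fin n → ℝ} {β : Fin m → ℝ}
    (hf : IsContractive f) (hg : IsContractive g)
    (hgm : Set.MapsTo g (OmegaIII n) (OmegaIII m)) (h0 : g 0 = 0) (hα0 : ∀ i, 0 ≤ α i)
    (hα1 : ∀ i, α i < 1) (hβ : ∀ i, |β i| < 1) (hval : g (cdiag α) = cdiag β)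
    (hrel : ∀ w ∈ OmegaIII n, f (mobius α w) = mobius β (g w)) {z : CMat n} (hz : zᵀ = z) :
    f z = g z := by
  have hα : ∀ i, |α i| < 1 := fun i => by rw [abs_of_nonneg (hα0 i)]; exact hα1 i
  obtain ⟨V, hV⟩ := exists_linkedFrame hf hg hgm h0 hα0 hα1 hβ hval hrel
  have hza : (z + cdiag α)ᵀ = z + cdiag α := by rw [transpose_add, hz, cdiag_transpose]
  have h1 := apply_eq_deflate (f := f) (α := α) hβ
    (cdiag (coSqrt α)⁻¹ * (z + cdiag α) * cdiag (coSqrt α)⁻¹)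
  rw [cdiag_mul_mul_of_inv (coSqrt_pos hα), add_sub_cancel_right,
    hV.eq (transpose_cdiag_mul_mul hza), ← multiStretch_eMat_coSqrt hα0,
    hV.apply_multiStretch hza, hV.apply_add_base hz] at h1
  have e : ∀ A B C D E : CMat m, A * (B * C * D) * E = (A * B) * C * (D * E) :=
    fun A B C D E => by simp only [Matrix.mul_assoc]
  rw [h1, e, hV.cdiag_coSqrt_mul hα, hV.mul_cdiag_coSqrt hα, Matrix.one_mul, Matrix.mul_one,
    add_sub_cancel_right]

end Core

section Reduction

variable {n m : ℕ}

lemma exists_takagi_of_mem {a : CMat n} (ha : a ∈ OmegaIII n) :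
    ∃ (U : CMat n) (α : Fin n → ℝ), Uᴴ * U = 1 ∧ (∀ i, 0 ≤ α i) ∧ (∀ i, α i < 1) ∧
      a = congrLin U (cdiag α) := by
  obtain ⟨haT, ha1⟩ := mem_OmegaIII_iff.1 ha
  obtain ⟨U, α, hU, hα, rfl⟩ := exists_takagi haT
  rw [spNorm_eq_of_unitary hU (conjTranspose_mul_transpose hU)] at ha1
  refine ⟨U, α, hU, hα, fun i => ?_, rfl⟩
  refine lt_of_le_of_lt ?_ ha1
  simpa [abs_of_nonneg (hα i)] using norm_entry_le_spNorm (diagonal fun i => (α i : ℂ)) i i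

/-- Equivalent polynomial maps fixing `0` are related by automorphisms fixing `0`. -/
theorem exists_isotropic_of_equivalent {f g : CMat n → CMat m} (hf : IsPolyMapIII f)
    (hg : IsPolyMapIII g) (hfm : Set.MapsTo f (OmegaIII n) (OmegaIII m))
    (hgm : Set.MapsTo g (OmegaIII n) (OmegaIII m)) (hf0 : f 0 = 0) (hg0 : g 0 = 0)
    {τ : CMat n → CMat n} {σ : CMat m → CMat m} (hτ : IsAutomorphismOf (OmegaIII n) τ)
    (hσ : IsAutomorphismOf (OmegaIII m) σ) (h : ∀ Z ∈ OmegaIII n, f Z = σ (g (τ Z))) :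
    ∃ (τ' : CMat n → CMat n) (σ' : CMat m → CMat m), IsAutomorphismOf (OmegaIII n) τ' ∧
      IsAutomorphismOf (OmegaIII m) σ' ∧ τ' 0 = 0 ∧ σ' 0 = 0 ∧
      ∀ Z ∈ OmegaIII n, f Z = σ' (g (τ' Z)) := by
  have ha : τ 0 ∈ OmegaIII n := hτ.1 zero_mem_OmegaIII
  obtain ⟨U, α, hU, hα0, hα1, hUα⟩ := exists_takagi_of_mem ha
  obtain ⟨W, β, hW, hβ0, hβ1, hWβ⟩ := exists_takagi_of_mem (hgm ha)
  have hα : ∀ i, |α i| < 1 := fun i => by rw [abs_of_nonneg (hα0 i)]; exact hα1 i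
  have hβ : ∀ i, |β i| < 1 := fun i => by rw [abs_of_nonneg (hβ0 i)]; exact hβ1 i
  have hβ' : ∀ i, |(-β) i| < 1 := fun i => by simpa using hβ i
  have hU' : U * Uᴴ = 1 := mul_eq_one_comm.1 hU
  have hW' : W * Wᴴ = 1 := mul_eq_one_comm.1 hW
  have hUu : Uᴴᴴ * Uᴴ = 1 := by rw [conjTranspose_conjTranspose, hU']
  have hWu : Wᴴᴴ * Wᴴ = 1 := by rw [conjTranspose_conjTranspose, hW']
  obtain ⟨L, M, hL, hM, hLτ, hML, hLM⟩ := ((isAutomorphismOf_mobius hα).comp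
    ((isAutomorphismOf_congrLin hUu).comp hτ)).exists_linear
    (by rw [hUα, congrLin_congrLin hU, mobius_cdiag hα])
  obtain ⟨L', M', hL', hM', hLσ, hML', hLM'⟩ := (hσ.comp ((isAutomorphismOf_congrLin hW).comp
    (isAutomorphismOf_mobius hβ'))).exists_linear
    (by rw [mobius_zero, cdiag_neg, neg_neg, ← hWβ, ← h 0 zero_mem_OmegaIII, hf0])
  have hτL : ∀ z ∈ OmegaIII n, τ z = congrLin U (mobius (-α) (L z)) := fun z hz => by
    rw [← hLτ z hz, mobius_neg_mobius hα (congrLin_mem hUu (hτ.1 hz)), congrLin_congrLin hU']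
  have hσL : ∀ y ∈ OmegaIII m, σ y = L' (mobius β (congrLin Wᴴ y)) := fun y hy => by
    have hy' := congrLin_mem hWu hy
    rw [← hLσ _ (mobius_mem hβ hy'), mobius_neg_mobius hβ hy', congrLin_congrLin hW']
  have hrel : ∀ w ∈ OmegaIII n, M' (f (M (mobius α w)))
      = mobius β (congrLin Wᴴ (g (congrLin U w))) := fun w hw => by
    have hw' := mobius_mem hα hw
    have hg' := hgm (congrLin_mem hU hw)
    rw [h _ (hM hw'), hτL _ (hM hw'), hLM _ hw', mobius_neg_mobius hα hw, hσL _ hg',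
      hML' _ (mobius_mem hβ (congrLin_mem hWu hg'))]
  have hgm' : Set.MapsTo (fun z => congrLin Wᴴ (g (congrLin U z))) (OmegaIII n) (OmegaIII m) :=
    fun _ hz => congrLin_mem hWu (hgm (congrLin_mem hU hz))
  have hfm' : Set.MapsTo (fun z => M' (f (M z))) (OmegaIII n) (OmegaIII m) :=
    fun _ hz => hM' (hfm (hM hz))
  have hg' : IsPolyMapIII fun z => congrLin Wᴴ (g (congrLin U z)) :=
    (isPolyMapIII_linear _).comp (hg.comp (isPolyMapIII_linear _))
  have hf' : IsPolyMapIII fun z => M' (f (M z)) :=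
    (isPolyMapIII_linear _).comp (hf.comp (isPolyMapIII_linear _))
  have heq : ∀ z ∈ OmegaIII n, M' (f (M z)) = congrLin Wᴴ (g (congrLin U z)) := fun z hz =>
    eq_of_mobius_rel (isContractive_of_mapsTo hf' hfm') (isContractive_of_mapsTo hg' hgm') hgm'
      (by simp only [map_zero, hg0]) hα0 hα1 hβ
      (by rw [← hUα, hWβ, congrLin_congrLin hW]) hrel (mem_OmegaIII_iff.1 hz).1
  refine ⟨fun z => congrLin U (L z), fun z => L' (congrLin Wᴴ z),
    (isAutomorphismOf_congrLin hU).comp (isAutomorphismOf_linear L M hL hM hML hLM),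
    (isAutomorphismOf_linear L' M' hL' hM' hML' hLM').comp (isAutomorphismOf_congrLin hWu),
    by simp only [map_zero], by simp only [map_zero], fun Z hZ => ?_⟩
  change f Z = L' (congrLin Wᴴ (g (congrLin U (L Z))))
  rw [← heq _ (hL hZ), hML _ hZ, hLM' _ (hfm hZ)]

end Reduction

/-- Theorem 1.1, type III case. -/
theorem equivalent_iff_isotropically_equivalent_typeIII
    (n n' : ℕ) (hn : 1 ≤ n) (hn' : 1 ≤ n')
    (f g : Matrix (Fin n) (Fin n) ℂ → Matrix (Fin n') (Fin n') ℂ)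
    (hfpoly : IsPolyMapIII f) (hgpoly : IsPolyMapIII g)
    (hfmaps : Set.MapsTo f (OmegaIII n) (OmegaIII n'))
    (hgmaps : Set.MapsTo g (OmegaIII n) (OmegaIII n'))
    (hfproper : IsProperOn f (OmegaIII n) (OmegaIII n'))
    (hgproper : IsProperOn g (OmegaIII n) (OmegaIII n'))
    (hf0 : f 0 = 0) (hg0 : g 0 = 0) :
    (∃ τ σ, IsAutomorphismOf (OmegaIII n) τ ∧ IsAutomorphismOf (OmegaIII n') σ ∧
        ∀ Z ∈ OmegaIII n, f Z = σ (g (τ Z))) ↔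
      (∃ τ σ, IsAutomorphismOf (OmegaIII n) τ ∧ IsAutomorphismOf (OmegaIII n') σ ∧
        τ 0 = 0 ∧ σ 0 = 0 ∧ ∀ Z ∈ OmegaIII n, f Z = σ (g (τ Z))) := by
  constructor
  · rintro ⟨τ, σ, hτ, hσ, h⟩
    exact exists_isotropic_of_equivalent hfpoly hgpoly hfmaps hgmaps hf0 hg0 hτ hσ h
  · rintro ⟨τ, σ, hτ, hσ, -, -, h⟩
    exact ⟨τ, σ, hτ, hσ, h⟩
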